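/- One has G̃(12) ≤ 253, G̃(13) ≤ 299, G̃(14) ≤ 349, G̃(15) ≤ 403, G̃(16) ≤ 460, G̃(17) ≤ 521, G̃(18) ≤ 587, G̃(19) ≤ 656, and G̃(20) ≤ 729. That is, for each such pair (k, bound), whenever s is a natural number at least the stated bound, the asymptotic formula R_{s,k}(n) = Γ(1+1/k)^s·Γ(s/k)^{−1}·𝔖_{s,k}(n)·n^{s/k−1} + o(n^{s/k−1}) holds as n → ∞. -/

import Mathlib

/-- e(z) = exp(2πiz). -/
noncomputable def ec (z : ℝ) : ℂ := Complex.exp (2 * Real.pi * Complex.I * z)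

/-- R_{s,k}(n): the number of representations of n as a sum of s k-th powers of
positive integers. -/
noncomputable def Rcount (s k n : ℕ) : ℕ :=
  Set.ncard {x : Fin s → ℕ | (∀ i, 1 ≤ x i) ∧ ∑ i, (x i)^k = n}

/-- The singular series 𝔖_{s,k}(n). -/
noncomputable def singSeries (s k n : ℕ) : ℂ :=
  ∑' q : ℕ, ∑ a ∈ (Finset.Icc 1 q).filter (fun a => Nat.Coprime a q),
    ((q:ℂ)⁻¹ * ∑ x ∈ Finset.Icc 1 q, ec ((a:ℝ) * (x:ℝ)^k / (q:ℝ)))^s *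
      ec (-(n:ℝ) * (a:ℝ) / (q:ℝ))

/-- The anticipated asymptotic formula (9.2) in Waring's problem:
R_{s,k}(n) = Γ(1+1/k)^s Γ(s/k)⁻¹ 𝔖_{s,k}(n) n^{s/k-1} + o(n^{s/k-1}). -/
def AsympFormula (s k : ℕ) : Prop :=
  Asymptotics.IsLittleO Filter.atTop
    (fun n : ℕ => (Rcount s k n : ℂ) -
      (((Real.Gamma (1 + 1/(k:ℝ)))^s / Real.Gamma ((s:ℝ)/(k:ℝ)) : ℝ) : ℂ) *
        singSeries s k n * (((n:ℝ) ^ ((s:ℝ)/(k:ℝ) - 1) : ℝ) : ℂ))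
    (fun n : ℕ => (n:ℝ) ^ ((s:ℝ)/(k:ℝ) - 1))

section WaringAsymptotics

open Finset

/-- Minkowski's inequality for finitely many nonnegative functions on a finite set. -/
theorem minkowski_finset_sum {Ω ι : Type*} (s : Finset Ω) (T : Finset ι) {t : ℝ} (ht : 1 ≤ t)
    (a : ι → Ω → ℝ) (ha : ∀ ξ ω, 0 ≤ a ξ ω) :
    (∑ ω ∈ s, (∑ ξ ∈ T, a ξ ω) ^ t) ^ (1 / t) ≤ ∑ ξ ∈ T, (∑ ω ∈ s, (a ξ ω) ^ t) ^ (1 / t) := by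
  classical
  induction T using Finset.induction_on with
  | empty =>
    have h0 : t ≠ 0 := by linarith
    simp [Real.zero_rpow h0, Real.zero_rpow (inv_ne_zero h0)]
  | insert b T hb ih =>
    simp only [Finset.sum_insert hb]
    refine (Real.Lp_add_le_of_nonneg s ht (fun i _ => ha b i)
      (fun i _ => Finset.sum_nonneg fun ξ _ => ha ξ i)).trans ?_
    gcongr

/-- The weighted `L^t` norm of a function on a finite type. -/
noncomputable def wnorm {Ω : Type*} [Fintype Ω] (t : ℕ) (w g : Ω → ℝ) : ℝ :=
  (∑ ω, w ω * g ω ^ t) ^ (1 / (t : ℝ))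

section wnorm
variable {Ω ι : Type*} [Fintype Ω] {t : ℕ} {w : Ω → ℝ}

theorem wnorm_nonneg (hw : ∀ ω, 0 ≤ w ω) {g : Ω → ℝ} (hg : ∀ ω, 0 ≤ g ω) : 0 ≤ wnorm t w g :=
  Real.rpow_nonneg (Finset.sum_nonneg fun ω _ => mul_nonneg (hw ω) (pow_nonneg (hg ω) _)) _

theorem wnorm_pow (ht : t ≠ 0) (hw : ∀ ω, 0 ≤ w ω) {g : Ω → ℝ} (hg : ∀ ω, 0 ≤ g ω) :
    wnorm t w g ^ t = ∑ ω, w ω * g ω ^ t := by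
  rw [wnorm, one_div]
  exact Real.rpow_inv_natCast_pow
    (Finset.sum_nonneg fun ω _ => mul_nonneg (hw ω) (pow_nonneg (hg ω) _)) ht

theorem wnorm_sum_le (ht : t ≠ 0) (hw : ∀ ω, 0 ≤ w ω) (T : Finset ι) {g : ι → Ω → ℝ}
    (hg : ∀ ξ ω, 0 ≤ g ξ ω) :
    wnorm t w (fun ω => ∑ ξ ∈ T, g ξ ω) ≤ ∑ ξ ∈ T, wnorm t w (g ξ) := by
  have ht0 : (t : ℝ) ≠ 0 := by exact_mod_cast ht
  have h := minkowski_finset_sum Finset.univ T (t := t)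
    (by exact_mod_cast Nat.one_le_iff_ne_zero.2 ht)
    (fun ξ ω => w ω ^ (1 / (t : ℝ)) * g ξ ω)
    (fun ξ ω => mul_nonneg (Real.rpow_nonneg (hw ω) _) (hg ξ ω))
  have key : ∀ ω, ∀ y : ℝ, 0 ≤ y → (w ω ^ (1 / (t : ℝ)) * y) ^ (t : ℝ) = w ω * y ^ t := by
    intro ω y hy
    rw [Real.mul_rpow (Real.rpow_nonneg (hw ω) _) hy, ← Real.rpow_mul (hw ω),
      one_div, inv_mul_cancel₀ ht0, Real.rpow_one, Real.rpow_natCast]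
  simp only [← Finset.mul_sum] at h
  simp only [wnorm]
  refine le_trans (le_of_eq ?_) (h.trans (le_of_eq ?_))
  · congr 1
    exact Finset.sum_congr rfl fun ω _ => (key ω _ (Finset.sum_nonneg fun ξ _ => hg ξ ω)).symm
  · refine Finset.sum_congr rfl fun ξ _ => ?_
    congr 1
    exact Finset.sum_congr rfl fun ω _ => key ω _ (hg ξ ω)

theorem wnorm_le_of_pow_le (ht : t ≠ 0) (hw : ∀ ω, 0 ≤ w ω) {g : Ω → ℝ} (hg : ∀ ω, 0 ≤ g ω)
    {B : ℝ} (hB : 0 ≤ B) (h : ∑ ω, w ω * g ω ^ t ≤ B ^ t) : wnorm t w g ≤ B := by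
  rw [← wnorm_pow ht hw hg] at h
  exact le_of_pow_le_pow_left₀ ht hB h

theorem wnorm_mono (hw : ∀ ω, 0 ≤ w ω) {g h : Ω → ℝ} (hg : ∀ ω, 0 ≤ g ω)
    (hgh : ∀ ω, g ω ≤ h ω) : wnorm t w g ≤ wnorm t w h := by
  refine Real.rpow_le_rpow
    (Finset.sum_nonneg fun ω _ => mul_nonneg (hw ω) (pow_nonneg (hg ω) _)) ?_ (by positivity)
  refine Finset.sum_le_sum fun ω _ => mul_le_mul_of_nonneg_left ?_ (hw ω)
  exact pow_le_pow_left₀ (hg ω) (hgh ω) _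

theorem wnorm_const_mul (ht : t ≠ 0) (hw : ∀ ω, 0 ≤ w ω) {g : Ω → ℝ} (hg : ∀ ω, 0 ≤ g ω)
    {K : ℝ} (hK : 0 ≤ K) : wnorm t w (fun ω => K * g ω) = K * wnorm t w g := by
  have h1 : ∀ ω, 0 ≤ K * g ω := fun ω => mul_nonneg hK (hg ω)
  refine (pow_left_inj₀ ?_ ?_ ht).1 ?_
  · exact wnorm_nonneg hw h1
  · exact mul_nonneg hK (wnorm_nonneg hw hg)
  · simp only [mul_pow]
    rw [wnorm_pow ht hw h1, wnorm_pow ht hw hg, Finset.mul_sum]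
    exact Finset.sum_congr rfl fun ω _ => by ring

end wnorm

/-- Hölder's inequality in the form needed to compare bilinear quantities. -/
theorem holder_pow_sum {Ω : Type*} (s : Finset Ω) (n : ℕ) {X A B : Ω → ℝ}
    (hX : ∀ ω, 0 ≤ X ω) (hA : ∀ ω, 0 ≤ A ω) (hB : ∀ ω, 0 ≤ B ω)
    (h : ∀ ω, X ω ^ (n + 1) = A ω ^ n * B ω) :
    (∑ ω ∈ s, X ω) ^ (n + 1) ≤ (∑ ω ∈ s, A ω) ^ n * ∑ ω ∈ s, B ω := by
  rcases Nat.eq_zero_or_pos n with rfl | hn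
  · simp only [zero_add, pow_one, pow_zero, one_mul] at h ⊢
    exact (Finset.sum_congr rfl fun ω _ => h ω).le
  have hn0 : (0 : ℝ) < n := by exact_mod_cast hn
  have hn1 : (0 : ℝ) < n + 1 := by positivity
  have hpq : Real.HolderConjugate ((n + 1 : ℝ) / n) (n + 1 : ℝ) := by
    rw [Real.holderConjugate_iff]
    constructor
    · rw [lt_div_iff₀ hn0]; linarith
    · field_simp
  have hXe : ∀ ω, X ω = A ω ^ ((n : ℝ) / (n + 1)) * B ω ^ (1 / (n + 1 : ℝ)) := by
    intro ω
    have h1 : X ω = (X ω ^ (n + 1)) ^ (1 / (n + 1 : ℝ)) := by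
      have := Real.pow_rpow_inv_natCast (hX ω) (Nat.succ_ne_zero n)
      rw [one_div]; push_cast at this; exact this.symm
    rw [h1, h ω, Real.mul_rpow (pow_nonneg (hA ω) _) (hB ω), ← Real.rpow_natCast,
      ← Real.rpow_mul (hA ω)]
    congr 2; ring
  have := Real.inner_le_Lp_mul_Lq_of_nonneg s hpq
    (f := fun ω => A ω ^ ((n : ℝ) / (n + 1))) (g := fun ω => B ω ^ (1 / (n + 1 : ℝ)))
    (fun i _ => Real.rpow_nonneg (hA i) _) (fun i _ => Real.rpow_nonneg (hB i) _)
  have hAA : ∀ ω, (A ω ^ ((n : ℝ) / (n + 1))) ^ ((n + 1 : ℝ) / n) = A ω := fun ω => by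
    rw [← Real.rpow_mul (hA ω)]
    rw [show (n : ℝ) / (n + 1) * ((n + 1 : ℝ) / n) = 1 by field_simp, Real.rpow_one]
  have hBB : ∀ ω, (B ω ^ (1 / (n + 1 : ℝ))) ^ (n + 1 : ℝ) = B ω := fun ω => by
    rw [← Real.rpow_mul (hB ω)]
    rw [show 1 / (n + 1 : ℝ) * (n + 1 : ℝ) = 1 by field_simp, Real.rpow_one]
  simp only [hAA, hBB] at this
  have hSA : 0 ≤ ∑ ω ∈ s, A ω := Finset.sum_nonneg fun ω _ => hA ω
  have hSB : 0 ≤ ∑ ω ∈ s, B ω := Finset.sum_nonneg fun ω _ => hB ω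
  calc (∑ ω ∈ s, X ω) ^ (n + 1)
      ≤ ((∑ ω ∈ s, A ω) ^ (1 / ((n + 1 : ℝ) / n)) * (∑ ω ∈ s, B ω) ^ (1 / (n + 1 : ℝ))) ^ (n + 1) := by
        refine pow_le_pow_left₀ (Finset.sum_nonneg fun ω _ => hX ω) ?_ _
        rw [Finset.sum_congr rfl fun ω _ => hXe ω]
        exact this
    _ = _ := by
        rw [mul_pow]
        congr 1
        · rw [← Real.rpow_natCast, ← Real.rpow_mul hSA, ← Real.rpow_natCast]
          congr 1; push_cast; field_simp
        · rw [← Real.rpow_natCast, ← Real.rpow_mul hSB]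
          rw [show 1 / (n + 1 : ℝ) * ((n + 1 : ℕ) : ℝ) = 1 by push_cast; field_simp, Real.rpow_one]

open Polynomial in
/-- A tuple of integer polynomials which modulo `p` consists of nonzero multiples of
`X ^ (m + 1), …, X ^ (m + l)`. -/
def MomentLike (p : ℕ) {l : ℕ} (m : ℕ) (χ : Fin l → ℤ[X]) : Prop :=
  ∀ j : Fin l, ∃ d : ZMod p, d ≠ 0 ∧
    (χ j).map (Int.castRingHom (ZMod p)) = C d * X ^ (m + j + 1)

section Taylor
open Polynomial
variable {p l m : ℕ} [Fact p.Prime]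

theorem coeff_taylor_derivative {R : Type*} [CommRing R] (P : R[X]) (u : R) (i : ℕ) :
    (taylor u (derivative P)).coeff i = (taylor u P).coeff (i + 1) * (i + 1) := by
  have : taylor u (derivative P) = derivative (taylor u P) := by
    simp [taylor_apply, derivative_comp]
  rw [this, coeff_derivative]

/-- Nonvanishing of the Wronskian of a tuple of consecutive monomials away from zero. -/
theorem taylor_matrix_det_ne_zero (hml : m + l < p) (d : Fin l → ZMod p) (hd : ∀ j, d j ≠ 0)
    (u : ZMod p) (hu : m = 0 ∨ u ≠ 0) :
    (Matrix.of fun i j : Fin l =>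
      (taylor u (C (d j) * X ^ (m + j + 1) : (ZMod p)[X])).coeff (i + 1)).det ≠ 0 := by
  intro h
  obtain ⟨w, hw, hw0⟩ := Matrix.exists_mulVec_eq_zero_iff.2 h
  apply hw
  set P : (ZMod p)[X] := ∑ j : Fin l, C (w j) * (C (d j) * X ^ (m + (j : ℕ) + 1)) with hP
  have hPc : ∀ i < l, (taylor u P).coeff (i + 1) = 0 := by
    intro i hi
    have := congrFun hw0 ⟨i, hi⟩
    simp only [Matrix.mulVec, dotProduct, Matrix.of_apply, Pi.zero_apply] at this
    rw [hP, map_sum, finsetSum_coeff, ← this]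
    refine Finset.sum_congr rfl fun j _ => ?_
    rw [taylor_mul, taylor_C, coeff_C_mul, mul_comm]
  set R : (ZMod p)[X] := ∑ j : Fin l, C (w j * d j * (m + (j : ℕ) + 1)) * X ^ (j : ℕ) with hR
  have hder : derivative P = X ^ m * R := by
    rw [hP, hR, derivative_sum, Finset.mul_sum]
    refine Finset.sum_congr rfl fun j _ => ?_
    simp only [derivative_C_mul, derivative_X_pow]
    push_cast
    simp only [map_mul, map_add, map_natCast, map_one]
    rw [pow_add]
    ring
  have hdvd : (X - C u) ^ l ∣ derivative P := by
    have h1 : X ^ l ∣ taylor u (derivative P) := by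
      rw [X_pow_dvd_iff]
      intro i hi
      rw [coeff_taylor_derivative, hPc i hi, zero_mul]
    have h2 := (taylorEquiv (-u)).toRingEquiv.toRingHom.map_dvd h1
    have h3 : taylor (-u) (taylor u (derivative P)) = derivative P := by
      rw [taylor_taylor, neg_add_cancel, taylor_zero]
    have h4 : taylor (-u) (X ^ l : (ZMod p)[X]) = (X - C u) ^ l := by
      simp [sub_eq_add_neg]
    have h5 : taylor (-u) (X ^ l : (ZMod p)[X]) ∣ taylor (-u) (taylor u (derivative P)) := h2
    rwa [h3, h4] at h5
  have hcop : IsCoprime ((X - C u) ^ l) (X ^ m : (ZMod p)[X]) := by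
    rcases hu with rfl | hu
    · simpa using isCoprime_one_right
    · apply IsCoprime.pow
      have := isCoprime_X_sub_C_of_isUnit_sub (R := ZMod p) (a := u) (b := 0)
        (by simpa using hu)
      simpa using this
  have hRd : (X - C u) ^ l ∣ R := by
    rw [hder] at hdvd
    exact hcop.dvd_of_dvd_mul_left hdvd
  have hRdeg : R.degree < l := by
    rw [degree_lt_iff_coeff_zero]
    intro n hn
    rw [hR, finsetSum_coeff]
    refine Finset.sum_eq_zero fun j _ => ?_
    have := j.2
    rw [coeff_C_mul_X_pow, if_neg (by omega)]
  have hR0 : R = 0 := by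
    by_contra hne
    have := degree_le_of_dvd hRd hne
    rw [degree_pow, degree_X_sub_C] at this
    simp only [nsmul_eq_mul, mul_one] at this
    exact absurd hRdeg (not_lt.2 this)
  funext j
  have hc : R.coeff j = w j * d j * (m + (j : ℕ) + 1) := by
    rw [hR, finsetSum_coeff, Finset.sum_eq_single j]
    · rw [coeff_C_mul_X_pow, if_pos rfl]
    · intro b _ hb
      rw [coeff_C_mul_X_pow, if_neg]
      exact fun h => hb (Fin.ext h.symm)
    · simp
  rw [hR0, coeff_zero] at hc
  have hne : (m + (j : ℕ) + 1 : ZMod p) ≠ 0 := by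
    have : ((m + j + 1 : ℕ) : ZMod p) ≠ 0 := by
      rw [Ne, ZMod.natCast_eq_zero_iff]
      intro hdv
      have := Nat.le_of_dvd (by omega) hdv
      omega
    exact_mod_cast this
  rcases mul_eq_zero.1 hc.symm with h | h
  · rcases mul_eq_zero.1 h with h | h
    · simpa using h
    · exact absurd h (hd j)
  · exact absurd h hne

/-- After an integral linear change of coordinates of determinant prime to `p`, a tuple of
polynomials agrees near `u` with a multiple of the moment curve up to order `l`. -/
theorem exists_taylor_normal_form (hml : m + l < p) {χ : Fin l → ℤ[X]} (hχ : MomentLike p m χ)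
    (u : ℤ) (hu : m = 0 ∨ ¬ (p : ℤ) ∣ u) :
    ∃ (A : Matrix (Fin l) (Fin l) ℤ) (δ : ℤ) (R : Fin l → ℤ[X]), (δ : ZMod p) ≠ 0 ∧
      ∀ i, ∑ j, C (A i j) * (taylor u (χ j) - C ((χ j).eval u)) =
        C δ * X ^ ((i : ℕ) + 1) + X ^ (l + 1) * R i := by
  choose d hd hdχ using hχ
  set T : Matrix (Fin l) (Fin l) ℤ :=
    Matrix.of fun i j : Fin l => (taylor u (χ j)).coeff ((i : ℕ) + 1) with hT
  have hdet : ((T.det : ℤ) : ZMod p) ≠ 0 := by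
    have h1 := taylor_matrix_det_ne_zero hml d hd (u : ZMod p)
      (hu.imp_right fun h => by rwa [Ne, ZMod.intCast_zmod_eq_zero_iff_dvd])
    have h2 : ((T.det : ℤ) : ZMod p) = ((Int.castRingHom (ZMod p)).mapMatrix T).det :=
      RingHom.map_det (Int.castRingHom (ZMod p)) T
    rw [h2]
    convert h1 using 2
    ext i j
    simp only [RingHom.mapMatrix_apply, Matrix.map_apply, hT, Matrix.of_apply, ← hdχ]
    rw [← eq_intCast (Int.castRingHom (ZMod p)) u, ← map_taylor, coeff_map]
  have hAT : ∀ i i', ∑ j, T.transpose.adjugate i j * T i' j = if i = i' then T.det else 0 := by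
    intro i i'
    have := congrFun (congrFun (Matrix.adjugate_mul T.transpose) i) i'
    rw [Matrix.mul_apply, Matrix.det_transpose] at this
    simp only [Matrix.transpose_apply, Matrix.smul_apply, Matrix.one_apply, smul_eq_mul,
      mul_ite, mul_one, mul_zero] at this
    exact this
  have hdiv : ∀ i : Fin l, X ^ (l + 1) ∣
      (∑ j, C (T.transpose.adjugate i j) * (taylor u (χ j) - C ((χ j).eval u)))
        - C T.det * X ^ ((i : ℕ) + 1) := by
    intro i
    rw [X_pow_dvd_iff]
    intro n hn
    rw [coeff_sub, finsetSum_coeff, coeff_C_mul_X_pow]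
    rcases n with _ | n
    · simp [taylor_coeff_zero]
    · have hn' : n < l := by omega
      have := hAT i ⟨n, hn'⟩
      simp only [hT, Matrix.of_apply] at this
      simp only [coeff_C_mul, coeff_sub, coeff_C_succ, sub_zero]
      rw [this]
      by_cases hi : i = ⟨n, hn'⟩
      · rw [if_pos hi, if_pos, sub_self]
        rw [hi]
      · rw [if_neg hi, if_neg, sub_self]
        intro h
        exact hi (Fin.ext (by simpa using h.symm))
  choose R hR using hdiv
  exact ⟨T.transpose.adjugate, T.det, R, hdet, fun i => by rw [← hR i]; ring⟩

theorem momentLike_rescale (hml : m + l < p) {χ : Fin l → ℤ[X]} (hχ : MomentLike p m χ)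
    (u : ℤ) (hu : m = 0 ∨ ¬ (p : ℤ) ∣ u) {b : ℕ} (hb : 1 ≤ b) :
    ∃ (A : Matrix (Fin l) (Fin l) ℤ) (ψ : Fin l → ℤ[X]), MomentLike p 0 ψ ∧
      ∀ (t : ℤ) (i : Fin l), ∑ j, A i j * ((χ j).eval (u + p ^ b * t) - (χ j).eval u) =
        p ^ (b * ((i : ℕ) + 1)) * (ψ i).eval t := by
  obtain ⟨A, δ, R, hδ, h⟩ := exists_taylor_normal_form hml hχ u hu
  refine ⟨A, fun i => C δ * X ^ ((i : ℕ) + 1) +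
    C ((p : ℤ) ^ (b * (l - i))) * (X ^ (l + 1) * (R i).comp (C ((p : ℤ) ^ b) * X)), ?_, ?_⟩
  · intro i
    refine ⟨δ, hδ, ?_⟩
    have h0 : b * (l - (i : ℕ)) ≠ 0 := by
      have := i.2
      exact Nat.mul_ne_zero (by omega) (by omega)
    simp [Polynomial.map_add, Polynomial.map_mul, h0]
  · intro t i
    have := congrArg (fun P => eval ((p : ℤ) ^ b * t) P) (h i)
    simp only [eval_finsetSum, eval_mul, eval_C, eval_sub, taylor_eval, eval_add, eval_pow,
      eval_X] at this
    simp only [add_comm u, this, eval_add, eval_mul, eval_C, eval_pow, eval_X, eval_comp]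
    have hi : b * (l + 1) = b * ((i : ℕ) + 1) + b * (l - i) := by
      rw [← mul_add]; congr 1; have := i.2; omega
    rw [mul_pow, mul_pow, ← pow_mul, ← pow_mul, hi, pow_add]
    ring

theorem momentLike_recenter {k : ℕ} (hk : k < p) {φ : Fin k → ℤ[X]} (hφ : MomentLike p 0 φ)
    (v : ℤ) :
    ∃ (A : Matrix (Fin k) (Fin k) ℤ) (χ : Fin k → ℤ[X]), MomentLike p 0 χ ∧
      (∀ i : Fin k, X ^ ((i : ℕ) + 1) ∣ χ i) ∧
      ∀ (y : ℤ) (i : Fin k), ∑ j, A i j * ((φ j).eval (v + y) - (φ j).eval v) =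
        (χ i).eval y := by
  obtain ⟨A, δ, R, hδ, h⟩ := exists_taylor_normal_form (by omega) hφ v (Or.inl rfl)
  refine ⟨A, fun i => C δ * X ^ ((i : ℕ) + 1) + X ^ (k + 1) * R i, ?_, ?_, ?_⟩
  · intro i
    refine ⟨δ, hδ, ?_⟩
    have h1 := congrArg (fun P => Polynomial.map (Int.castRingHom (ZMod p)) P) (h i)
    simp only [Polynomial.map_sum, Polynomial.map_mul, Polynomial.map_sub, map_C,
      map_taylor, Polynomial.map_add, Polynomial.map_pow, map_X] at h1
    simp only [Polynomial.map_add, Polynomial.map_mul, map_C, Polynomial.map_pow, map_X, zero_add]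
    rw [eq_intCast] at h1 ⊢
    have h2 : X ^ (k + 1) * Polynomial.map (Int.castRingHom (ZMod p)) (R i) = 0 := by
      ext n
      rw [coeff_zero]
      by_cases hn : n < k + 1
      · rw [coeff_X_pow_mul', if_neg (by omega)]
      · have h3 := congrArg (fun P => coeff P n) h1
        simp only [coeff_add, coeff_C_mul_X_pow] at h3
        have hi := i.2
        rw [if_neg (by omega), zero_add] at h3
        rw [← h3, finsetSum_coeff]
        refine Finset.sum_eq_zero fun j _ => ?_
        rw [coeff_C_mul, coeff_sub]
        obtain ⟨d, hd, hdj⟩ := hφ j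
        have h4 : (taylor (v : ZMod p)
            (Polynomial.map (Int.castRingHom (ZMod p)) (φ j))).coeff n = 0 := by
          apply coeff_eq_zero_of_natDegree_lt
          rw [natDegree_taylor, hdj]
          refine lt_of_le_of_lt (natDegree_C_mul_X_pow_le _ _) ?_
          have := j.2; omega
        rw [h4, coeff_C, if_neg (by omega)]
        simp
    rw [h2, add_zero]
  · intro i
    refine dvd_add (Dvd.intro_left _ rfl) (Dvd.dvd.mul_right (pow_dvd_pow _ ?_) _)
    have := i.2; omega
  · intro y i
    have := congrArg (fun P => eval y P) (h i)
    simp only [eval_finsetSum, eval_mul, eval_C, eval_sub, taylor_eval, eval_add, eval_pow,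
      eval_X] at this
    simp only [add_comm v, this, eval_add, eval_mul, eval_C, eval_pow, eval_X]

end Taylor

/-- The triangular number `k (k + 1) / 2`. -/
def tri (k : ℕ) : ℕ := k * (k + 1) / 2

theorem two_mul_tri (k : ℕ) : 2 * tri k = k * (k + 1) :=
  Nat.mul_div_cancel' (Nat.even_mul_succ_self k).two_dvd

theorem tri_ne_zero {k : ℕ} (hk : k ≠ 0) : tri k ≠ 0 := by
  have := two_mul_tri k
  have h : 0 < k * (k + 1) := Nat.mul_pos (Nat.pos_of_ne_zero hk) (Nat.succ_pos k)
  omega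

/-- Regrouping a sum over the fibres of `x` according to a coarser label `h`. -/
theorem sum_filter_filter_of_coarser {α β γ : Type*} [Fintype β] [DecidableEq β] [Fintype γ]
    [DecidableEq γ] {Q : Finset α → ℝ} (hQ : Q ∅ = 0) (h : α → β) (x : α → γ)
    (S : Finset α) (hc : ∀ i ∈ S, ∀ j ∈ S, x i = x j → h i = h j) :
    ∑ ξ, ∑ η, Q ((S.filter (h · = ξ)).filter (x · = η)) = ∑ η, Q (S.filter (x · = η)) := by
  rw [Finset.sum_comm]
  refine Finset.sum_congr rfl fun η _ => ?_
  by_cases he : (S.filter (x · = η)).Nonempty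
  · obtain ⟨i, hi⟩ := he
    rw [Finset.mem_filter] at hi
    rw [Finset.sum_eq_single (h i)]
    · congr 1
      ext j
      simp only [Finset.mem_filter]
      constructor
      · rintro ⟨⟨h1, h2⟩, h3⟩; exact ⟨h1, h3⟩
      · rintro ⟨h1, h3⟩; exact ⟨⟨h1, hc j h1 i hi.1 (h3.trans hi.2.symm)⟩, h3⟩
    · intro ξ _ hξ
      have : (S.filter (h · = ξ)).filter (x · = η) = ∅ := by
        rw [Finset.eq_empty_iff_forall_notMem]
        intro j hj
        simp only [Finset.mem_filter] at hj
        exact hξ (hj.1.2 ▸ hc j hj.1.1 i hi.1 (hj.2.trans hi.2.symm))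
      rw [this, hQ]
    · simp
  · rw [Finset.not_nonempty_iff_eq_empty] at he
    rw [he, hQ]
    refine Finset.sum_eq_zero fun ξ _ => ?_
    rw [Finset.filter_filter, Finset.filter_congr (q := fun i => x i = η ∧ h i = ξ)
      (fun i _ => and_comm), ← Finset.filter_filter, he, Finset.filter_empty, hQ]

theorem sum_filter_eq_of_equiv {α β γ : Type*} [Fintype β] [DecidableEq β] [Fintype γ]
    [DecidableEq γ] {Q : Finset α → ℝ} (hQ : Q ∅ = 0) (h : α → β) (x : α → γ)
    (S : Finset α) (hc : ∀ i ∈ S, ∀ j ∈ S, x i = x j ↔ h i = h j) :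
    ∑ ξ, Q (S.filter (h · = ξ)) = ∑ η, Q (S.filter (x · = η)) := by
  rw [← sum_filter_filter_of_coarser hQ h x S fun i hi j hj => (hc i hi j hj).1,
    ← sum_filter_filter_of_coarser hQ x h S fun i hi j hj => (hc i hi j hj).2, Finset.sum_comm]
  simp only [Finset.filter_filter, and_comm]

section expsum
variable {Ω : Type*}

/-- The squared absolute value of a partial sum of functions. -/
noncomputable def sqSum (f : ℤ → Ω → ℂ) (S : Finset ℤ) (ω : Ω) : ℝ := ‖∑ i ∈ S, f i ω‖ ^ 2

theorem sqSum_nonneg (f : ℤ → Ω → ℂ) (S : Finset ℤ) (ω : Ω) : 0 ≤ sqSum f S ω := by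
  unfold sqSum; positivity

/-- The triangle inequality together with the Cauchy-Schwarz inequality. -/
theorem sqSum_le_card_mul {ι : Type*} [Fintype ι] [DecidableEq ι] (f : ℤ → Ω → ℂ) (h : ℤ → ι)
    (S : Finset ℤ) (ω : Ω) :
    sqSum f S ω ≤ Fintype.card ι * ∑ ξ, sqSum f (S.filter (h · = ξ)) ω := by
  unfold sqSum
  rw [← Finset.sum_fiberwise S h]
  refine (pow_le_pow_left₀ (norm_nonneg _) (norm_sum_le _ _) 2).trans ?_
  exact sq_sum_le_card_mul_sum_sq

variable [Fintype Ω]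

/-- The weighted norm of `sqSum`. -/
noncomputable def sqNorm (t : ℕ) (w : Ω → ℝ) (f : ℤ → Ω → ℂ) (S : Finset ℤ) : ℝ :=
  wnorm t w (sqSum f S)

theorem sqNorm_nonneg {t : ℕ} {w : Ω → ℝ} (hw : ∀ ω, 0 ≤ w ω) (f : ℤ → Ω → ℂ) (S : Finset ℤ) :
    0 ≤ sqNorm t w f S := wnorm_nonneg hw (sqSum_nonneg f S)

theorem sqNorm_empty {t : ℕ} (ht : t ≠ 0) (w : Ω → ℝ) (f : ℤ → Ω → ℂ) : sqNorm t w f ∅ = 0 := by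
  simp [sqNorm, wnorm, sqSum, ht]

/-- The sum of `sqNorm` over residue classes. -/
noncomputable def classSum (p N : ℕ) [NeZero p] (t : ℕ) (w : Ω → ℝ) (f : ℤ → Ω → ℂ) (x : ℤ → ℤ)
    (S : Finset ℤ) : ℝ :=
  ∑ ξ : ZMod (p ^ N), sqNorm t w f (S.filter fun i => (x i : ZMod (p ^ N)) = ξ)

theorem classSum_nonneg {p N : ℕ} [NeZero p] {t : ℕ} {w : Ω → ℝ} (hw : ∀ ω, 0 ≤ w ω)
    (f : ℤ → Ω → ℂ) (x : ℤ → ℤ) (S : Finset ℤ) : 0 ≤ classSum p N t w f x S :=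
  Finset.sum_nonneg fun _ _ => sqNorm_nonneg hw _ _

theorem sqNorm_le_card_mul {ι : Type*} [Fintype ι] [DecidableEq ι] {t : ℕ} (ht : t ≠ 0)
    {w : Ω → ℝ} (hw : ∀ ω, 0 ≤ w ω) (f : ℤ → Ω → ℂ) (h : ℤ → ι) (S : Finset ℤ) :
    sqNorm t w f S ≤ Fintype.card ι * ∑ ξ, sqNorm t w f (S.filter (h · = ξ)) := by
  refine (wnorm_mono hw (sqSum_nonneg _ _) (sqSum_le_card_mul f h S)).trans ?_
  rw [wnorm_const_mul ht hw
    (fun ω => Finset.sum_nonneg fun ξ _ => sqSum_nonneg _ _ _) (by positivity)]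
  exact mul_le_mul_of_nonneg_left (wnorm_sum_le ht hw _ fun ξ ω => sqSum_nonneg _ _ _)
    (by positivity)

end expsum

theorem intCast_zmod_pow_eq_iff {p : ℕ} (N : ℕ) (a b : ℤ) :
    (a : ZMod (p ^ N)) = b ↔ (p : ℤ) ^ N ∣ a - b := by
  rw [← sub_eq_zero, ← Int.cast_sub, ZMod.intCast_zmod_eq_zero_iff_dvd]
  push_cast
  rfl

section decoupling
open Polynomial
variable (p : ℕ) [hp : Fact p.Prime]

/-- The additive character of `(ℤ / p ^ M) ^ k` given by the value of `φ` at `n`. -/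
noncomputable def phase {k : ℕ} (M : ℕ) (φ : Fin k → ℤ[X]) (n : ℤ)
    (η : Fin k → ZMod (p ^ M)) : ℂ :=
  ZMod.stdAddChar (∑ j, η j * (((φ j).eval n : ℤ) : ZMod (p ^ M)))

/-- The decoupling inequality in degree `k` at scale `p ^ N` with constant `K`. -/
def Dec (k N : ℕ) (K : ℝ) : Prop :=
  ∀ φ : Fin k → ℤ[X], MomentLike p 0 φ → ∀ M, k * N ≤ M → ∀ (c : ℤ → ℂ) (x : ℤ → ℤ)
    (S : Finset ℤ),
    sqNorm (tri k) (fun _ => 1) (fun i η => c i * phase p M φ (x i) η) S ≤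
      K * classSum p N (tri k) (fun _ => 1) (fun i η => c i * phase p M φ (x i) η) x S

variable {p}

theorem Dec.mono {k N : ℕ} {K K' : ℝ} (h : Dec p k N K) (hK : K ≤ K') : Dec p k N K' :=
  fun φ hφ M hM c x S => (h φ hφ M hM c x S).trans
    (mul_le_mul_of_nonneg_right hK (classSum_nonneg (fun _ => zero_le_one) _ _ _))

theorem dec_trivial {k : ℕ} (hk : k ≠ 0) (N : ℕ) : Dec p k N ((p : ℝ) ^ N) := by
  intro φ _ M _ c x S
  have := sqNorm_le_card_mul (tri_ne_zero hk) (w := fun _ => 1) (fun _ => zero_le_one)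
    (fun i η => c i * phase p M φ (x i) η) (fun i => (x i : ZMod (p ^ N))) S
  rw [ZMod.card] at this
  exact_mod_cast this

theorem phase_add {k M : ℕ} (φ : Fin k → ℤ[X]) (n : ℤ) (η : Fin k → ZMod (p ^ M))
    (z : Fin k → ℤ) :
    phase p M φ n (η + fun j => (z j : ZMod (p ^ M))) =
      phase p M φ n η * ZMod.stdAddChar ((∑ j, z j * (φ j).eval n : ℤ) : ZMod (p ^ M)) := by
  unfold phase
  rw [← AddChar.map_add_eq_mul]
  congr 1
  push_cast
  rw [← Finset.sum_add_distrib]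
  exact Finset.sum_congr rfl fun j _ => by simp [add_mul]

theorem stdAddChar_pow_mul {M M' : ℕ} (r : ℕ) (hM : M = r + M') (n : ℤ) :
    ZMod.stdAddChar (((p : ℤ) ^ r * n : ℤ) : ZMod (p ^ M)) =
      ZMod.stdAddChar (n : ZMod (p ^ M')) := by
  subst hM
  rw [ZMod.stdAddChar_coe, ZMod.stdAddChar_coe]
  congr 1
  have : (p : ℂ) ≠ 0 := by exact_mod_cast hp.out.ne_zero
  push_cast
  rw [pow_add]
  field_simp

theorem phase_eq_intCast {k M : ℕ} (φ : Fin k → ℤ[X]) (n : ℤ) (ζ : Fin k → ZMod (p ^ M)) :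
    phase p M φ n ζ =
      ZMod.stdAddChar ((∑ j, ((ζ j).val : ℤ) * (φ j).eval n : ℤ) : ZMod (p ^ M)) := by
  unfold phase
  congr 1
  push_cast
  exact Finset.sum_congr rfl fun j _ => by rw [ZMod.natCast_zmod_val]

/-- A decoupling inequality on a finite group, obtained by averaging over translates. -/
theorem Dec.shift {l N : ℕ} {K : ℝ} (h : Dec p l N K) (hl : l ≠ 0) (hK : 0 ≤ K)
    {ψ : Fin l → ℤ[X]}
    (hψ : MomentLike p 0 ψ) {M : ℕ} (hM : l * N ≤ M) {G : Type*} [Fintype G] [AddCommGroup G]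
    {w : G → ℝ} (hw : ∀ η, 0 ≤ w η) (f : ℤ → G → ℂ) (m : ℤ → ℤ) (S : Finset ℤ)
    (ι : (Fin l → ZMod (p ^ M)) → G) (θ : (Fin l → ZMod (p ^ M)) → ℂ) (hθ : ∀ ζ, ‖θ ζ‖ = 1)
    (hwι : ∀ η ζ, w (η + ι ζ) = w η)
    (hf : ∀ i ∈ S, ∀ η ζ, f i (η + ι ζ) = f i η * θ ζ * phase p M ψ (m i) ζ) :
    sqNorm (tri l) w f S ≤ K * classSum p N (tri l) w f m S := by
  have ht := tri_ne_zero hl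
  set t := tri l with htdef
  set Z : ℝ := (Fintype.card (Fin l → ZMod (p ^ M)) : ℝ) with hZ
  have hZ0 : 0 < Z := by rw [hZ]; exact_mod_cast Fintype.card_pos
  set q : Finset ℤ → G → ℝ := fun T η =>
    sqNorm t (fun _ => 1) (fun i ζ => f i η * phase p M ψ (m i) ζ) T with hq
  have hq0 : ∀ T η, 0 ≤ q T η := fun T η => sqNorm_nonneg (fun _ => zero_le_one) _ _
  have hsq : ∀ T ⊆ S, ∀ η ζ, sqSum f T (η + ι ζ) =
      sqSum (fun i ζ => f i η * phase p M ψ (m i) ζ) T ζ := by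
    intro T hT η ζ
    unfold sqSum
    rw [Finset.sum_congr rfl fun i hi => hf i (hT hi) η ζ]
    have : ∑ i ∈ T, f i η * θ ζ * phase p M ψ (m i) ζ =
        θ ζ * ∑ i ∈ T, f i η * phase p M ψ (m i) ζ := by
      rw [Finset.mul_sum]; exact Finset.sum_congr rfl fun i _ => by ring
    rw [this, norm_mul, hθ, one_mul]
  have key : ∀ T ⊆ S, wnorm t w (q T) = Z ^ (1 / (t : ℝ)) * sqNorm t w f T := by
    intro T hT
    have hs : ∑ η, w η * q T η ^ t = Z * ∑ η, w η * sqSum f T η ^ t := by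
      calc ∑ η, w η * q T η ^ t = ∑ η, ∑ ζ, w (η + ι ζ) * sqSum f T (η + ι ζ) ^ t := by
            refine Finset.sum_congr rfl fun η _ => ?_
            rw [hq]
            simp only [sqNorm]
            rw [wnorm_pow ht (fun _ => zero_le_one) (sqSum_nonneg _ _), Finset.mul_sum]
            refine Finset.sum_congr rfl fun ζ _ => ?_
            rw [hwι, hsq T hT, one_mul]
        _ = ∑ ζ : Fin l → ZMod (p ^ M), ∑ η, w η * sqSum f T η ^ t := by
            rw [Finset.sum_comm]
            refine Finset.sum_congr rfl fun ζ _ => ?_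
            exact Equiv.sum_comp (Equiv.addRight (ι ζ)) fun η => w η * sqSum f T η ^ t
        _ = _ := by rw [Finset.sum_const, Finset.card_univ, nsmul_eq_mul]
    rw [sqNorm, wnorm, wnorm, hs, Real.mul_rpow hZ0.le]
    exact Finset.sum_nonneg fun η _ => mul_nonneg (hw η) (pow_nonneg (sqSum_nonneg _ _ _) _)
  have hZ1 : 0 < Z ^ (1 / (t : ℝ)) := Real.rpow_pos_of_pos hZ0 _
  have main : wnorm t w (q S) ≤
      K * ∑ ξ : ZMod (p ^ N), wnorm t w (q (S.filter fun i => (m i : ZMod (p ^ N)) = ξ)) := by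
    refine (wnorm_mono hw (hq0 S)
      (fun η => h ψ hψ M hM (fun i => f i η) m S)).trans ?_
    rw [wnorm_const_mul ht hw
      (fun η => classSum_nonneg (fun _ => zero_le_one) _ _ _) hK]
    exact mul_le_mul_of_nonneg_left (wnorm_sum_le ht hw _ fun ξ η => hq0 _ η) hK
  rw [key S subset_rfl, Finset.sum_congr rfl fun ξ _ => key _ (Finset.filter_subset _ _),
    ← Finset.mul_sum, mul_left_comm] at main
  exact le_of_mul_le_mul_left main hZ1

theorem classSum_rescale {Ω : Type*} [Fintype Ω] {N b : ℕ} (hb : b ≤ N) {t : ℕ} (ht : t ≠ 0)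
    (w : Ω → ℝ) (f : ℤ → Ω → ℂ) (x m : ℤ → ℤ) (u : ℤ) (S : Finset ℤ)
    (hx : ∀ i ∈ S, x i = u + (p : ℤ) ^ b * m i) :
    classSum p (N - b) t w f m S = classSum p N t w f x S := by
  unfold classSum
  refine sum_filter_eq_of_equiv (Q := sqNorm t w f) (sqNorm_empty ht w f) _ _ S
    fun i hi j hj => ?_
  simp only [intCast_zmod_pow_eq_iff]
  rw [hx i hi, hx j hj]
  have h1 : (u + (p : ℤ) ^ b * m i) - (u + (p : ℤ) ^ b * m j) = (p : ℤ) ^ b * (m i - m j) := by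
    ring
  have h2 : (p : ℤ) ^ N = (p : ℤ) ^ b * (p : ℤ) ^ (N - b) := by
    rw [← pow_add]; congr 1; omega
  rw [h1, h2]
  exact mul_dvd_mul_iff_left (pow_ne_zero _ (by exact_mod_cast hp.out.ne_zero))

/-- Affine rescaling: decoupling inside a residue class modulo `p ^ b`. -/
theorem Dec.rescale {k N b : ℕ} {K : ℝ} (hk : k ≠ 0) (hkp : k < p) (hb : 1 ≤ b) (hbN : b ≤ N)
    (h : Dec p k (N - b) K) (hK : 0 ≤ K) {φ : Fin k → ℤ[X]} (hφ : MomentLike p 0 φ) {M : ℕ}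
    (hM : k * N ≤ M) (c : ℤ → ℂ) (x : ℤ → ℤ) (u : ℤ) (S : Finset ℤ)
    (hS : ∀ i ∈ S, (p : ℤ) ^ b ∣ x i - u) :
    sqNorm (tri k) (fun _ => 1) (fun i η => c i * phase p M φ (x i) η) S ≤
      K * classSum p N (tri k) (fun _ => 1) (fun i η => c i * phase p M φ (x i) η) x S := by
  obtain ⟨A, ψ, hψ, hA⟩ := momentLike_rescale (by omega) hφ u (Or.inl rfl) hb
  set m : ℤ → ℤ := fun i => (x i - u) / (p : ℤ) ^ b
  have hm : ∀ i ∈ S, x i = u + (p : ℤ) ^ b * m i := fun i hi => by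
    rw [Int.mul_ediv_cancel' (hS i hi)]; ring
  rw [← classSum_rescale hbN (tri_ne_zero hk) _ _ x m u S hm]
  have hbk : k * b ≤ k * N := Nat.mul_le_mul_left _ hbN
  set z : (Fin k → ZMod (p ^ (M - k * b))) → Fin k → ℤ := fun ζ j =>
    ∑ i : Fin k, (p : ℤ) ^ (b * (k - (i + 1))) * ((ζ i).val : ℤ) * A i j with hz
  refine h.shift hk hK hψ (M := M - k * b) (by rw [Nat.mul_sub]; omega) (fun _ => zero_le_one)
    _ m S (fun ζ j => (z ζ j : ZMod (p ^ M)))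
    (fun ζ => ZMod.stdAddChar ((∑ j, z ζ j * (φ j).eval u : ℤ) : ZMod (p ^ M)))
    (fun ζ => AddChar.norm_apply _ _) (fun _ _ => rfl) ?_
  intro i hi η ζ
  rw [phase_add, phase_eq_intCast ψ (m i) ζ, ← stdAddChar_pow_mul (k * b) (M := M) (M' := M - k * b) (by omega),
    mul_assoc, mul_assoc, ← AddChar.map_add_eq_mul, ← Int.cast_add]
  congr 4
  rw [← sub_eq_iff_eq_add', ← Finset.sum_sub_distrib]
  calc ∑ j, (z ζ j * (φ j).eval (x i) - z ζ j * (φ j).eval u)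
      = ∑ i' : Fin k, (p : ℤ) ^ (b * (k - ((i' : ℕ) + 1))) * ((ζ i').val : ℤ) *
          ∑ j, A i' j * ((φ j).eval (x i) - (φ j).eval u) := by
        simp only [hz, Finset.sum_mul, Finset.mul_sum, ← Finset.sum_sub_distrib]
        rw [Finset.sum_comm]
        exact Finset.sum_congr rfl fun _ _ => Finset.sum_congr rfl fun _ _ => by ring
    _ = _ := by
        rw [Finset.mul_sum]
        refine Finset.sum_congr rfl fun i' _ => ?_
        rw [hm i hi, hA]
        have : (p : ℤ) ^ (k * b) =
            (p : ℤ) ^ (b * (k - ((i' : ℕ) + 1))) * (p : ℤ) ^ (b * ((i' : ℕ) + 1)) := by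
          rw [← pow_add, ← mul_add, mul_comm]; congr 2; have := i'.2; omega
        rw [this]
        ring

/-- Lower-degree decoupling on one residue class against a weight given by a transverse one. -/
theorem Dec.transverse {k l n b N M : ℕ} {K : ℝ} (hl : l ≠ 0) (hn : n + l = k) (hkp : k < p)
    (h : Dec p l N K) (hK : 0 ≤ K) {φ : Fin k → ℤ[X]} (hφ : MomentLike p 0 φ)
    (hN : l * (N + 1) ≤ b * (n + 1)) (hM : b * (n + 1) ≤ M) (c : ℤ → ℂ) (x : ℤ → ℤ)
    (u v : ℤ) (huv : ¬ (p : ℤ) ∣ u - v) (S₁ S₂ : Finset ℤ) (hS₁ : ∀ i ∈ S₁, (p : ℤ) ∣ x i - u)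
    (hS₂ : ∀ i ∈ S₂, (p : ℤ) ^ b ∣ x i - v) (r : ℕ) :
    sqNorm (tri l) (fun η => sqSum (fun i η => c i * phase p M φ (x i) η) S₂ η ^ r)
        (fun i η => c i * phase p M φ (x i) η) S₁ ≤
      K * classSum p (N + 1) (tri l)
        (fun η => sqSum (fun i η => c i * phase p M φ (x i) η) S₂ η ^ r)
        (fun i η => c i * phase p M φ (x i) η) x S₁ := by
  subst hn
  obtain ⟨A, χ, hχ, hχX, hA⟩ := momentLike_recenter hkp hφ v
  set χ' : Fin l → ℤ[X] := fun j => χ (Fin.natAdd n j) with hχ'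
  have hχ'm : MomentLike p n χ' := by
    intro j
    obtain ⟨d, hd, h1⟩ := hχ (Fin.natAdd n j)
    exact ⟨d, hd, by rw [hχ', h1]; simp⟩
  obtain ⟨A', ψ, hψ, hA'⟩ := momentLike_rescale hkp hχ'm (u - v) (Or.inr huv) le_rfl
  simp only [pow_one, one_mul] at hA'
  set m : ℤ → ℤ := fun i => (x i - u) / (p : ℤ) with hmdef
  have hm : ∀ i ∈ S₁, x i = u + (p : ℤ) ^ 1 * m i := fun i hi => by
    rw [pow_one, hmdef]
    simp only
    rw [Int.mul_ediv_cancel' (hS₁ i hi)]; ring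
  rw [← classSum_rescale (b := 1) (by omega) (tri_ne_zero hl) _ _ x m u S₁ hm,
    Nat.add_sub_cancel]
  set B := b * (n + 1) with hB
  have hlB : l ≤ B := le_trans (Nat.le_mul_of_pos_right l (Nat.succ_pos N)) hN
  set τ : (Fin l → ZMod (p ^ (B - l))) → Fin l → ℤ := fun ζ j =>
    ∑ i : Fin l, (p : ℤ) ^ (l - ((i : ℕ) + 1)) * ((ζ i).val : ℤ) * A' i j with hτ
  set z : (Fin l → ZMod (p ^ (B - l))) → Fin (n + l) → ℤ := fun ζ j =>
    (p : ℤ) ^ (M - B) * ∑ i : Fin l, τ ζ i * A (Fin.natAdd n i) j with hz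
  have hzφ : ∀ ζ y, ∑ j, z ζ j * ((φ j).eval (v + y) - (φ j).eval v) =
      (p : ℤ) ^ (M - B) * ∑ i, τ ζ i * (χ' i).eval y := by
    intro ζ y
    simp only [hχ', ← hA, hz, Finset.sum_mul, Finset.mul_sum]
    rw [Finset.sum_comm]
    exact Finset.sum_congr rfl fun _ _ => Finset.sum_congr rfl fun _ _ => by ring
  have hphase : ∀ ζ y η, phase p M φ (v + y) (η + fun j => (z ζ j : ZMod (p ^ M))) =
      phase p M φ (v + y) η *
        (ZMod.stdAddChar ((∑ j, z ζ j * (φ j).eval v : ℤ) : ZMod (p ^ M)) *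
          ZMod.stdAddChar ((∑ i, τ ζ i * (χ' i).eval y : ℤ) : ZMod (p ^ B))) := by
    intro ζ y η
    rw [phase_add, ← stdAddChar_pow_mul (M - B) (M := M) (M' := B) (by omega), ← hzφ,
      ← AddChar.map_add_eq_mul, ← Int.cast_add]
    congr 4
    rw [← Finset.sum_add_distrib]
    exact Finset.sum_congr rfl fun _ _ => by ring
  refine h.shift hl hK hψ (M := B - l) (by rw [mul_add, mul_one] at hN; omega)
    (fun η => pow_nonneg (sqSum_nonneg _ _ _) _)
    _ m S₁ (fun ζ j => (z ζ j : ZMod (p ^ M)))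
    (fun ζ => ZMod.stdAddChar ((∑ j, z ζ j * (φ j).eval v : ℤ) : ZMod (p ^ M)) *
      ZMod.stdAddChar ((∑ i, τ ζ i * (χ' i).eval (u - v) : ℤ) : ZMod (p ^ B)))
    (fun ζ => by rw [norm_mul, AddChar.norm_apply, AddChar.norm_apply, one_mul]) ?_ ?_
  · intro η ζ
    congr 1
    unfold sqSum
    have h1 : ∀ i ∈ S₂, c i * phase p M φ (x i) (η + fun j => (z ζ j : ZMod (p ^ M))) =
        ZMod.stdAddChar ((∑ j, z ζ j * (φ j).eval v : ℤ) : ZMod (p ^ M)) *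
          (c i * phase p M φ (x i) η) := by
      intro i hi
      have h2 := hphase ζ (x i - v) η
      rw [add_sub_cancel] at h2
      have h3 : ((∑ i', τ ζ i' * (χ' i').eval (x i - v) : ℤ) : ZMod (p ^ B)) = 0 := by
        rw [ZMod.intCast_zmod_eq_zero_iff_dvd]
        push_cast
        refine Finset.dvd_sum fun i' _ => Dvd.dvd.mul_left ?_ _
        obtain ⟨R, hR⟩ := hχX (Fin.natAdd n i')
        simp only [hχ', hR, eval_mul, eval_pow, eval_X]
        refine Dvd.dvd.mul_right ?_ _
        refine dvd_trans ?_ (pow_dvd_pow_of_dvd (hS₂ i hi) _)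
        rw [← pow_mul]
        refine pow_dvd_pow _ ?_
        rw [hB, Fin.val_natAdd]
        exact Nat.mul_le_mul_left _ (by omega)
      rw [h2, h3, AddChar.map_zero_eq_one]
      ring
    rw [Finset.sum_congr rfl h1, ← Finset.mul_sum, norm_mul, AddChar.norm_apply, one_mul]
  · intro i hi η ζ
    have h2 := hphase ζ (x i - v) η
    rw [add_sub_cancel] at h2
    have h3 : ZMod.stdAddChar ((∑ i', τ ζ i' * (χ' i').eval (x i - v) : ℤ) : ZMod (p ^ B)) =
        ZMod.stdAddChar ((∑ i', τ ζ i' * (χ' i').eval (u - v) : ℤ) : ZMod (p ^ B)) *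
          phase p (B - l) ψ (m i) ζ := by
      rw [phase_eq_intCast, ← stdAddChar_pow_mul l (M := B) (M' := B - l) (by omega),
        ← AddChar.map_add_eq_mul, ← Int.cast_add]
      congr 2
      rw [← sub_eq_iff_eq_add', ← Finset.sum_sub_distrib]
      calc ∑ j, (τ ζ j * (χ' j).eval (x i - v) - τ ζ j * (χ' j).eval (u - v))
          = ∑ i' : Fin l, (p : ℤ) ^ (l - ((i' : ℕ) + 1)) * ((ζ i').val : ℤ) *
              ∑ j, A' i' j * ((χ' j).eval (x i - v) - (χ' j).eval (u - v)) := by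
            simp only [hτ, Finset.sum_mul, Finset.mul_sum, ← Finset.sum_sub_distrib]
            rw [Finset.sum_comm]
            exact Finset.sum_congr rfl fun _ _ => Finset.sum_congr rfl fun _ _ => by ring
        _ = _ := by
            rw [Finset.mul_sum]
            refine Finset.sum_congr rfl fun i' _ => ?_
            have h4 : x i - v = u - v + p * m i := by rw [hm i hi]; ring
            rw [h4, hA']
            have : (p : ℤ) ^ l = (p : ℤ) ^ (l - ((i' : ℕ) + 1)) * (p : ℤ) ^ ((i' : ℕ) + 1) := by
              rw [← pow_add]; congr 1; have := i'.2; omega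
            rw [this]
            ring
    rw [h2, h3]
    ring

end decoupling

theorem tri_add (l n : ℕ) : tri (l + n) = tri l + tri n + l * n := by
  have h1 := two_mul_tri (l + n)
  have h2 := two_mul_tri l
  have h3 := two_mul_tri n
  nlinarith

theorem tri_one : tri 1 = 1 := rfl

theorem tri_mono {l k : ℕ} (h : l ≤ k) : tri l ≤ tri k := by
  obtain ⟨n, rfl⟩ := Nat.exists_eq_add_of_le h
  rw [tri_add]; omega

theorem tri_lt {l k : ℕ} (h : l < k) : tri l < tri k := by
  obtain ⟨n, rfl⟩ := Nat.exists_eq_add_of_le h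
  have := tri_ne_zero (k := 1 + n) (by omega)
  rw [Nat.succ_eq_add_one, Nat.add_assoc, tri_add]; omega

/-- Orthogonality of sums over distinct classes. -/
theorem sum_sqSum_eq_of_orthogonal {Ω ι : Type*} [Fintype Ω] [Fintype ι] [DecidableEq ι]
    (f : ℤ → Ω → ℂ) (h : ℤ → ι) (S : Finset ℤ)
    (horth : ∀ i ∈ S, ∀ j ∈ S, h i ≠ h j → ∑ ω, f i ω * (starRingEnd ℂ) (f j ω) = 0) :
    ∑ ω, sqSum f S ω = ∑ ξ, ∑ ω, sqSum f (S.filter (h · = ξ)) ω := by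
  have expand : ∀ T : Finset ℤ, ((∑ ω, sqSum f T ω : ℝ) : ℂ) =
      ∑ i ∈ T, ∑ j ∈ T, ∑ ω, f i ω * (starRingEnd ℂ) (f j ω) := by
    intro T
    push_cast
    have : ∀ ω, ((sqSum f T ω : ℝ) : ℂ) = ∑ i ∈ T, ∑ j ∈ T, f i ω * (starRingEnd ℂ) (f j ω) := by
      intro ω
      unfold sqSum
      rw [← Complex.normSq_eq_norm_sq, Complex.normSq_eq_conj_mul_self, mul_comm, map_sum,
        Finset.sum_mul_sum]
    simp only [this]
    rw [Finset.sum_comm]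
    exact Finset.sum_congr rfl fun i _ => Finset.sum_comm
  apply Complex.ofReal_injective
  rw [expand S, Complex.ofReal_sum]
  simp only [expand]
  rw [← Finset.sum_fiberwise S h]
  refine Finset.sum_congr rfl fun ξ _ => Finset.sum_congr rfl fun i hi => ?_
  rw [Finset.mem_filter] at hi
  refine (Finset.sum_subset (Finset.filter_subset _ _) fun j hj hj' => ?_).symm
  refine horth i hi.1 j hj fun hij => hj' ?_
  rw [Finset.mem_filter]
  exact ⟨hj, hij.symm.trans hi.2⟩

/-- Hölder's inequality with natural exponents. -/
theorem sum_pow_mul_pow_le {Ω : Type*} [Fintype Ω] {t r : ℕ} (ht : t ≠ 0) (hr : r ≤ t)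
    {g h : Ω → ℝ} (hg : ∀ ω, 0 ≤ g ω) (hh : ∀ ω, 0 ≤ h ω) {A B : ℝ} (hA : 0 ≤ A) (hB : 0 ≤ B)
    (hgA : ∑ ω, g ω ^ t ≤ A ^ t) (hhB : ∑ ω, h ω ^ t ≤ B ^ t) :
    ∑ ω, g ω ^ r * h ω ^ (t - r) ≤ A ^ r * B ^ (t - r) := by
  have hpos : ∀ (f : Ω → ℝ), (∀ ω, 0 ≤ f ω) → 0 ≤ ∑ ω, f ω ^ t := fun f hf =>
    Finset.sum_nonneg fun ω _ => pow_nonneg (hf ω) _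
  rcases Nat.eq_zero_or_pos r with rfl | hr0
  · simpa using hhB
  rcases eq_or_lt_of_le hr with rfl | hrt
  · simpa using hgA
  have hr' : (0 : ℝ) < r := by exact_mod_cast hr0
  have ht' : (0 : ℝ) < t := by exact_mod_cast Nat.pos_of_ne_zero ht
  have htr : (0 : ℝ) < (t - r : ℕ) := by exact_mod_cast Nat.sub_pos_of_lt hrt
  have hcast : ((t - r : ℕ) : ℝ) = t - r := Nat.cast_sub hr
  have hpq : Real.HolderConjugate ((t : ℝ) / r) ((t : ℝ) / (t - r : ℕ)) := by
    rw [Real.holderConjugate_iff]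
    constructor
    · rw [lt_div_iff₀ hr']; rw [hcast] at htr; linarith
    · rw [inv_div, inv_div, ← add_div, hcast]; field_simp; ring
  have := Real.inner_le_Lp_mul_Lq_of_nonneg Finset.univ hpq
    (f := fun ω => g ω ^ r) (g := fun ω => h ω ^ (t - r))
    (fun i _ => pow_nonneg (hg i) _) (fun i _ => pow_nonneg (hh i) _)
  have hconv : ∀ (y : ℝ), 0 ≤ y → ∀ e : ℕ, (0 : ℝ) < e → (y ^ e) ^ ((t : ℝ) / e) = y ^ t := by
    intro y hy e he
    rw [← Real.rpow_natCast, ← Real.rpow_mul hy, mul_div_cancel₀ _ he.ne', Real.rpow_natCast]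
  have hconv2 : ∀ (A' Y : ℝ), 0 ≤ A' → 0 ≤ Y → Y ≤ A' ^ t → ∀ e : ℕ, (0 : ℝ) < e →
      Y ^ (1 / ((t : ℝ) / e)) ≤ A' ^ e := by
    intro A' Y hA' hY hYA e he
    refine (Real.rpow_le_rpow hY hYA (by positivity)).trans (le_of_eq ?_)
    rw [← Real.rpow_natCast, ← Real.rpow_mul hA', one_div_div, mul_div_cancel₀ _ ht'.ne',
      Real.rpow_natCast]
  simp only [hconv _ (hg _) r hr', hconv _ (hh _) (t - r) htr] at this
  refine this.trans (mul_le_mul (hconv2 A _ hA (hpos g hg) hgA r hr')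
    (hconv2 B _ hB (hpos h hh) hhB _ htr) (Real.rpow_nonneg (hpos h hh) _) (pow_nonneg hA _))

section bilinear
open Polynomial
variable (p : ℕ) [hp : Fact p.Prime]

/-- A weighted family of characters along the curve `φ`. -/
noncomputable abbrev wave {k : ℕ} (M : ℕ) (φ : Fin k → ℤ[X]) (c : ℤ → ℂ) (x : ℤ → ℤ) :
    ℤ → (Fin k → ZMod (p ^ M)) → ℂ :=
  fun i η => c i * phase p M φ (x i) η

/-- The bilinear decoupling inequality for transverse residue classes modulo `p` and `p ^ b`. -/
def Bil (k l b N : ℕ) (K : ℝ) : Prop :=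
  ∀ φ : Fin k → ℤ[X], MomentLike p 0 φ → ∀ M, k * N ≤ M → ∀ (c : ℤ → ℂ) (x : ℤ → ℤ)
    (u v : ℤ), ¬ (p : ℤ) ∣ u - v → ∀ S₁ S₂ : Finset ℤ, (∀ i ∈ S₁, (p : ℤ) ∣ x i - u) →
    (∀ i ∈ S₂, (p : ℤ) ^ b ∣ x i - v) →
    ∑ η, sqSum (wave p M φ c x) S₁ η ^ tri l * sqSum (wave p M φ c x) S₂ η ^ (tri k - tri l) ≤
      K ^ tri k * (classSum p N (tri k) (fun _ => 1) (wave p M φ c x) x S₁ ^ tri l *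
        classSum p N (tri k) (fun _ => 1) (wave p M φ c x) x S₂ ^ (tri k - tri l))

variable {p}

theorem Bil.mono {k l b N : ℕ} {K K' : ℝ} (h : Bil p k l b N K) (hK : 0 ≤ K) (hKK : K ≤ K') :
    Bil p k l b N K' := by
  intro φ hφ M hM c x u v huv S₁ S₂ h₁ h₂
  refine (h φ hφ M hM c x u v huv S₁ S₂ h₁ h₂).trans ?_
  refine mul_le_mul_of_nonneg_right (pow_le_pow_left₀ hK hKK _) ?_
  exact mul_nonneg (pow_nonneg (classSum_nonneg (fun _ => zero_le_one) _ _ _) _)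
    (pow_nonneg (classSum_nonneg (fun _ => zero_le_one) _ _ _) _)

theorem sum_sqSum_pow {Ω : Type*} [Fintype Ω] {t : ℕ} (ht : t ≠ 0) (f : ℤ → Ω → ℂ)
    (S : Finset ℤ) : ∑ ω, sqSum f S ω ^ t = sqNorm t (fun _ => 1) f S ^ t := by
  rw [sqNorm, wnorm_pow ht (fun _ => zero_le_one) (sqSum_nonneg f S)]
  simp

/-- In degree one, decoupling is orthogonality. -/
theorem dec_one (N : ℕ) : Dec p 1 N 1 := by
  intro φ hφ M hM c x S
  rw [one_mul]
  have h1 : ∀ T, sqNorm (tri 1) (fun _ => 1) (fun i η => c i * phase p M φ (x i) η) T =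
      ∑ η, sqSum (wave p M φ c x) T η := by
    intro T
    have := sum_sqSum_pow (t := 1) one_ne_zero (wave p M φ c x) T
    simp only [pow_one] at this
    exact this.symm
  unfold classSum
  simp only [h1]
  refine (sum_sqSum_eq_of_orthogonal _ _ S ?_).le
  intro i _ j _ hij
  obtain ⟨d, hd, hdφ⟩ := hφ 0
  have key : (((φ 0).eval (x i) - (φ 0).eval (x j) : ℤ) : ZMod (p ^ M)) ≠ 0 := by
    intro h0
    apply hij
    rw [ZMod.intCast_zmod_eq_zero_iff_dvd] at h0
    push_cast at h0
    obtain ⟨e, he⟩ := sub_dvd_eval_sub (x i) (x j) (φ 0)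
    rw [intCast_zmod_pow_eq_iff]
    refine dvd_trans (pow_dvd_pow _ (by omega : N ≤ M)) ?_
    obtain ⟨R, hR⟩ : ∃ R : ℤ[X], ∃ d' : ℤ, (d' : ZMod p) ≠ 0 ∧ φ 0 = C d' * X + C (p : ℤ) * R := by
      obtain ⟨d', rfl⟩ := ZMod.intCast_surjective d
      have : Polynomial.map (Int.castRingHom (ZMod p)) (φ 0 - C d' * X) = 0 := by
        rw [Polynomial.map_sub, hdφ]
        simp
      have h2 : C (p : ℤ) ∣ φ 0 - C d' * X := by
        rw [C_dvd_iff_dvd_coeff]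
        intro n
        have := congrArg (fun P => coeff P n) this
        simp only [coeff_map, coeff_zero, eq_intCast] at this
        exact (ZMod.intCast_zmod_eq_zero_iff_dvd _ _).1 this
      obtain ⟨R, hR⟩ := h2
      exact ⟨R, d', hd, by rw [← hR]; ring⟩
    obtain ⟨d', hd', hR⟩ := hR
    obtain ⟨e', he'⟩ := sub_dvd_eval_sub (x i) (x j) R
    have h3 : (φ 0).eval (x i) - (φ 0).eval (x j) = (x i - x j) * (d' + p * e') := by
      rw [hR]
      simp only [eval_add, eval_mul, eval_C, eval_X]
      linear_combination (p : ℤ) * he'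
    rw [h3] at h0
    have hcop : IsCoprime ((p : ℤ) ^ M) (d' + p * e') := by
      apply IsCoprime.pow_left
      refine (Nat.prime_iff_prime_int.1 hp.out).coprime_iff_not_dvd.2 ?_
      intro hdv
      apply hd'
      rw [ZMod.intCast_zmod_eq_zero_iff_dvd]
      exact (dvd_add_left (dvd_mul_right _ _)).1 hdv
    exact hcop.dvd_of_dvd_mul_right h0
  have h2 : ∀ η : Fin 1 → ZMod (p ^ M), wave p M φ c x i η * (starRingEnd ℂ) (wave p M φ c x j η) =
      c i * (starRingEnd ℂ) (c j) * ZMod.stdAddChar (η 0 *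
        (((φ 0).eval (x i) - (φ 0).eval (x j) : ℤ) : ZMod (p ^ M))) := by
    intro η
    simp only [wave, phase, Fin.sum_univ_one, map_mul]
    rw [← AddChar.map_neg_eq_conj]
    push_cast
    rw [mul_sub, sub_eq_add_neg, AddChar.map_add_eq_mul]
    ring
  simp only [h2]
  rw [← Finset.mul_sum]
  have h3 := AddChar.sum_mulShift
    ((((φ 0).eval (x i) - (φ 0).eval (x j) : ℤ) : ZMod (p ^ M)))
    (ZMod.isPrimitive_stdAddChar (p ^ M))
  rw [if_neg key, Nat.cast_zero] at h3
  refine mul_eq_zero_of_right _ (Eq.trans ?_ h3)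
  exact Fintype.sum_equiv (Equiv.funUnique (Fin 1) (ZMod (p ^ M))) _ _ fun η => rfl

theorem bil_zero {k b N : ℕ} {K : ℝ} (hk : k ≠ 0) (hkp : k < p) (hb : 1 ≤ b) (hbN : b ≤ N)
    (h : Dec p k (N - b) K) (hK : 0 ≤ K) : Bil p k 0 b N K := by
  intro φ hφ M hM c x u v huv S₁ S₂ h₁ h₂
  have h0 : tri 0 = 0 := rfl
  simp only [h0, pow_zero, one_mul, Nat.sub_zero]
  rw [sum_sqSum_pow (tri_ne_zero hk), ← mul_pow]
  exact pow_le_pow_left₀ (sqNorm_nonneg (fun _ => zero_le_one) _ _)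
    (h.rescale hk hkp hb hbN hK hφ hM c x v S₂ h₂) _

theorem Dec.bil {k N : ℕ} {K : ℝ} (hk : k ≠ 0) (h : Dec p k N K) (hK : 0 ≤ K) {l : ℕ}
    (hl : l ≤ k) (b : ℕ) : Bil p k l b N K := by
  intro φ hφ M hM c x u v huv S₁ S₂ h₁ h₂
  have ht := tri_ne_zero hk
  have hE : ∀ S, 0 ≤ K * classSum p N (tri k) (fun _ => 1) (wave p M φ c x) x S := fun S =>
    mul_nonneg hK (classSum_nonneg (fun _ => zero_le_one) _ _ _)
  have hS : ∀ S, ∑ η, sqSum (wave p M φ c x) S η ^ tri k ≤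
      (K * classSum p N (tri k) (fun _ => 1) (wave p M φ c x) x S) ^ tri k := fun S => by
    rw [sum_sqSum_pow ht]
    exact pow_le_pow_left₀ (sqNorm_nonneg (fun _ => zero_le_one) _ _) (h φ hφ M hM c x S) _
  refine (sum_pow_mul_pow_le ht (tri_mono hl) (sqSum_nonneg _ _) (sqSum_nonneg _ _)
    (hE S₁) (hE S₂) (hS S₁) (hS S₂)).trans (le_of_eq ?_)
  rw [mul_pow, mul_pow]
  have : K ^ tri k = K ^ tri l * K ^ (tri k - tri l) := by
    rw [← pow_add]; congr 1; have := tri_mono hl; omega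
  rw [this]
  ring

end bilinear

section bilinear
open Polynomial
variable {p : ℕ} [hp : Fact p.Prime]

theorem sum_classSum_eq {Ω ι : Type*} [Fintype Ω] [Fintype ι] [DecidableEq ι] {N t : ℕ}
    (ht : t ≠ 0) (w : Ω → ℝ) (f : ℤ → Ω → ℂ) (x : ℤ → ℤ) (h : ℤ → ι) (S : Finset ℤ)
    (hc : ∀ i ∈ S, ∀ j ∈ S, (p : ℤ) ^ N ∣ x i - x j → h i = h j) :
    ∑ ξ, classSum p N t w f x (S.filter (h · = ξ)) = classSum p N t w f x S := by
  unfold classSum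
  refine sum_filter_filter_of_coarser (Q := sqNorm t w f) (sqNorm_empty ht w f) h
    (fun i => (x i : ZMod (p ^ N))) S fun i hi j hj hij => hc i hi j hj ?_
  exact (intCast_zmod_pow_eq_iff _ _ _).1 hij

/-- Combining bounds for the pieces of a family by the triangle inequality. -/
theorem sum_mul_sqSum_pow_le {Ω ι : Type*} [Fintype Ω] [Fintype ι] [DecidableEq ι] {r : ℕ}
    (hr : r ≠ 0) {w : Ω → ℝ} (hw : ∀ ω, 0 ≤ w ω) (f : ℤ → Ω → ℂ) (h : ℤ → ι) (S : Finset ℤ)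
    {L B : ℝ} (hL : 0 ≤ L) (hB : 0 ≤ B) {E : Finset ℤ → ℝ} (hE : ∀ T, 0 ≤ E T)
    (hdec : sqNorm r w f S ≤ L * ∑ ξ, sqNorm r w f (S.filter (h · = ξ)))
    (hpiece : ∀ ξ, ∑ ω, w ω * sqSum f (S.filter (h · = ξ)) ω ^ r ≤
      B * E (S.filter (h · = ξ)) ^ r)
    (hsum : ∑ ξ, E (S.filter (h · = ξ)) = E S) :
    ∑ ω, w ω * sqSum f S ω ^ r ≤ L ^ r * (B * E S ^ r) := by
  have hBr : (B ^ (1 / (r : ℝ))) ^ r = B := by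
    rw [one_div]; exact Real.rpow_inv_natCast_pow hB hr
  have h1 : ∀ ξ, sqNorm r w f (S.filter (h · = ξ)) ≤
      B ^ (1 / (r : ℝ)) * E (S.filter (h · = ξ)) := by
    intro ξ
    refine wnorm_le_of_pow_le hr hw (sqSum_nonneg _ _)
      (mul_nonneg (Real.rpow_nonneg hB _) (hE _)) ?_
    rw [mul_pow, hBr]
    exact hpiece ξ
  have h2 : sqNorm r w f S ≤ L * (B ^ (1 / (r : ℝ)) * E S) := by
    refine hdec.trans (mul_le_mul_of_nonneg_left ?_ hL)
    rw [← hsum, Finset.mul_sum]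
    exact Finset.sum_le_sum fun ξ _ => h1 ξ
  rw [← wnorm_pow hr hw (sqSum_nonneg f S)]
  refine (pow_le_pow_left₀ (sqNorm_nonneg hw f S) h2 r).trans (le_of_eq ?_)
  rw [mul_pow, mul_pow, hBr]

theorem Bil.step {k l n b a N : ℕ} {K₀ K₁ K₂ K : ℝ} (hl : l ≠ 0) (hn : n + l = k) (hkp : k < p)
    (hn0 : n ≠ 0) (hb : 1 ≤ b) (hbN : b ≤ N) (haN : a + 1 ≤ N)
    (hdec : a = 0 ∨ (Dec p l a K₀ ∧ l * (a + 1) ≤ b * (n + 1))) (hK₀ : 1 ≤ K₀)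
    (h₁ : Bil p k (l - 1) b N K₁) (h₂ : Bil p k n (a + 1) N K₂) (hK₁ : 0 ≤ K₁) (hK₂ : 0 ≤ K₂)
    (hK : 0 ≤ K) (hKK : K₁ ^ n * K₂ ≤ K ^ (n + 1)) : Bil p k l b N (K₀ * K) := by
  intro φ hφ M hM c x u v huv S₁ S₂ hS₁ hS₂
  set f := wave p M φ c x with hf
  set t := tri k with htdef
  have hk : k ≠ 0 := by omega
  have ht : t ≠ 0 := tri_ne_zero hk
  set E : Finset ℤ → ℝ := fun S => classSum p N t (fun _ => 1) f x S with hE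
  have hE0 : ∀ S, 0 ≤ E S := fun S => classSum_nonneg (fun _ => zero_le_one) _ _ _
  have hlt : tri l ≤ t := tri_mono (by omega)
  have hltk : tri l < t := tri_lt (by omega)
  have htl := tri_ne_zero hl
  have hw : ∀ η, 0 ≤ sqSum f S₂ η ^ (t - tri l) := fun η => pow_nonneg (sqSum_nonneg _ _ _) _
  have hMB : b * (n + 1) ≤ M := by
    refine le_trans ?_ hM
    rw [mul_comm k N]
    exact Nat.mul_le_mul hbN (by omega)
  have hdec' : sqNorm (tri l) (fun η => sqSum f S₂ η ^ (t - tri l)) f S₁ ≤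
      K₀ * ∑ ξ : ZMod (p ^ (a + 1)), sqNorm (tri l) (fun η => sqSum f S₂ η ^ (t - tri l)) f
        (S₁.filter fun i => (x i : ZMod (p ^ (a + 1))) = ξ) := by
    rcases hdec with rfl | ⟨hd, hle⟩
    · refine le_trans ?_ (le_mul_of_one_le_left
        (Finset.sum_nonneg fun _ _ => sqNorm_nonneg hw _ _) hK₀)
      refine le_trans (le_of_eq ?_) (Finset.single_le_sum
        (f := fun ξ : ZMod (p ^ (0 + 1)) => sqNorm (tri l) (fun η => sqSum f S₂ η ^ (t - tri l)) f
        (S₁.filter fun i => (x i : ZMod (p ^ (0 + 1))) = ξ))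
        (fun _ _ => sqNorm_nonneg hw _ _) (Finset.mem_univ ((u : ℤ) : ZMod (p ^ (0 + 1)))))
      rw [Finset.filter_true_of_mem]
      intro i hi
      rw [intCast_zmod_pow_eq_iff]
      simpa using hS₁ i hi
    · exact hd.transverse hl hn hkp (by linarith) hφ hle hMB c x u v huv S₁ S₂ hS₁ hS₂ _
  have hpiece : ∀ ξ : ZMod (p ^ (a + 1)), ∑ η, sqSum f S₂ η ^ (t - tri l) *
      sqSum f (S₁.filter fun i => (x i : ZMod (p ^ (a + 1))) = ξ) η ^ tri l ≤
      (K ^ t * E S₂ ^ (t - tri l)) *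
        E (S₁.filter fun i => (x i : ZMod (p ^ (a + 1))) = ξ) ^ tri l := by
    intro ξ
    set T := S₁.filter fun i => (x i : ZMod (p ^ (a + 1))) = ξ with hT
    have hTS : T ⊆ S₁ := Finset.filter_subset _ _
    rcases T.eq_empty_or_nonempty with h0 | ⟨i₀, hi₀⟩
    · rw [h0]
      have : ∀ η, sqSum f ∅ η = 0 := fun η => by simp [sqSum]
      simp only [this, zero_pow htl, mul_zero, Finset.sum_const_zero]
      exact mul_nonneg (mul_nonneg (pow_nonneg hK _) (pow_nonneg (hE0 _) _))
        (pow_nonneg (hE0 _) _)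
    · have hi₀' := Finset.mem_filter.1 hi₀
      have e1 : (n + 1) * tri l = n * tri (l - 1) + (t - tri n) := by
        obtain ⟨l', rfl⟩ := Nat.exists_eq_succ_of_ne_zero hl
        have h1 := tri_add l' 1
        have h2 := tri_add n (l' + 1)
        rw [tri_one] at h1
        rw [htdef, ← hn]
        simp only [Nat.succ_eq_add_one, Nat.add_sub_cancel]
        have : tri (n + (l' + 1)) - tri n = tri (l' + 1) + n * (l' + 1) := by omega
        rw [this, h1]
        ring
      have e2 : (n + 1) * (t - tri l) = n * (t - tri (l - 1)) + tri n := by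
        have h1 : tri (l - 1) ≤ t := tri_mono (by omega)
        have h2 : tri n ≤ t := tri_mono (by omega)
        zify [hlt, h1, h2] at e1 ⊢
        linear_combination -e1
      have b1 := h₁ φ hφ M hM c x u v huv T S₂ (fun i hi => hS₁ i (hTS hi)) hS₂
      have huv' : ¬ (p : ℤ) ∣ v - x i₀ := by
        intro hd
        apply huv
        have := dvd_add hd (hS₁ i₀ hi₀'.1)
        rw [← dvd_neg]
        convert this using 1
        ring
      have b2 := h₂ φ hφ M hM c x v (x i₀) huv' S₂ T
        (fun i hi => dvd_trans (dvd_pow_self _ (by omega)) (hS₂ i hi))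
        (fun i hi => by
          rw [← intCast_zmod_pow_eq_iff, hi₀'.2]
          exact (Finset.mem_filter.1 hi).2)
      have hol := holder_pow_sum Finset.univ n
        (X := fun η => sqSum f S₂ η ^ (t - tri l) * sqSum f T η ^ tri l)
        (A := fun η => sqSum f T η ^ tri (l - 1) * sqSum f S₂ η ^ (t - tri (l - 1)))
        (B := fun η => sqSum f S₂ η ^ tri n * sqSum f T η ^ (t - tri n))
        (fun η => mul_nonneg (hw η) (pow_nonneg (sqSum_nonneg _ _ _) _))
        (fun η => mul_nonneg (pow_nonneg (sqSum_nonneg _ _ _) _)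
          (pow_nonneg (sqSum_nonneg _ _ _) _))
        (fun η => mul_nonneg (pow_nonneg (sqSum_nonneg _ _ _) _)
          (pow_nonneg (sqSum_nonneg _ _ _) _))
        (fun η => by
          simp only [mul_pow, ← pow_mul]
          rw [mul_comm (t - tri l), mul_comm (tri l), e1, e2, pow_add, pow_add,
            mul_comm n, mul_comm n]
          ring)
      have hA0 : 0 ≤ ∑ η, sqSum f T η ^ tri (l - 1) * sqSum f S₂ η ^ (t - tri (l - 1)) :=
        Finset.sum_nonneg fun η _ => mul_nonneg (pow_nonneg (sqSum_nonneg _ _ _) _)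
          (pow_nonneg (sqSum_nonneg _ _ _) _)
      have hB0 : 0 ≤ ∑ η, sqSum f S₂ η ^ tri n * sqSum f T η ^ (t - tri n) :=
        Finset.sum_nonneg fun η _ => mul_nonneg (pow_nonneg (sqSum_nonneg _ _ _) _)
          (pow_nonneg (sqSum_nonneg _ _ _) _)
      refine le_of_pow_le_pow_left₀ (Nat.succ_ne_zero n)
        (mul_nonneg (mul_nonneg (pow_nonneg hK _) (pow_nonneg (hE0 _) _))
          (pow_nonneg (hE0 _) _)) ?_
      refine hol.trans ?_
      refine (mul_le_mul (pow_le_pow_left₀ hA0 b1 n) b2 hB0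
        (pow_nonneg (mul_nonneg (pow_nonneg hK₁ _) (mul_nonneg (pow_nonneg (hE0 _) _)
          (pow_nonneg (hE0 _) _))) _)).trans ?_
      change (K₁ ^ t * (E T ^ tri (l - 1) * E S₂ ^ (t - tri (l - 1)))) ^ n *
        (K₂ ^ t * (E S₂ ^ tri n * E T ^ (t - tri n))) ≤
        (K ^ t * E S₂ ^ (t - tri l) * E T ^ tri l) ^ (n + 1)
      have hKt : (K₁ ^ n * K₂) ^ t ≤ (K ^ (n + 1)) ^ t :=
        pow_le_pow_left₀ (mul_nonneg (pow_nonneg hK₁ _) hK₂) hKK t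
      calc (K₁ ^ t * (E T ^ tri (l - 1) * E S₂ ^ (t - tri (l - 1)))) ^ n *
          (K₂ ^ t * (E S₂ ^ tri n * E T ^ (t - tri n)))
          = (K₁ ^ n * K₂) ^ t * (E S₂ ^ ((n + 1) * (t - tri l)) * E T ^ ((n + 1) * tri l)) := by
            rw [e1, e2, pow_add, pow_add, mul_pow, mul_pow, mul_pow, ← pow_mul, ← pow_mul,
              ← pow_mul, ← pow_mul, mul_comm t n, mul_comm _ n, mul_comm _ n]
            ring
        _ ≤ (K ^ (n + 1)) ^ t * (E S₂ ^ ((n + 1) * (t - tri l)) * E T ^ ((n + 1) * tri l)) :=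
            mul_le_mul_of_nonneg_right hKt
              (mul_nonneg (pow_nonneg (hE0 _) _) (pow_nonneg (hE0 _) _))
        _ = _ := by
            rw [mul_pow, mul_pow, ← pow_mul, ← pow_mul, ← pow_mul, ← pow_mul,
              mul_comm (n + 1) t, mul_comm (n + 1), mul_comm (n + 1)]
            ring
  have hsum : ∑ ξ : ZMod (p ^ (a + 1)), E (S₁.filter fun i => (x i : ZMod (p ^ (a + 1))) = ξ) =
      E S₁ := by
    refine sum_classSum_eq ht _ _ _ _ S₁ fun i _ j _ hij => ?_
    rw [intCast_zmod_pow_eq_iff]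
    exact dvd_trans (pow_dvd_pow _ haN) hij
  have main := sum_mul_sqSum_pow_le htl hw f (fun i => (x i : ZMod (p ^ (a + 1)))) S₁
    (by linarith : 0 ≤ K₀) (mul_nonneg (pow_nonneg hK t) (pow_nonneg (hE0 S₂) (t - tri l)))
    hE0 hdec' hpiece hsum
  rw [Finset.sum_congr rfl fun η _ => mul_comm _ _]
  refine main.trans ?_
  have hpw : K₀ ^ tri l ≤ K₀ ^ t := pow_le_pow_right₀ hK₀ hlt
  calc K₀ ^ tri l * (K ^ t * E S₂ ^ (t - tri l) * E S₁ ^ tri l)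
      ≤ K₀ ^ t * (K ^ t * E S₂ ^ (t - tri l) * E S₁ ^ tri l) :=
        mul_le_mul_of_nonneg_right hpw
          (mul_nonneg (mul_nonneg (pow_nonneg hK _) (pow_nonneg (hE0 _) _))
            (pow_nonneg (hE0 _) _))
    _ = _ := by rw [mul_pow]; simp only [hE]; ring

theorem Bil.of_fine {k l b N : ℕ} {K : ℝ} (hlk : l < k) (hbN : b ≤ N) (hK : 0 ≤ K)
    (h : Bil p k l b N K) : Bil p k l 1 N ((p : ℝ) ^ b * K) := by
  intro φ hφ M hM c x u v huv S₁ S₂ hS₁ hS₂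
  set f := wave p M φ c x with hf
  set t := tri k with htdef
  have ht : t ≠ 0 := tri_ne_zero (by omega)
  set E : Finset ℤ → ℝ := fun S => classSum p N t (fun _ => 1) f x S with hE
  have hE0 : ∀ S, 0 ≤ E S := fun S => classSum_nonneg (fun _ => zero_le_one) _ _ _
  have hr : t - tri l ≠ 0 := by have := tri_lt hlk; omega
  have hw : ∀ η, 0 ≤ sqSum f S₁ η ^ tri l := fun η => pow_nonneg (sqSum_nonneg _ _ _) _
  have hp1 : (1 : ℝ) ≤ (p : ℝ) ^ b := one_le_pow₀ (by exact_mod_cast hp.out.one_lt.le)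
  have main := sum_mul_sqSum_pow_le (E := E) hr hw f (fun i => (x i : ZMod (p ^ b))) S₂
    (L := (p : ℝ) ^ b) (by positivity) (B := K ^ t * E S₁ ^ tri l)
    (mul_nonneg (pow_nonneg hK t) (pow_nonneg (hE0 S₁) _))
    hE0 (by
      have := sqNorm_le_card_mul hr hw f (fun i => (x i : ZMod (p ^ b))) S₂
      rw [ZMod.card] at this
      exact_mod_cast this)
    (by
      intro ξ
      set T := S₂.filter fun i => (x i : ZMod (p ^ b)) = ξ with hT
      rcases T.eq_empty_or_nonempty with h0 | ⟨i₀, hi₀⟩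
      · rw [h0]
        have : ∀ η, sqSum f ∅ η = 0 := fun η => by simp [sqSum]
        simp only [this, zero_pow hr, mul_zero, Finset.sum_const_zero]
        exact mul_nonneg (mul_nonneg (pow_nonneg hK _) (pow_nonneg (hE0 _) _))
          (pow_nonneg (hE0 _) _)
      · have hi₀' := Finset.mem_filter.1 hi₀
        have huv' : ¬ (p : ℤ) ∣ u - x i₀ := by
          intro hd
          apply huv
          have hd' := hS₂ i₀ hi₀'.1
          rw [pow_one] at hd'
          have := dvd_add hd hd'
          rwa [sub_add_sub_cancel] at this
        have := h φ hφ M hM c x u (x i₀) huv' S₁ T hS₁ (fun i hi => by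
          rw [← intCast_zmod_pow_eq_iff, hi₀'.2]
          exact (Finset.mem_filter.1 hi).2)
        rw [mul_assoc]
        exact this)
    (sum_classSum_eq ht _ _ _ _ S₂ fun i _ j _ hij => by
      rw [intCast_zmod_pow_eq_iff]
      exact dvd_trans (pow_dvd_pow _ hbN) hij)
  refine main.trans ?_
  have hpw : ((p : ℝ) ^ b) ^ (t - tri l) ≤ ((p : ℝ) ^ b) ^ t :=
    pow_le_pow_right₀ hp1 (Nat.sub_le _ _)
  calc ((p : ℝ) ^ b) ^ (t - tri l) * (K ^ t * E S₁ ^ tri l * E S₂ ^ (t - tri l))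
      ≤ ((p : ℝ) ^ b) ^ t * (K ^ t * E S₁ ^ tri l * E S₂ ^ (t - tri l)) :=
        mul_le_mul_of_nonneg_right hpw
          (mul_nonneg (mul_nonneg (pow_nonneg hK _) (pow_nonneg (hE0 _) _))
            (pow_nonneg (hE0 _) _))
    _ = _ := by rw [mul_pow]; simp only [hE]; ring

end bilinear

/-- A sum is dominated by its largest term unless two terms are of comparable size. -/
theorem norm_sum_pow_le_broad_narrow {ι : Type*} [Fintype ι] [DecidableEq ι] [Nonempty ι]
    (F : ι → ℂ) {t : ℕ} (ht : t ≠ 0) :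
    (‖∑ u, F u‖ ^ 2) ^ t ≤ 4 ^ t * ∑ u, (‖F u‖ ^ 2) ^ t +
      (Fintype.card ι : ℝ) ^ (4 * t) *
        ∑ u, ∑ v ∈ univ.filter (· ≠ u), ‖F u‖ ^ 2 * (‖F v‖ ^ 2) ^ (t - 1) := by
  obtain ⟨u, hu⟩ := Finite.exists_max fun u => ‖F u‖
  set P : ℝ := (Fintype.card ι : ℝ) with hP
  have hP1 : 1 ≤ P := by rw [hP]; exact_mod_cast Fintype.card_pos
  have hP0 : 0 < P := by linarith
  have hA : 0 ≤ ∑ u, (‖F u‖ ^ 2) ^ t := Finset.sum_nonneg fun _ _ => by positivity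
  have hB : 0 ≤ ∑ u, ∑ v ∈ univ.filter (· ≠ u), ‖F u‖ ^ 2 * (‖F v‖ ^ 2) ^ (t - 1) :=
    Finset.sum_nonneg fun _ _ => Finset.sum_nonneg fun _ _ => by positivity
  by_cases h : ∀ v, v ≠ u → ‖F v‖ ≤ ‖F u‖ / P
  · have h1 : ‖∑ u, F u‖ ≤ 2 * ‖F u‖ := by
      rw [← Finset.add_sum_erase univ F (Finset.mem_univ u)]
      refine (norm_add_le _ _).trans ?_
      have h2 : ‖∑ v ∈ univ.erase u, F v‖ ≤ ∑ v ∈ univ.erase u, ‖F u‖ / P :=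
        (norm_sum_le _ _).trans (Finset.sum_le_sum fun v hv => h v (Finset.ne_of_mem_erase hv))
      have h3 : ∑ v ∈ univ.erase u, ‖F u‖ / P ≤ ∑ v : ι, ‖F u‖ / P :=
        Finset.sum_le_sum_of_subset_of_nonneg (Finset.erase_subset _ _)
          fun _ _ _ => by positivity
      have h4 : ∑ v : ι, ‖F u‖ / P = ‖F u‖ := by
        rw [Finset.sum_const, Finset.card_univ, nsmul_eq_mul, ← hP, mul_div_cancel₀ _ hP0.ne']
      linarith
    have h4 : (‖∑ u, F u‖ ^ 2) ^ t ≤ 4 ^ t * (‖F u‖ ^ 2) ^ t := by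
      rw [← mul_pow]
      refine pow_le_pow_left₀ (by positivity) ?_ _
      calc ‖∑ u, F u‖ ^ 2 ≤ (2 * ‖F u‖) ^ 2 := pow_le_pow_left₀ (norm_nonneg _) h1 2
        _ = _ := by ring
    have h5 : (‖F u‖ ^ 2) ^ t ≤ ∑ u, (‖F u‖ ^ 2) ^ t :=
      Finset.single_le_sum (f := fun u => (‖F u‖ ^ 2) ^ t) (fun _ _ => by positivity)
        (Finset.mem_univ u)
    have h6 := mul_le_mul_of_nonneg_left h5 (by positivity : (0 : ℝ) ≤ 4 ^ t)
    have h7 : 0 ≤ P ^ (4 * t) * ∑ u, ∑ v ∈ univ.filter (· ≠ u),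
      ‖F u‖ ^ 2 * (‖F v‖ ^ 2) ^ (t - 1) := by positivity
    linarith
  · push Not at h
    obtain ⟨v, hvu, hv⟩ := h
    have h1 : ‖∑ u, F u‖ ≤ P * ‖F u‖ := by
      refine (norm_sum_le _ _).trans ((Finset.sum_le_sum fun v _ => hu v).trans ?_)
      rw [Finset.sum_const, Finset.card_univ, nsmul_eq_mul]
    have h2 : ‖F u‖ ≤ P * ‖F v‖ := by
      rw [div_lt_iff₀ hP0] at hv; linarith
    have h3 : (‖∑ u, F u‖ ^ 2) ^ t ≤ P ^ (4 * t) * (‖F u‖ ^ 2 * (‖F v‖ ^ 2) ^ (t - 1)) := by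
      obtain ⟨t', rfl⟩ := Nat.exists_eq_succ_of_ne_zero ht
      simp only [Nat.succ_eq_add_one, Nat.add_sub_cancel]
      calc (‖∑ u, F u‖ ^ 2) ^ (t' + 1) ≤ ((P * ‖F u‖) ^ 2) ^ (t' + 1) := by gcongr
        _ = P ^ (2 * (t' + 1)) * ‖F u‖ ^ 2 * (‖F u‖ ^ 2) ^ t' := by
            rw [← pow_mul, mul_pow, ← pow_mul]; ring
        _ ≤ P ^ (2 * (t' + 1)) * ‖F u‖ ^ 2 * ((P * ‖F v‖) ^ 2) ^ t' := by gcongr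
        _ = P ^ (2 * (t' + 1) + 2 * t') * (‖F u‖ ^ 2 * (‖F v‖ ^ 2) ^ t') := by
            rw [mul_pow P, mul_pow (P ^ 2), ← pow_mul P, pow_add]; ring
        _ ≤ _ := by
            refine mul_le_mul_of_nonneg_right (pow_le_pow_right₀ hP1 (by omega)) (by positivity)
    have h4 : ‖F u‖ ^ 2 * (‖F v‖ ^ 2) ^ (t - 1) ≤
        ∑ u, ∑ v ∈ univ.filter (· ≠ u), ‖F u‖ ^ 2 * (‖F v‖ ^ 2) ^ (t - 1) := by
      refine le_trans ?_ (Finset.single_le_sum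
        (f := fun u => ∑ v ∈ univ.filter (· ≠ u), ‖F u‖ ^ 2 * (‖F v‖ ^ 2) ^ (t - 1))
        (fun _ _ => Finset.sum_nonneg fun _ _ => by positivity) (Finset.mem_univ u))
      exact Finset.single_le_sum (f := fun v => ‖F u‖ ^ 2 * (‖F v‖ ^ 2) ^ (t - 1))
        (fun _ _ => by positivity) (Finset.mem_filter.2 ⟨Finset.mem_univ v, hvu⟩)
    have h5 := mul_le_mul_of_nonneg_left h4 (by positivity : (0 : ℝ) ≤ P ^ (4 * t))
    have h6 : 0 ≤ 4 ^ t * ∑ u, (‖F u‖ ^ 2) ^ t := by positivity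
    linarith

theorem sum_pow_le_pow_sum_of_nonneg {ι : Type*} (s : Finset ι) {a : ι → ℝ}
    (ha : ∀ i, 0 ≤ a i) {t : ℕ} (ht : t ≠ 0) : ∑ i ∈ s, a i ^ t ≤ (∑ i ∈ s, a i) ^ t := by
  obtain ⟨t', rfl⟩ := Nat.exists_eq_succ_of_ne_zero ht
  simp only [Nat.succ_eq_add_one, pow_succ']
  rw [Finset.sum_mul]
  refine Finset.sum_le_sum fun i hi => mul_le_mul_of_nonneg_left ?_ (ha i)
  exact pow_le_pow_left₀ (ha i) (Finset.single_le_sum (fun j _ => ha j) hi) _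

section bilinear
open Polynomial
variable {p : ℕ} [hp : Fact p.Prime]

theorem Dec.broad_narrow {k N : ℕ} {D K : ℝ} (hk : 1 < k) (hkp : k < p) (hN : 1 ≤ N)
    (hD : 0 ≤ D) (hK : 0 ≤ K) (h : Dec p k (N - 1) D) (hB : Bil p k 1 1 N K) :
    Dec p k N (4 * D + (p : ℝ) ^ 6 * K) := by
  intro φ hφ M hM c x S
  set f := wave p M φ c x with hf
  set t := tri k with htdef
  have ht : t ≠ 0 := tri_ne_zero (by omega)
  have ht1 : 1 < t := tri_lt hk
  set E : Finset ℤ → ℝ := fun S => classSum p N t (fun _ => 1) f x S with hE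
  have hE0 : ∀ S, 0 ≤ E S := fun S => classSum_nonneg (fun _ => zero_le_one) _ _ _
  set T : ZMod p → Finset ℤ := fun u => S.filter fun i => (x i : ZMod p) = u with hT
  have hTx : ∀ u : ZMod p, ∀ i ∈ T u, (p : ℤ) ∣ x i - (u.val : ℤ) := by
    intro u i hi
    rw [← ZMod.intCast_zmod_eq_zero_iff_dvd]
    push_cast
    rw [ZMod.natCast_zmod_val, (Finset.mem_filter.1 hi).2, sub_self]
  have hsum : ∑ u, E (T u) = E S := by
    refine sum_classSum_eq ht _ _ _ _ S fun i _ j _ hij => ?_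
    rw [← sub_eq_zero, ← Int.cast_sub, ZMod.intCast_zmod_eq_zero_iff_dvd]
    exact dvd_trans (dvd_pow_self _ (by omega)) hij
  have hET : ∀ u, E (T u) ≤ E S := fun u => by
    rw [← hsum]; exact Finset.single_le_sum (fun u _ => hE0 (T u)) (Finset.mem_univ u)
  have hpt : ∀ η, sqSum f S η ^ t ≤ 4 ^ t * ∑ u, sqSum f (T u) η ^ t + (p : ℝ) ^ (4 * t) *
      ∑ u, ∑ v ∈ univ.filter (· ≠ u), sqSum f (T u) η * sqSum f (T v) η ^ (t - 1) := by
    intro η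
    have := norm_sum_pow_le_broad_narrow (fun u : ZMod p => ∑ i ∈ T u, f i η) ht
    rw [ZMod.card] at this
    rw [hT, Finset.sum_fiberwise] at this
    exact this
  have hnar : ∀ u, ∑ η, sqSum f (T u) η ^ t ≤ (D * E (T u)) ^ t := by
    intro u
    rw [sum_sqSum_pow ht]
    refine pow_le_pow_left₀ (sqNorm_nonneg (fun _ => zero_le_one) _ _) ?_ _
    exact h.rescale (by omega) hkp le_rfl hN hD hφ hM c x (u.val : ℤ) (T u)
      (fun i hi => by rw [pow_one]; exact hTx u i hi)
  have hbro : ∀ u v, v ≠ u → ∑ η, sqSum f (T u) η * sqSum f (T v) η ^ (t - 1) ≤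
      K ^ t * E S ^ t := by
    intro u v huv
    have huv' : ¬ (p : ℤ) ∣ (u.val : ℤ) - (v.val : ℤ) := by
      rw [← ZMod.intCast_zmod_eq_zero_iff_dvd]
      push_cast
      rw [ZMod.natCast_zmod_val, ZMod.natCast_zmod_val, sub_eq_zero]
      exact fun h => huv h.symm
    have := hB φ hφ M hM c x _ _ huv' (T u) (T v) (hTx u)
      (fun i hi => by rw [pow_one]; exact hTx v i hi)
    rw [tri_one] at this
    simp only [pow_one] at this
    refine this.trans (mul_le_mul_of_nonneg_left ?_ (pow_nonneg hK _))
    calc E (T u) * E (T v) ^ (t - 1) ≤ E S * E S ^ (t - 1) :=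
          mul_le_mul (hET u) (pow_le_pow_left₀ (hE0 _) (hET v) _) (pow_nonneg (hE0 _) _) (hE0 _)
      _ = E S ^ t := by rw [← pow_succ']; congr 1; omega
  have hp1 : (1 : ℝ) ≤ p := by exact_mod_cast hp.out.one_lt.le
  have main : ∑ η, sqSum f S η ^ t ≤ ((4 * D + (p : ℝ) ^ 6 * K) * E S) ^ t := by
    calc ∑ η, sqSum f S η ^ t ≤ ∑ η, (4 ^ t * ∑ u, sqSum f (T u) η ^ t + (p : ℝ) ^ (4 * t) *
          ∑ u, ∑ v ∈ univ.filter (· ≠ u), sqSum f (T u) η * sqSum f (T v) η ^ (t - 1)) :=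
          Finset.sum_le_sum fun η _ => hpt η
      _ = 4 ^ t * ∑ u, ∑ η, sqSum f (T u) η ^ t + (p : ℝ) ^ (4 * t) *
          ∑ u, ∑ v ∈ univ.filter (· ≠ u), ∑ η, sqSum f (T u) η * sqSum f (T v) η ^ (t - 1) := by
          rw [Finset.sum_add_distrib, ← Finset.mul_sum, ← Finset.mul_sum]
          congr 2
          · exact Finset.sum_comm
          · rw [Finset.sum_comm]
            exact Finset.sum_congr rfl fun u _ => Finset.sum_comm
      _ ≤ 4 ^ t * ∑ u, (D * E (T u)) ^ t + (p : ℝ) ^ (4 * t) *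
          ∑ u : ZMod p, ∑ v ∈ univ.filter (· ≠ u), K ^ t * E S ^ t := by
          gcongr with u _ u _ v hv
          · exact hnar u
          · exact hbro u v (Finset.mem_filter.1 hv).2
      _ ≤ 4 ^ t * (D * E S) ^ t + (p : ℝ) ^ (4 * t) * ((p : ℝ) ^ (2 * t) * (K ^ t * E S ^ t)) := by
          have e1 : ∑ u, (D * E (T u)) ^ t ≤ (D * E S) ^ t := by
            refine (sum_pow_le_pow_sum_of_nonneg _ (fun u => mul_nonneg hD (hE0 _)) ht).trans ?_
            rw [← Finset.mul_sum, hsum]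
          have hx : 0 ≤ K ^ t * E S ^ t := mul_nonneg (pow_nonneg hK _) (pow_nonneg (hE0 _) _)
          have e2 : ∑ u : ZMod p, ∑ v ∈ univ.filter (· ≠ u), K ^ t * E S ^ t ≤
              (p : ℝ) ^ (2 * t) * (K ^ t * E S ^ t) := by
            calc ∑ u : ZMod p, ∑ v ∈ univ.filter (· ≠ u), K ^ t * E S ^ t
                ≤ ∑ u : ZMod p, ∑ v : ZMod p, K ^ t * E S ^ t :=
                  Finset.sum_le_sum fun u _ => Finset.sum_le_sum_of_subset_of_nonneg
                    (Finset.filter_subset _ _) fun _ _ _ => hx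
              _ = (p : ℝ) ^ 2 * (K ^ t * E S ^ t) := by
                  simp only [Finset.sum_const, Finset.card_univ, ZMod.card, nsmul_eq_mul]
                  ring
              _ ≤ _ := mul_le_mul_of_nonneg_right (pow_le_pow_right₀ hp1 (by omega)) hx
          gcongr
      _ = (4 * D * E S) ^ t + ((p : ℝ) ^ 6 * K * E S) ^ t := by
          simp only [mul_pow, ← pow_mul]
          ring
      _ ≤ _ := by
          have a1 : 0 ≤ 4 * D * E S := mul_nonneg (by positivity) (hE0 S)
          have a2 : 0 ≤ (p : ℝ) ^ 6 * K * E S := mul_nonneg (by positivity) (hE0 S)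
          have := pow_add_pow_le a1 a2 ht
          rwa [← add_mul] at this
  rw [sum_sqSum_pow ht] at main
  exact le_of_pow_le_pow_left₀ ht (mul_nonneg (by positivity) (hE0 S)) main

end bilinear

section iteration
variable (p : ℕ) [hp : Fact p.Prime]

/-- Power-type decoupling bounds with exponent `θ`. -/
def DecBound (k : ℕ) (θ : ℝ) : Prop :=
  ∃ C : ℝ, 1 ≤ C ∧ ∀ N : ℕ, Dec p k N (C * (p : ℝ) ^ (θ * N))

/-- Power-type bilinear bounds, with a gain of `τ * l * (k - l) + θ / k * (k - l)` in each step
of the finer scale. -/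
def BilBound (k : ℕ) (θ τ : ℝ) (D : ℕ) : Prop :=
  ∃ C : ℝ, 1 ≤ C ∧ ∀ N b : ℕ, 1 ≤ b → b * D ≤ N → ∀ l < k,
    Bil p k l b N (C * (p : ℝ) ^
      (θ * N - (τ * l * ((k : ℝ) - l) + θ / k * ((k : ℝ) - l)) * b))

variable {p}

theorem DecBound.mono {k : ℕ} {θ θ' : ℝ} (h : DecBound p k θ) (hθ : θ ≤ θ') : DecBound p k θ' := by
  obtain ⟨C, hC, h⟩ := h
  have hp1 : (1 : ℝ) ≤ p := by exact_mod_cast hp.out.one_lt.le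
  refine ⟨C, hC, fun N => (h N).mono ?_⟩
  gcongr

theorem decBound_one_of_ne_zero {k : ℕ} (hk : k ≠ 0) : DecBound p k 1 :=
  ⟨1, le_rfl, fun N => (dec_trivial hk N).mono (by
    rw [one_mul, one_mul, Real.rpow_natCast])⟩

theorem DecBound.bilBound {k : ℕ} {θ : ℝ} (hk : k ≠ 0) (hkp : k < p) (hθ : 0 ≤ θ)
    (h : DecBound p k θ) : BilBound p k θ (-(θ / k)) 1 := by
  obtain ⟨C, hC, h⟩ := h
  have hp1 : (1 : ℝ) ≤ p := by exact_mod_cast hp.out.one_lt.le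
  have hk0 : (0 : ℝ) < k := by exact_mod_cast Nat.pos_of_ne_zero hk
  refine ⟨C, hC, fun N b hb hbN l hl => ?_⟩
  rcases Nat.eq_zero_or_pos l with rfl | hl0
  · refine (bil_zero hk hkp hb (by omega) (h (N - b)) (by positivity)).mono (by positivity) ?_
    refine le_of_eq ?_
    congr 2
    rw [Nat.cast_sub (by omega)]
    field_simp
    push_cast
    ring
  · refine ((h N).bil hk (by positivity) hl.le b).mono (by positivity) ?_
    gcongr
    have h1 : (1 : ℝ) ≤ l := by exact_mod_cast hl0
    have h2 : (0 : ℝ) ≤ (k : ℝ) - l := by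
      rw [sub_nonneg]; exact_mod_cast hl.le
    have h3 : 0 ≤ θ / k := by positivity
    have h4 : 0 ≤ (θ / k) * ((k : ℝ) - l) * ((l : ℝ) - 1) * b :=
      mul_nonneg (mul_nonneg (mul_nonneg h3 h2) (by linarith)) (by positivity)
    nlinarith

theorem exponent_step_le {ε ε' θ τ δ n l b A N G E₁ E₂ : ℝ} (hε : 0 < ε) (hεθ : ε ≤ θ)
    (hε' : ε' = ε / (2 * (n + l) ^ 2)) (hδ : δ = ε / (2 * (n + l) ^ 3)) (hl : 1 ≤ l) (hn : 1 ≤ n)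
    (hb : 0 ≤ b) (hA : |l * A - (n + 1) * b| ≤ l) (hG : G = |τ| * (n + l) ^ 2 + θ)
    (hE₁ : E₁ = θ * N - (τ * (l - 1) * (n + l - (l - 1)) + θ / (n + l) * (n + l - (l - 1))) * b)
    (hE₂ : E₂ = θ * N - (τ * n * (n + l - n) + θ / (n + l) * (n + l - n)) * A) :
    ε' * ((n + l) * b) + (n * E₁ + E₂) / (n + 1) ≤
      G + (θ * N - ((τ + δ) * l * (n + l - l) + θ / (n + l) * (n + l - l)) * b) := by
  set K := n + l with hK
  have hK0 : 0 < K := by linarith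
  set r := l * A - (n + 1) * b with hr
  set g := τ * n + θ / K with hg
  have h1 : (n * E₁ + E₂) / (n + 1) =
      θ * N - ((τ * n * l + θ / K * n) * b + θ / K * b + g * r / (n + 1)) := by
    rw [hE₁, hE₂, hg, hr, hK]
    field_simp
    ring
  have h2 : -(g * r / (n + 1)) ≤ G := by
    refine (neg_le_abs _).trans ?_
    rw [abs_div, abs_mul, abs_of_pos (by linarith : (0 : ℝ) < n + 1)]
    have e1 : |g| ≤ |τ| * n + θ / K := by
      refine (abs_add_le _ _).trans (le_of_eq ?_)
      rw [abs_mul, abs_of_pos (by linarith : (0 : ℝ) < n),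
        abs_of_pos (div_pos (by linarith) hK0 : 0 < θ / K)]
    have e2 : |g| * |r| / (n + 1) ≤ |g| * |r| :=
      div_le_self (by positivity) (by linarith)
    have e3 : |g| * |r| ≤ (|τ| * n + θ / K) * l :=
      mul_le_mul e1 hA (abs_nonneg _) ((abs_nonneg _).trans e1)
    have e4 : θ / K * l ≤ θ := by
      rw [div_mul_eq_mul_div, div_le_iff₀ hK0]
      exact mul_le_mul_of_nonneg_left (by linarith) (by linarith)
    have e5 : n * l ≤ K ^ 2 := by rw [hK]; nlinarith
    have e6 : |τ| * (n * l) ≤ |τ| * K ^ 2 := mul_le_mul_of_nonneg_left e5 (abs_nonneg _)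
    rw [hG]
    linarith
  have h3 : ε' * K + δ * (l * n) ≤ θ / K := by
    have e5 : l * n ≤ K ^ 2 := by rw [hK]; nlinarith
    have hδ0 : 0 ≤ δ := by rw [hδ]; positivity
    calc ε' * K + δ * (l * n) ≤ ε' * K + δ * K ^ 2 := by gcongr
      _ = ε / K := by rw [hε', hδ]; field_simp; ring
      _ ≤ θ / K := by gcongr
  have h4 := mul_le_mul_of_nonneg_right h3 hb
  rw [h1]
  have h5 : K - l = n := by rw [hK]; ring
  rw [h5]
  nlinarith

theorem BilBound.step {k : ℕ} {ε ε' θ τ δ C' : ℝ} {D : ℕ} (hkp : k < p)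
    (hε : 0 < ε) (hεθ : ε ≤ θ) (hε' : ε' = ε / (2 * k ^ 2)) (hδ : δ = ε / (2 * k ^ 3))
    (hC' : 1 ≤ C') (hlow : ∀ l, 1 ≤ l → l < k → ∀ N : ℕ, Dec p l N (C' * (p : ℝ) ^ (ε' * N)))
    (hD : 1 ≤ D) (hdec : DecBound p k θ) (h : BilBound p k θ τ D) :
    BilBound p k θ (τ + δ) (k * D) := by
  obtain ⟨C₁, hC₁, hdec⟩ := hdec
  obtain ⟨C, hC, h⟩ := h
  have hp1 : (1 : ℝ) ≤ p := by exact_mod_cast hp.out.one_lt.le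
  have hp0 : (0 : ℝ) < p := by linarith
  have hθ : 0 < θ := by linarith
  set G : ℝ := |τ| * k ^ 2 + θ with hG
  have hG0 : 0 ≤ G := by positivity
  have hpG : (1 : ℝ) ≤ (p : ℝ) ^ G := Real.one_le_rpow hp1 hG0
  refine ⟨C₁ * (C' * C * (p : ℝ) ^ G), ?_, fun N b hb hbN l hl => ?_⟩
  · have : 1 ≤ C' * C := one_le_mul_of_one_le_of_one_le hC' hC
    exact one_le_mul_of_one_le_of_one_le hC₁ (one_le_mul_of_one_le_of_one_le this hpG)
  have hk1 : 1 ≤ k := by omega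
  have hk1' : (1 : ℝ) ≤ k := by exact_mod_cast hk1
  have hk0 : (0 : ℝ) < k := by linarith
  have hbkN : b * k ≤ N := by
    calc b * k ≤ b * (k * D) := Nat.mul_le_mul_left _ (Nat.le_mul_of_pos_right _ hD)
      _ ≤ N := hbN
  have hbleN : b ≤ N := (Nat.le_mul_of_pos_right _ hk1).trans hbkN
  rcases Nat.eq_zero_or_pos l with rfl | hl0
  · refine (bil_zero (by omega) hkp hb hbleN (hdec (N - b)) (by positivity)).mono (by positivity) ?_
    have : θ * (N : ℝ) - ((τ + δ) * (0 : ℕ) * ((k : ℝ) - (0 : ℕ)) + θ / k * ((k : ℝ) - (0 : ℕ))) * b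
        = θ * ((N - b : ℕ) : ℝ) := by
      rw [Nat.cast_sub hbleN]
      field_simp
      push_cast
      ring
    rw [this, mul_assoc C₁]
    gcongr
    refine le_mul_of_one_le_left (by positivity) ?_
    exact one_le_mul_of_one_le_of_one_le (one_le_mul_of_one_le_of_one_le hC' hC) hpG
  · obtain ⟨n, rfl⟩ : ∃ n, k = n + l := ⟨k - l, by omega⟩
    have hn0 : n ≠ 0 := by omega
    have hcast : ((n + l : ℕ) : ℝ) = n + l := by push_cast; ring
    set A : ℕ := max 1 ((n + 1) * b / l) with hA
    have hA1 : 1 ≤ A := le_max_left _ _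
    have hAb : A ≤ (n + l) * b := by
      refine max_le ?_ ?_
      · exact Nat.mul_pos (by omega) hb
      · refine (Nat.div_le_self _ _).trans ?_
        exact Nat.mul_le_mul_right _ (by omega)
    have hAD : A * D ≤ N := by
      calc A * D ≤ (n + l) * b * D := Nat.mul_le_mul_right _ hAb
        _ = b * ((n + l) * D) := by ring
        _ ≤ N := hbN
    have hlR : (1 : ℝ) ≤ l := by exact_mod_cast hl0
    have hnR : (1 : ℝ) ≤ n := by exact_mod_cast Nat.pos_of_ne_zero hn0
    have hbR : (1 : ℝ) ≤ b := by exact_mod_cast hb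
    have habs : |(l : ℝ) * A - (n + 1) * b| ≤ l := by
      have e1 : (n + 1) * b / l * l ≤ (n + 1) * b := Nat.div_mul_le_self _ _
      have e2 : (n + 1) * b < ((n + 1) * b / l + 1) * l := by
        have := Nat.lt_div_mul_add (a := (n + 1) * b) (b := l) hl0
        linarith
      rw [abs_le]
      rcases le_total 1 ((n + 1) * b / l) with h5 | h5
      · rw [max_eq_right h5] at hA
        rw [← hA] at e1 e2
        have e1' : (A : ℝ) * l ≤ (n + 1) * b := by exact_mod_cast e1
        have e2' : ((n : ℝ) + 1) * b < (A + 1) * l := by exact_mod_cast e2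
        constructor <;> nlinarith
      · rw [max_eq_left h5] at hA
        have e2' : ((n : ℝ) + 1) * b ≤ 2 * l := by
          have : ((n + 1) * b / l + 1) * l ≤ 2 * l := Nat.mul_le_mul_right _ (by omega)
          exact_mod_cast (e2.le.trans this)
        rw [hA]
        push_cast
        constructor <;> nlinarith
    have h₁ := h N b hb ((Nat.mul_le_mul_left b (Nat.le_mul_of_pos_left D hk1)).trans hbN)
      (l - 1) (by omega)
    have h₂ := h N A hA1 hAD n (by omega)
    set E₁ : ℝ := θ * N - (τ * (l - 1 : ℕ) * (((n + l : ℕ) : ℝ) - (l - 1 : ℕ)) +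
      θ / ((n + l : ℕ) : ℝ) * (((n + l : ℕ) : ℝ) - (l - 1 : ℕ))) * b with hE₁
    set E₂ : ℝ := θ * N - (τ * n * (((n + l : ℕ) : ℝ) - n) +
      θ / ((n + l : ℕ) : ℝ) * (((n + l : ℕ) : ℝ) - n)) * A with hE₂
    have hdec' : A - 1 = 0 ∨ (Dec p l (A - 1) (C' * (p : ℝ) ^ (ε' * (((n + l : ℕ) : ℝ) * b))) ∧
        l * (A - 1 + 1) ≤ b * (n + 1)) := by
      by_cases h5 : A = 1
      · left; omega
      · right
        have hA' : A = (n + 1) * b / l := by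
          rcases le_total 1 ((n + 1) * b / l) with h6 | h6
          · rw [hA, max_eq_right h6]
          · rw [max_eq_left h6] at hA; omega
        constructor
        · refine (hlow l hl0 hl (A - 1)).mono ?_
          have hε'0 : 0 ≤ ε' := by rw [hε']; positivity
          have : ((A - 1 : ℕ) : ℝ) ≤ ((n + l : ℕ) : ℝ) * b := by
            exact_mod_cast (Nat.sub_le _ _).trans hAb
          gcongr
        · rw [Nat.sub_add_cancel hA1, hA', mul_comm b, mul_comm l]
          exact Nat.div_mul_le_self _ _
    have hε'0 : 0 ≤ ε' := by rw [hε']; positivity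
    have key := Bil.step (K := C * (p : ℝ) ^ ((n * E₁ + E₂) / (n + 1))) (by omega) rfl hkp hn0 hb
      hbleN (a := A - 1)
      (by
        rw [Nat.sub_add_cancel hA1]
        exact (Nat.le_mul_of_pos_right _ hD).trans hAD) hdec'
      (one_le_mul_of_one_le_of_one_le hC' (Real.one_le_rpow hp1 (by positivity))) h₁
      (by rwa [Nat.sub_add_cancel hA1]) (by positivity) (by positivity) (by positivity)
      (by
        refine le_of_eq ?_
        rw [mul_pow, mul_pow, ← Real.rpow_natCast, ← Real.rpow_natCast, ← Real.rpow_natCast,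
          ← Real.rpow_natCast, ← Real.rpow_mul hp0.le, ← Real.rpow_mul hp0.le]
        have e1 : (n * E₁ + E₂) / (n + 1) * ((n + 1 : ℕ) : ℝ) = E₁ * n + E₂ := by
          push_cast; field_simp
        have hC0 : 0 < C := by linarith
        rw [e1, Real.rpow_add hp0]
        push_cast
        rw [Real.rpow_add hC0, Real.rpow_one]
        ring)
    refine key.mono (by positivity) ?_
    have hexp : ε' * (((n + l : ℕ) : ℝ) * b) + (n * E₁ + E₂) / (n + 1) ≤ G +
        (θ * N - ((τ + δ) * l * (((n + l : ℕ) : ℝ) - l) +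
          θ / ((n + l : ℕ) : ℝ) * (((n + l : ℕ) : ℝ) - l)) * b) := by
      have hl1 : ((l - 1 : ℕ) : ℝ) = l - 1 := by rw [Nat.cast_sub hl0]; simp
      rw [hcast] at hE₁ hE₂ hG hk0 hε' hδ ⊢
      rw [hl1] at hE₁
      exact exponent_step_le hε hεθ hε' hδ hlR hnR (by linarith) habs hG hE₁ hE₂
    calc C' * (p : ℝ) ^ (ε' * (((n + l : ℕ) : ℝ) * b)) * (C * (p : ℝ) ^ ((n * E₁ + E₂) / (n + 1)))
        = C' * C * (p : ℝ) ^ (ε' * (((n + l : ℕ) : ℝ) * b) + (n * E₁ + E₂) / (n + 1)) := by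
          rw [Real.rpow_add hp0]; ring
      _ ≤ C' * C * ((p : ℝ) ^ G * (p : ℝ) ^ (θ * N - ((τ + δ) * l * (((n + l : ℕ) : ℝ) - l) +
          θ / ((n + l : ℕ) : ℝ) * (((n + l : ℕ) : ℝ) - l)) * b)) := by
          rw [← Real.rpow_add hp0]
          gcongr
      _ = 1 * (C' * C * (p : ℝ) ^ G * (p : ℝ) ^ (θ * N - ((τ + δ) * l * (((n + l : ℕ) : ℝ) - l) +
          θ / ((n + l : ℕ) : ℝ) * (((n + l : ℕ) : ℝ) - l)) * b)) := by ring
      _ ≤ C₁ * (C' * C * (p : ℝ) ^ G * (p : ℝ) ^ (θ * N - ((τ + δ) * l * (((n + l : ℕ) : ℝ) - l) +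
          θ / ((n + l : ℕ) : ℝ) * (((n + l : ℕ) : ℝ) - l)) * b)) := by gcongr
      _ = _ := by ring

/-- Iterating the bilinear step until the gain beats the loss from passing to fine scales. -/
theorem BilBound.iterate {k : ℕ} {ε ε' θ δ C' : ℝ} (hk : k ≠ 0) (hkp : k < p)
    (hε : 0 < ε) (hεθ : ε ≤ θ) (hε' : ε' = ε / (2 * k ^ 2)) (hδ : δ = ε / (2 * k ^ 3))
    (hC' : 1 ≤ C') (hlow : ∀ l, 1 ≤ l → l < k → ∀ N : ℕ, Dec p l N (C' * (p : ℝ) ^ (ε' * N)))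
    (hdec : DecBound p k θ) (J : ℕ) : BilBound p k θ (-(θ / k) + J * δ) (k ^ J) := by
  induction J with
  | zero => simpa using hdec.bilBound hk hkp (by linarith)
  | succ J ih =>
    have := ih.step hkp hε hεθ hε' hδ hC' hlow (Nat.one_le_pow _ _ (by omega)) hdec
    rw [pow_succ', Nat.cast_succ, add_mul, one_mul, ← add_assoc]
    exact this

theorem BilBound.bil_one {k D : ℕ} {θ τ : ℝ} (hk : 1 < k) (hθ : 0 ≤ θ) (hτ : 2 ≤ τ) (hD : 1 ≤ D)
    (h : BilBound p k θ τ D) {θ' : ℝ} (hθ' : θ - 1 / D ≤ θ') (hθ0 : 0 ≤ θ') :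
    ∃ C : ℝ, 1 ≤ C ∧ ∀ N : ℕ, Bil p k 1 1 N (C * (p : ℝ) ^ (θ' * N)) := by
  obtain ⟨C, hC, h⟩ := h
  have hp1 : (1 : ℝ) ≤ p := by exact_mod_cast hp.out.one_lt.le
  have hp0 : (0 : ℝ) < p := by linarith
  have hpD : (1 : ℝ) ≤ (p : ℝ) ^ D := one_le_pow₀ hp1
  have hD0 : (0 : ℝ) < D := by exact_mod_cast hD
  refine ⟨C * p + (p : ℝ) ^ D, by nlinarith, fun N => ?_⟩
  rcases lt_or_ge N D with hN | hN
  · refine ((dec_trivial (p := p) (k := k) (by omega) N).bil (by omega) (by positivity)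
      hk.le 1).mono (by positivity) ?_
    have h1 : (p : ℝ) ^ N ≤ (p : ℝ) ^ D := pow_le_pow_right₀ hp1 hN.le
    have h2 : (1 : ℝ) ≤ (p : ℝ) ^ (θ' * N) := Real.one_le_rpow hp1 (by positivity)
    have h3 : 0 ≤ C * p := by positivity
    calc (p : ℝ) ^ N ≤ (C * p + (p : ℝ) ^ D) * 1 := by linarith
      _ ≤ _ := by gcongr
  · set b := N / D with hb
    have hb1 : 1 ≤ b := Nat.div_pos hN hD
    have hbN : b * D ≤ N := Nat.div_mul_le_self _ _
    have hbleN : b ≤ N := Nat.div_le_self _ _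
    refine ((h N b hb1 hbN 1 hk).of_fine hk hbleN (by positivity)).mono (by positivity) ?_
    have hkR : (2 : ℝ) ≤ k := by exact_mod_cast hk
    have hgain : (2 : ℝ) ≤ τ * (1 : ℕ) * ((k : ℝ) - (1 : ℕ)) + θ / k * ((k : ℝ) - (1 : ℕ)) := by
      have e1 : 0 ≤ θ / k * ((k : ℝ) - 1) := mul_nonneg (by positivity) (by linarith)
      push_cast
      nlinarith
    have hbR : (N : ℝ) / D ≤ b + 1 := by
      rw [div_le_iff₀ hD0]
      have : N < (b + 1) * D := by
        have := Nat.lt_div_mul_add (a := N) (b := D) hD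
        rw [hb]; linarith
      exact_mod_cast this.le
    have hb0 : (0 : ℝ) ≤ b := by positivity
    have hexp : (b : ℝ) + (θ * N - (τ * (1 : ℕ) * ((k : ℝ) - (1 : ℕ)) +
        θ / k * ((k : ℝ) - (1 : ℕ))) * b) ≤ 1 + θ' * N := by
      have e1 := mul_le_mul_of_nonneg_right hgain hb0
      have e2 : (θ - 1 / D) * N ≤ θ' * N := by gcongr
      have e3 : (θ - 1 / D) * N = θ * N - (N : ℝ) / D := by ring
      linarith
    calc (p : ℝ) ^ b * (C * (p : ℝ) ^ (θ * N - (τ * (1 : ℕ) * ((k : ℝ) - (1 : ℕ)) +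
        θ / k * ((k : ℝ) - (1 : ℕ))) * b))
        = C * (p : ℝ) ^ ((b : ℝ) + (θ * N - (τ * (1 : ℕ) * ((k : ℝ) - (1 : ℕ)) +
        θ / k * ((k : ℝ) - (1 : ℕ))) * b)) := by
          rw [Real.rpow_add hp0, Real.rpow_natCast]; ring
      _ ≤ C * (p : ℝ) ^ (1 + θ' * N) := by gcongr
      _ = C * p * (p : ℝ) ^ (θ' * N) := by rw [Real.rpow_add hp0, Real.rpow_one]; ring
      _ ≤ _ := by
          refine mul_le_mul_of_nonneg_right ?_ (by positivity)
          linarith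

theorem decBound_of_bil_one {k : ℕ} {θ' C : ℝ} (hk : 1 < k) (hkp : k < p)
    (hpθ : 8 ≤ (p : ℝ) ^ θ') (hC : 1 ≤ C)
    (h : ∀ N : ℕ, Bil p k 1 1 N (C * (p : ℝ) ^ (θ' * N))) : DecBound p k θ' := by
  have hp1 : (1 : ℝ) ≤ p := by exact_mod_cast hp.out.one_lt.le
  have hp0 : (0 : ℝ) < p := by linarith
  have hp6 : (1 : ℝ) ≤ (p : ℝ) ^ 6 := one_le_pow₀ hp1
  refine ⟨2 * (p : ℝ) ^ 6 * C, by nlinarith, fun N => ?_⟩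
  induction N with
  | zero =>
    refine (dec_trivial (by omega) 0).mono ?_
    simp only [pow_zero, Nat.cast_zero, mul_zero, Real.rpow_zero, mul_one]
    nlinarith
  | succ N ih =>
    refine (Dec.broad_narrow (D := 2 * (p : ℝ) ^ 6 * C * (p : ℝ) ^ (θ' * N)) hk hkp (by omega)
      (by positivity) (by positivity) (by simpa using ih) (h (N + 1))).mono ?_
    have e1 : (p : ℝ) ^ (θ' * ((N + 1 : ℕ) : ℝ)) = (p : ℝ) ^ θ' * (p : ℝ) ^ (θ' * N) := by
      rw [← Real.rpow_add hp0]; push_cast; congr 1; ring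
    rw [e1]
    have e2 : 0 ≤ (p : ℝ) ^ 6 * C * (p : ℝ) ^ (θ' * N) := by positivity
    nlinarith

theorem DecBound.improve {k : ℕ} {ε : ℝ} (hk : 1 < k) (hkp : k < p) (hε : 0 < ε)
    (hpε : 8 ≤ (p : ℝ) ^ ε)
    (hlow : ∃ C' : ℝ, 1 ≤ C' ∧ ∀ l, 1 ≤ l → l < k → ∀ N : ℕ,
      Dec p l N (C' * (p : ℝ) ^ (ε / (2 * k ^ 2) * N))) : DecBound p k ε := by
  obtain ⟨C', hC', hlow⟩ := hlow
  have hp1 : (1 : ℝ) ≤ p := by exact_mod_cast hp.out.one_lt.le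
  have hk0 : (0 : ℝ) < k := by exact_mod_cast (by omega : 0 < k)
  have hkR : (1 : ℝ) ≤ k := by exact_mod_cast hk.le
  set δ : ℝ := ε / (2 * k ^ 3) with hδ
  have hδ0 : 0 < δ := by positivity
  obtain ⟨J, hJ⟩ := exists_nat_ge ((2 + max 1 ε) / δ)
  rw [div_le_iff₀ hδ0] at hJ
  have hDpos : 1 ≤ k ^ J := Nat.one_le_pow _ _ (by omega)
  have hD0 : (0 : ℝ) < ((k ^ J : ℕ) : ℝ) := by exact_mod_cast hDpos
  have main : ∀ m : ℕ, DecBound p k (max (1 - m * (1 / ((k ^ J : ℕ) : ℝ))) ε) := by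
    intro m
    induction m with
    | zero =>
      exact (decBound_one_of_ne_zero (by omega)).mono (by simp)
    | succ m ih =>
      set θ := max (1 - m * (1 / ((k ^ J : ℕ) : ℝ))) ε with hθ
      have hθε : ε ≤ θ := le_max_right _ _
      have hθ1 : θ ≤ max 1 ε := by
        refine max_le_max_right _ ?_
        have : 0 ≤ m * (1 / ((k ^ J : ℕ) : ℝ)) := by positivity
        linarith
      have hθk : θ / k ≤ max 1 ε := (div_le_self (by linarith) hkR).trans hθ1
      have hB := BilBound.iterate (by omega) hkp hε hθε rfl hδ hC' hlow ih J
      obtain ⟨C, hC, hB⟩ := hB.bil_one hk (by linarith) (by linarith) hDpos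
        (θ' := max (1 - (m + 1 : ℕ) * (1 / ((k ^ J : ℕ) : ℝ))) ε)
        (by
          rw [sub_le_iff_le_add, hθ]
          refine max_le ?_ ?_
          · have := le_max_left (1 - (m + 1 : ℕ) * (1 / ((k ^ J : ℕ) : ℝ))) ε
            refine le_trans (le_of_eq ?_) (add_le_add_left this _)
            push_cast; ring
          · have := le_max_right (1 - (m + 1 : ℕ) * (1 / ((k ^ J : ℕ) : ℝ))) ε
            have h2 : 0 ≤ 1 / ((k ^ J : ℕ) : ℝ) := by positivity
            linarith)
        (hε.le.trans (le_max_right _ _))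
      refine decBound_of_bil_one hk hkp (hpε.trans ?_) hC hB
      exact Real.rpow_le_rpow_of_exponent_le hp1 (le_max_right _ _)
  obtain ⟨m, hm⟩ := exists_nat_ge ((k ^ J : ℕ) : ℝ)
  refine (main m).mono (max_le ?_ le_rfl)
  have : 1 ≤ m * (1 / ((k ^ J : ℕ) : ℝ)) := by
    rw [mul_one_div, le_div_iff₀ hD0]; linarith
  linarith

end iteration

/-- The `p`-adic `ℓ²` decoupling theorem for the moment curve at the critical exponent. -/
theorem decBound_of_large_prime {k : ℕ} (hk : k ≠ 0) {ε : ℝ} (hε : 0 < ε) :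
    ∃ p₀ : ℕ, ∀ p : ℕ, ∀ _ : Fact p.Prime, p₀ ≤ p → DecBound p k ε := by
  induction k using Nat.strong_induction_on generalizing ε with
  | _ k ih =>
    rcases Nat.lt_or_ge 1 k with hk1 | hk1
    · have hε' : 0 < ε / (2 * k ^ 2) := by
        have : (0 : ℝ) < k := by exact_mod_cast (by omega : 0 < k)
        positivity
      choose! P hP using fun l (hl : l < k) (hl0 : l ≠ 0) => ih l hl hl0 hε'
      obtain ⟨m, hm⟩ := exists_nat_ge ((8 : ℝ) ^ (1 / ε))
      refine ⟨∑ l ∈ range k, P l + m + k + 1, fun p hp hpp => ?_⟩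
      have h1 : ∀ l ∈ range k, l ≠ 0 → DecBound p l (ε / (2 * k ^ 2)) := fun l hl hl0 =>
        hP l (mem_range.1 hl) hl0 p hp (by
          have := Finset.single_le_sum (f := P) (fun _ _ => Nat.zero_le _) hl
          omega)
      choose! C hC1 hC using h1
      refine DecBound.improve hk1 (by omega) hε ?_ ⟨1 + ∑ l ∈ range k, |C l|, ?_, ?_⟩
      · have hmp : (8 : ℝ) ^ (1 / ε) ≤ p := hm.trans (by exact_mod_cast (by omega : m ≤ p))
        calc (8 : ℝ) = ((8 : ℝ) ^ (1 / ε)) ^ ε := by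
              rw [← Real.rpow_mul (by norm_num), one_div, inv_mul_cancel₀ hε.ne', Real.rpow_one]
          _ ≤ _ := Real.rpow_le_rpow (by positivity) hmp hε.le
      · have := Finset.sum_nonneg fun l (_ : l ∈ range k) => abs_nonneg (C l)
        linarith
      · intro l hl hlk N
        refine (hC l (mem_range.2 hlk) (by omega) N).mono ?_
        refine mul_le_mul_of_nonneg_right ?_ (by positivity)
        have := Finset.single_le_sum (f := fun l => |C l|) (fun _ _ => abs_nonneg _)
          (mem_range.2 hlk)
        have h2 := le_abs_self (C l)
        linarith
    · obtain rfl : k = 1 := by omega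
      refine ⟨0, fun p hp _ => ⟨1, le_rfl, fun N => (dec_one N).mono ?_⟩⟩
      have hp1 : (1 : ℝ) ≤ p := by exact_mod_cast hp.out.one_lt.le
      rw [one_mul]
      exact Real.one_le_rpow hp1 (by positivity)

section counting

/-- A lower bound for the mean square of a sum of additive characters. -/
theorem card_mul_card_filter_eq_le {G ι : Type*} [AddCommGroup G] [Fintype G]
    (χ : ι → AddChar G ℂ) (T : Finset ι) (r : ι → ι → Prop) [∀ x y, Decidable (r x y)]
    (hr : ∀ x y, r x y → χ x = χ y) :
    (Fintype.card G : ℝ) * #{z ∈ T ×ˢ T | r z.1 z.2} ≤ ∑ g, ‖∑ x ∈ T, χ x g‖ ^ 2 := by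
  classical
  have h1 : ((∑ g, ‖∑ x ∈ T, χ x g‖ ^ 2 : ℝ) : ℂ) =
      ∑ z ∈ T ×ˢ T, if χ z.1 - χ z.2 = 0 then (Fintype.card G : ℂ) else 0 := by
    push_cast
    have h2 : ∀ g, ((‖∑ x ∈ T, χ x g‖ : ℂ)) ^ 2 = ∑ z ∈ T ×ˢ T, (χ z.1 - χ z.2) g := by
      intro g
      rw [← Complex.mul_conj', map_sum, Finset.sum_mul_sum, Finset.sum_product]
      refine Finset.sum_congr rfl fun x _ => Finset.sum_congr rfl fun y _ => ?_
      rw [AddChar.sub_apply, AddChar.map_neg_eq_conj]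
    simp_rw [h2]
    rw [Finset.sum_comm]
    refine Finset.sum_congr rfl fun z _ => ?_
    rw [AddChar.sum_eq_ite]
  have h3 : (∑ g, ‖∑ x ∈ T, χ x g‖ ^ 2 : ℝ) =
      ∑ z ∈ T ×ˢ T, if χ z.1 - χ z.2 = 0 then (Fintype.card G : ℝ) else 0 := by
    apply Complex.ofReal_injective
    rw [h1]
    push_cast
    refine Finset.sum_congr rfl fun z _ => ?_
    split_ifs <;> simp
  rw [h3, Finset.card_filter]
  push_cast
  rw [Finset.mul_sum]
  refine Finset.sum_le_sum fun z _ => ?_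
  by_cases hz : r z.1 z.2
  · rw [if_pos hz, if_pos (by rw [hr _ _ hz, sub_self]), mul_one]
  · rw [if_neg hz, mul_zero]
    split_ifs <;> positivity

/-- Among all differences, zero is attained most often. -/
theorem card_filter_sub_eq_le {α G : Type*} [AddCommGroup G] [DecidableEq G] (A : Finset α)
    (v : α → G) (h : G) :
    #{z ∈ A ×ˢ A | v z.1 - v z.2 = h} ≤ #{z ∈ A ×ˢ A | v z.1 = v z.2} := by
  classical
  set r : G → ℕ := fun w => #{x ∈ A | v x = w} with hr
  have key : ∀ h : G, #{z ∈ A ×ˢ A | v z.1 - v z.2 = h} = ∑ x ∈ A, r (v x - h) := by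
    intro h
    rw [Finset.card_filter, Finset.sum_product]
    refine Finset.sum_congr rfl fun x _ => ?_
    rw [hr]
    simp only
    rw [Finset.card_filter]
    refine Finset.sum_congr rfl fun y _ => ?_
    congr 1
    rw [eq_iff_iff]
    constructor
    · intro e; rw [← e]; abel
    · intro e; rw [e]; abel
  have key' : ∀ h : G, ∑ x ∈ A, r (v x - h) =
      ∑ w ∈ A.image v ∪ (A.image v).image (· + h), r w * r (w - h) := by
    intro h
    rw [← Finset.sum_fiberwise_of_maps_to (g := v)
      (t := A.image v ∪ (A.image v).image (· + h))
      (fun x hx => Finset.mem_union_left _ (Finset.mem_image_of_mem v hx))]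
    refine Finset.sum_congr rfl fun w _ => ?_
    rw [Finset.sum_congr rfl (g := fun _ => r (w - h))
      (fun x hx => by rw [(Finset.mem_filter.1 hx).2]), Finset.sum_const, smul_eq_mul]
  have h0 : #{z ∈ A ×ˢ A | v z.1 = v z.2} = ∑ w ∈ A.image v, r w * r w := by
    have e1 : #{z ∈ A ×ˢ A | v z.1 = v z.2} = #{z ∈ A ×ˢ A | v z.1 - v z.2 = 0} := by
      simp_rw [sub_eq_zero]
    rw [e1, key 0, key' 0]
    simp
  have hzero : ∀ w, w ∉ A.image v → r w = 0 := by
    intro w hw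
    rw [hr]
    simp only [Finset.card_eq_zero]
    rw [Finset.filter_eq_empty_iff]
    intro x hx e
    exact hw (Finset.mem_image.2 ⟨x, hx, e⟩)
  set U := A.image v ∪ (A.image v).image (· + h) with hU
  have h1 : ∑ w ∈ U, r w * r w = ∑ w ∈ A.image v, r w * r w := by
    symm
    refine Finset.sum_subset Finset.subset_union_left fun w _ hw => ?_
    rw [hzero w hw, mul_zero]
  have h2 : ∑ w ∈ U, r (w - h) * r (w - h) = ∑ w ∈ A.image v, r w * r w := by
    have e1 : ∑ w ∈ (A.image v).image (· + h), r (w - h) * r (w - h) =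
        ∑ w ∈ A.image v, r w * r w := by
      rw [Finset.sum_image (fun a _ b _ e => add_right_cancel e)]
      simp
    rw [← e1]
    symm
    refine Finset.sum_subset Finset.subset_union_right fun w _ hw => ?_
    rw [hzero (w - h) fun hw' => hw (Finset.mem_image.2 ⟨w - h, hw', by simp⟩),
      mul_zero]
  rw [key, key', h0, ← hU]
  have h3 : ∑ w ∈ U, 2 * (r w * r (w - h)) ≤ ∑ w ∈ U, (r w * r w + r (w - h) * r (w - h)) := by
    refine Finset.sum_le_sum fun w _ => ?_
    have := two_mul_le_add_sq (r w) (r (w - h))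
    nlinarith
  rw [Finset.sum_add_distrib, h1, h2, ← Finset.mul_sum] at h3
  omega

open Polynomial in
theorem momentLike_X_pow (p : ℕ) [Fact p.Prime] (k : ℕ) :
    MomentLike p 0 (fun j : Fin k => (X : ℤ[X]) ^ ((j : ℕ) + 1)) := fun j =>
  ⟨1, one_ne_zero, by simp⟩

/-- The vector of power sums of degrees `1, …, k`. -/
def powerSums (k : ℕ) {t : ℕ} (x : Fin t → ℕ) (j : Fin k) : ℤ := ∑ i, (x i : ℤ) ^ ((j : ℕ) + 1)

theorem stdAddChar_sum {ι : Type*} {n : ℕ} [NeZero n] (s : Finset ι) (z : ι → ZMod n) :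
    ∏ i ∈ s, ZMod.stdAddChar (z i) = ZMod.stdAddChar (∑ i ∈ s, z i) := by
  classical
  induction s using Finset.induction_on with
  | empty => simp
  | insert a s ha ih => rw [prod_insert ha, sum_insert ha, ih, AddChar.map_add_eq_mul]

/-- The additive character of `(ℤ / n) ^ k` dual to an integer vector. -/
noncomputable def dualChar (n : ℕ) [NeZero n] {k : ℕ} (w : Fin k → ℤ) :
    AddChar (Fin k → ZMod n) ℂ where
  toFun η := ZMod.stdAddChar (∑ j, η j * (w j : ZMod n))
  map_zero_eq_one' := by simp
  map_add_eq_mul' a b := by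
    rw [← AddChar.map_add_eq_mul]
    simp [add_mul, Finset.sum_add_distrib]

/-- Decoupling bounds the number of solutions of the Vinogradov system. -/
theorem card_vinogradov_le_of_dec {p k N : ℕ} [Fact p.Prime] (hk : k ≠ 0) {K : ℝ} (hK : 0 ≤ K)
    (h : Dec p k N K) {X : ℕ} (hX : X < p ^ N) :
    (#{z ∈ (Fintype.piFinset fun _ : Fin (tri k) => Icc 1 X) ×ˢ
        (Fintype.piFinset fun _ : Fin (tri k) => Icc 1 X) |
      powerSums k z.1 = powerSums k z.2} : ℝ) ≤ (K * X) ^ tri k := by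
  classical
  set t := tri k with ht
  have ht0 : t ≠ 0 := tri_ne_zero hk
  let G := Fin k → ZMod (p ^ (k * N))
  set φ : Fin k → Polynomial ℤ := fun j => (Polynomial.X : Polynomial ℤ) ^ ((j : ℕ) + 1) with hφ
  set f : ℤ → G → ℂ := fun i η => 1 * phase p (k * N) φ i η with hf
  set S : Finset ℤ := (Icc 1 X).map Nat.castEmbedding with hS
  have hdec := h φ (momentLike_X_pow p k) (k * N) le_rfl (fun _ => 1) id S
  have hG : (0 : ℝ) < Fintype.card G := by exact_mod_cast Fintype.card_pos
  have hnorm : ∀ i η, ‖f i η‖ = 1 := by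
    intro i η
    simp [hf, phase, AddChar.norm_apply]
  have hclass : classSum p N t (fun _ => 1) f id S ≤ X * (Fintype.card G : ℝ) ^ (1 / (t : ℝ)) := by
    have e1 : ∀ ξ : ZMod (p ^ N), sqNorm t (fun _ => 1) f (S.filter fun i => ((id i : ℤ) :
        ZMod (p ^ N)) = ξ) ≤ #(S.filter fun i => ((id i : ℤ) : ZMod (p ^ N)) = ξ) *
          (Fintype.card G : ℝ) ^ (1 / (t : ℝ)) := by
      intro ξ
      set T := S.filter fun i => ((id i : ℤ) : ZMod (p ^ N)) = ξ with hT
      have hT1 : #T ≤ 1 := by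
        rw [Finset.card_le_one]
        intro a ha b hb
        simp only [hT, hS, Finset.mem_filter, Finset.mem_map, Finset.mem_Icc, id] at ha hb
        obtain ⟨⟨a, ⟨_, ha2⟩, rfl⟩, ha3⟩ := ha
        obtain ⟨⟨b, ⟨_, hb2⟩, rfl⟩, hb3⟩ := hb
        rw [← hb3] at ha3
        simp only [Nat.castEmbedding_apply, Int.cast_natCast] at ha3
        rw [ZMod.natCast_eq_natCast_iff'] at ha3
        rw [Nat.mod_eq_of_lt (by omega), Nat.mod_eq_of_lt (by omega)] at ha3
        simp [ha3]
      rcases Nat.le_one_iff_eq_zero_or_eq_one.1 hT1 with h0 | h1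
      · rw [Finset.card_eq_zero.1 h0, sqNorm_empty ht0]; simp
      · rw [h1, Nat.cast_one, one_mul]
        obtain ⟨a, ha⟩ := Finset.card_eq_one.1 h1
        rw [ha]
        simp [sqNorm, wnorm, sqSum, hnorm]
    refine (Finset.sum_le_sum fun ξ _ => e1 ξ).trans ?_
    rw [← Finset.sum_mul]
    refine mul_le_mul_of_nonneg_right ?_ (by positivity)
    rw [← Nat.cast_sum, Finset.sum_card_fiberwise_eq_card_filter]
    simp [hS]
  have hupper : ∑ η, sqSum f S η ^ t ≤ (K * X) ^ t * Fintype.card G := by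
    rw [sum_sqSum_pow ht0]
    have e2 : sqNorm t (fun _ => 1) f S ≤ K * (X * (Fintype.card G : ℝ) ^ (1 / (t : ℝ))) :=
      hdec.trans (mul_le_mul_of_nonneg_left hclass hK)
    refine (pow_le_pow_left₀ (sqNorm_nonneg (fun _ => zero_le_one) _ _) e2 t).trans (le_of_eq ?_)
    rw [← mul_assoc, mul_pow, one_div, Real.rpow_inv_natCast_pow hG.le ht0]
  have hlower := card_mul_card_filter_eq_le
    (fun x : Fin t → ℕ => dualChar (p ^ (k * N)) (powerSums k x))
    (Fintype.piFinset fun _ : Fin t => Icc 1 X) (fun x y => powerSums k x = powerSums k y)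
    (fun x y e => by rw [e])
  have heq : ∀ η : G, sqSum f S η ^ t =
      ‖∑ x ∈ Fintype.piFinset fun _ : Fin t => Icc 1 X,
        dualChar (p ^ (k * N)) (powerSums k x) η‖ ^ 2 := by
    intro η
    rw [sqSum, ← pow_mul, mul_comm, pow_mul, ← norm_pow, hS, Finset.sum_map, Finset.sum_pow']
    congr 2
    refine Finset.sum_congr rfl fun x _ => ?_
    simp only [hf, hφ, one_mul, phase, dualChar, Nat.castEmbedding_apply, powerSums]
    rw [stdAddChar_sum, Finset.sum_comm]
    show _ = ZMod.stdAddChar _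
    congr 1
    refine Finset.sum_congr rfl fun j _ => ?_
    push_cast
    rw [Finset.mul_sum]
    simp
  rw [← Finset.sum_congr rfl fun η _ => heq η] at hlower
  have := hlower.trans hupper
  rw [mul_comm] at this
  exact le_of_mul_le_mul_right this hG

theorem prod_pow_succ_eq (X k : ℕ) : ∏ j : Fin k, X ^ ((j : ℕ) + 1) = X ^ tri k := by
  rw [Fin.prod_univ_eq_prod_range (fun j => X ^ (j + 1)) k, Finset.prod_pow_eq_pow_sum]
  congr 1
  induction k with
  | zero => rfl
  | succ k ih =>
    rw [Finset.sum_range_succ, ih]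
    have h1 := two_mul_tri k
    have h2 := two_mul_tri (k + 1)
    nlinarith

/-- A sharp upper bound for the number of solutions of the symmetric equation in sums of
`k (k + 1) / 2` powers on each side. -/
theorem card_sum_pow_eq_le {k : ℕ} (hk : k ≠ 0) {ε : ℝ} (hε : 0 < ε) :
    ∃ C : ℝ, 0 < C ∧ ∀ X : ℕ, 1 ≤ X →
      (#{z ∈ (Fintype.piFinset fun _ : Fin (tri k) => Icc 1 X) ×ˢ
          (Fintype.piFinset fun _ : Fin (tri k) => Icc 1 X) |
        ∑ i, z.1 i ^ k = ∑ i, z.2 i ^ k} : ℝ) ≤ C * (X : ℝ) ^ ((k : ℝ) ^ 2 + ε) := by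
  classical
  set t := tri k with ht
  have ht0 : t ≠ 0 := tri_ne_zero hk
  have htR : (0 : ℝ) < t := by exact_mod_cast Nat.pos_of_ne_zero ht0
  obtain ⟨p₀, hp₀⟩ := decBound_of_large_prime hk (div_pos hε htR)
  obtain ⟨p, hpp₀, hp⟩ := Nat.exists_infinite_primes p₀
  have : Fact p.Prime := ⟨hp⟩
  obtain ⟨C, hC, hdec⟩ := hp₀ p ⟨hp⟩ hpp₀
  have hp0 : (0 : ℝ) < p := by exact_mod_cast hp.pos
  have hp1 : (1 : ℝ) ≤ p := by exact_mod_cast hp.one_lt.le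
  obtain ⟨k', rfl⟩ : ∃ k', k = k' + 1 := ⟨k - 1, by omega⟩
  refine ⟨(3 * t : ℝ) ^ k' * (C ^ t * (p : ℝ) ^ ε), by positivity, fun X hX => ?_⟩
  have hX0 : (0 : ℝ) < X := by exact_mod_cast hX
  set A := Fintype.piFinset fun _ : Fin t => Icc 1 X with hA
  set H : Finset (Fin (k' + 1) → ℤ) := Fintype.piFinset fun j : Fin (k' + 1) =>
    if (j : ℕ) = k' then {0} else Icc (-(t * X ^ ((j : ℕ) + 1) : ℤ)) (t * X ^ ((j : ℕ) + 1)) with hH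
  set J := #{z ∈ A ×ˢ A | powerSums (k' + 1) z.1 = powerSums (k' + 1) z.2} with hJ
  have hps : ∀ x ∈ A, ∀ j, 0 ≤ powerSums (k' + 1) x j ∧
      powerSums (k' + 1) x j ≤ t * X ^ ((j : ℕ) + 1) := by
    intro x hx j
    refine ⟨Finset.sum_nonneg fun _ _ => by positivity, ?_⟩
    refine (Finset.sum_le_card_nsmul univ _ ((X : ℤ) ^ ((j : ℕ) + 1)) fun i _ => ?_).trans ?_
    · have := (Finset.mem_Icc.1 (Fintype.mem_piFinset.1 hx i)).2
      exact_mod_cast Nat.pow_le_pow_left this _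
    · simp
  have hcard := Finset.card_le_mul_card_image_of_maps_to
    (s := {z ∈ A ×ˢ A | ∑ i, z.1 i ^ (k' + 1) = ∑ i, z.2 i ^ (k' + 1)}) (t := H)
    (f := fun z => powerSums (k' + 1) z.1 - powerSums (k' + 1) z.2) (by
      intro z hz
      rw [Finset.mem_filter, Finset.mem_product] at hz
      rw [hH, Fintype.mem_piFinset]
      intro j
      split_ifs with hj
      · rw [Finset.mem_singleton, Pi.sub_apply, sub_eq_zero]
        simp only [powerSums, hj]
        exact_mod_cast hz.2
      · rw [Finset.mem_Icc, Pi.sub_apply]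
        have h1 := hps _ hz.1.1 j
        have h2 := hps _ hz.1.2 j
        constructor <;> linarith [h1.1, h1.2, h2.1, h2.2]) J (by
      intro b _
      refine le_trans (Finset.card_le_card ?_)
        (card_filter_sub_eq_le A (powerSums (k' + 1)) b)
      rw [Finset.filter_filter]
      intro z hz
      rw [Finset.mem_filter] at hz ⊢
      exact ⟨hz.1, hz.2.2⟩)
  have hHcard : #H ≤ (3 * t) ^ k' * X ^ tri k' := by
    rw [hH, Fintype.card_piFinset, Fin.prod_univ_castSucc]
    simp only [Fin.val_castSucc, Fin.val_last, if_true, Finset.card_singleton, mul_one]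
    rw [← prod_pow_succ_eq]
    have e1 : (3 * t) ^ k' = ∏ _j : Fin k', 3 * t := by simp
    rw [e1, ← Finset.prod_mul_distrib]
    refine Finset.prod_le_prod' fun j _ => ?_
    rw [if_neg j.2.ne, Int.card_Icc]
    have : 1 ≤ t * X ^ ((j : ℕ) + 1) :=
      Nat.mul_pos (Nat.pos_of_ne_zero ht0) (Nat.pow_pos hX)
    have e2 : ((t : ℤ) * (X : ℤ) ^ ((j : ℕ) + 1) + 1 - -((t : ℤ) * (X : ℤ) ^ ((j : ℕ) + 1))).toNat =
        2 * (t * X ^ ((j : ℕ) + 1)) + 1 := by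
      rw [← Int.toNat_natCast (2 * (t * X ^ ((j : ℕ) + 1)) + 1)]
      congr 1
      push_cast; ring
    rw [e2]
    linarith
  set N := Nat.log p X + 1 with hN
  have hXN : X < p ^ N := Nat.lt_pow_succ_log_self hp.one_lt X
  have hNX : (p : ℝ) ^ N ≤ p * X := by
    rw [hN, pow_succ']
    exact mul_le_mul_of_nonneg_left (by exact_mod_cast Nat.pow_log_le_self p (by omega)) hp0.le
  have hJle := card_vinogradov_le_of_dec hk (by positivity) (hdec N) hXN
  have hJ2 : (J : ℝ) ≤ C ^ t * (p : ℝ) ^ ε * ((X : ℝ) ^ t * (X : ℝ) ^ ε) := by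
    refine hJle.trans ?_
    have e1 : ((p : ℝ) ^ (ε / t * N)) ^ t ≤ (p : ℝ) ^ ε * (X : ℝ) ^ ε := by
      rw [← Real.mul_rpow hp0.le hX0.le, ← Real.rpow_natCast, ← Real.rpow_mul hp0.le]
      calc (p : ℝ) ^ (ε / t * N * t) = ((p : ℝ) ^ N) ^ ε := by
            rw [← Real.rpow_natCast, ← Real.rpow_mul hp0.le]
            congr 1; field_simp
        _ ≤ _ := Real.rpow_le_rpow (by positivity) hNX hε.le
    calc (C * (p : ℝ) ^ (ε / t * N) * X) ^ t
        = C ^ t * X ^ t * ((p : ℝ) ^ (ε / t * N)) ^ t := by rw [mul_pow, mul_pow]; ring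
      _ ≤ C ^ t * X ^ t * ((p : ℝ) ^ ε * (X : ℝ) ^ ε) := by gcongr
      _ = _ := by ring
  have e3 : (X : ℝ) ^ (((k' + 1 : ℕ) : ℝ) ^ 2 + ε) = (X : ℝ) ^ t * (X : ℝ) ^ tri k' * (X : ℝ) ^ ε := by
    have : t + tri k' = (k' + 1) ^ 2 := by
      have h1 := two_mul_tri k'
      have h2 := two_mul_tri (k' + 1)
      rw [← ht] at h2
      nlinarith
    rw [Real.rpow_add hX0, ← pow_add, this, ← Real.rpow_natCast (X : ℝ) ((k' + 1) ^ 2)]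
    push_cast
    rfl
  rw [e3]
  calc (#{z ∈ A ×ˢ A | ∑ i, z.1 i ^ (k' + 1) = ∑ i, z.2 i ^ (k' + 1)} : ℝ)
      ≤ J * #H := by exact_mod_cast hcard
    _ ≤ (C ^ t * (p : ℝ) ^ ε * ((X : ℝ) ^ t * (X : ℝ) ^ ε)) * ((3 * t) ^ k' * X ^ tri k') := by
        gcongr
        exact_mod_cast hHcard
    _ = _ := by ring

end counting

section ec

theorem ec_add (x y : ℝ) : ec (x + y) = ec x * ec y := by
  unfold ec
  rw [← Complex.exp_add]
  congr 1
  push_cast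
  ring

theorem ec_intCast (m : ℤ) : ec m = 1 := by
  unfold ec
  rw [Complex.exp_eq_one_iff]
  exact ⟨m, by push_cast; ring⟩

theorem norm_ec (x : ℝ) : ‖ec x‖ = 1 := by
  unfold ec
  have : 2 * (Real.pi : ℂ) * Complex.I * x = ((2 * Real.pi * x : ℝ) : ℂ) * Complex.I := by
    push_cast; ring
  rw [this, Complex.norm_exp_ofReal_mul_I]

theorem ec_neg (x : ℝ) : ec (-x) = starRingEnd ℂ (ec x) := by
  unfold ec
  rw [← Complex.exp_conj]
  congr 1
  simp only [map_mul, Complex.conj_ofReal, Complex.conj_I, map_ofNat]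
  push_cast
  ring

theorem ec_add_intCast (x : ℝ) (m : ℤ) : ec (x + m) = ec x := by
  rw [ec_add, ec_intCast, mul_one]

theorem ec_sub (x y : ℝ) : ec (x - y) = ec x * starRingEnd ℂ (ec y) := by
  rw [sub_eq_add_neg, ec_add, ec_neg]

theorem ec_nat_mul (m : ℕ) (x : ℝ) : ec (m * x) = ec x ^ m := by
  unfold ec
  rw [← Complex.exp_nat_mul]
  congr 1
  push_cast
  ring

theorem norm_ec_sub_one_le (x : ℝ) : ‖ec x - 1‖ ≤ 2 * Real.pi * |x| := by
  have h := Real.norm_exp_I_mul_ofReal_sub_one_le (x := 2 * Real.pi * x)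
  have e : Complex.exp (Complex.I * ((2 * Real.pi * x : ℝ) : ℂ)) = ec x := by
    unfold ec; congr 1; push_cast; ring
  rw [e, Real.norm_eq_abs, abs_mul, abs_of_pos (by positivity)] at h
  exact h

theorem four_mul_abs_le_norm_ec_sub_one {x : ℝ} (hx : |x| ≤ 1 / 2) : 4 * |x| ≤ ‖ec x - 1‖ := by
  have e : Complex.exp (Complex.I * ((2 * Real.pi * x : ℝ) : ℂ)) = ec x := by
    unfold ec; congr 1; push_cast; ring
  rw [← e, Complex.norm_exp_I_mul_ofReal_sub_one]
  have h2 : 2 * Real.pi * x / 2 = Real.pi * x := by ring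
  rw [h2, norm_mul, Real.norm_eq_abs, Real.norm_eq_abs, abs_two]
  have h3 : 2 / Real.pi * |Real.pi * x| ≤ |Real.sin (Real.pi * x)| := by
    apply Real.mul_abs_le_abs_sin
    rw [abs_mul, abs_of_pos Real.pi_pos]
    nlinarith [Real.pi_pos]
  rw [abs_mul, abs_of_pos Real.pi_pos, ← mul_assoc, div_mul_cancel₀ _ Real.pi_pos.ne'] at h3
  linarith

end ec

section Weyl

theorem normSq_sum_range (F : ℕ → ℂ) (N : ℕ) :
    ‖∑ x ∈ range N, F x‖ ^ 2 = ∑ x ∈ range N, ‖F x‖ ^ 2 +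
      2 * ∑ h ∈ Ico 1 N, (∑ x ∈ range (N - h), F (x + h) * starRingEnd ℂ (F x)).re := by
  induction N with
  | zero => simp
  | succ N ih =>
    have h1 : ∑ h ∈ Ico 1 (N + 1), (∑ x ∈ range (N + 1 - h), F (x + h) * starRingEnd ℂ (F x)).re
        = ∑ h ∈ Ico 1 N, (∑ x ∈ range (N - h), F (x + h) * starRingEnd ℂ (F x)).re +
          ∑ x ∈ range N, (F N * starRingEnd ℂ (F x)).re := by
      have h2 : ∑ x ∈ range N, (F N * starRingEnd ℂ (F x)).re =
          ∑ h ∈ Ico 1 (N + 1), (F N * starRingEnd ℂ (F (N - h))).re := by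
        rw [Finset.sum_Ico_eq_sum_range, ← Finset.sum_range_reflect]
        refine sum_congr (by simp) fun x hx => ?_
        rw [Nat.sub_sub]
      have h3 : ∑ h ∈ Ico 1 N, (∑ x ∈ range (N - h), F (x + h) * starRingEnd ℂ (F x)).re =
          ∑ h ∈ Ico 1 (N + 1), (∑ x ∈ range (N - h), F (x + h) * starRingEnd ℂ (F x)).re := by
        rcases Nat.eq_zero_or_pos N with rfl | hN
        · simp
        · rw [Finset.sum_Ico_succ_top hN]; simp
      rw [h2, h3, ← sum_add_distrib]
      refine sum_congr rfl fun h hh => ?_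
      rw [mem_Ico] at hh
      rw [Nat.sub_add_comm (by omega), sum_range_succ, Complex.add_re]
      rw [Nat.sub_add_cancel (by omega)]
    have h4 : ∑ x ∈ range N, (F N * starRingEnd ℂ (F x)).re =
        (F N * starRingEnd ℂ (∑ x ∈ range N, F x)).re := by
      rw [← Complex.re_sum, ← mul_sum, ← map_sum]
    rw [h1, h4, sum_range_succ, sum_range_succ, mul_add]
    have : ∀ a b : ℂ, ‖a + b‖ ^ 2 = ‖a‖ ^ 2 + ‖b‖ ^ 2 + 2 * (b * starRingEnd ℂ a).re := by
      intro a b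
      simp only [← Complex.normSq_eq_norm_sq, Complex.normSq_apply]
      simp
      ring
    rw [this, ih]
    ring

theorem normSq_sum_range_le (F : ℕ → ℂ) (hF : ∀ x, ‖F x‖ = 1) (N : ℕ) :
    ‖∑ x ∈ range N, F x‖ ^ 2 ≤ N +
      2 * ∑ h ∈ Ico 1 N, ‖∑ x ∈ range (N - h), F (x + h) * starRingEnd ℂ (F x)‖ := by
  rw [normSq_sum_range]
  have h1 : ∑ x ∈ range N, ‖F x‖ ^ 2 = N := by simp [hF]
  rw [h1]
  gcongr with h hh
  exact Complex.re_le_norm _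

/-- A dense subset of an interval has a gap of prescribed size. -/
theorem exists_gap {B : ℝ} (hB : 2 ≤ B) {P L : ℕ} {H : Finset ℕ} (hH : H ⊆ Icc 1 P)
    (hc : (P : ℝ) ≤ B * #H) (hL : 4 * B < L) (hLP : L ≤ P) :
    ∃ h ∈ H, ∃ h' ∈ H, h < h' ∧ (L : ℝ) / (4 * B) ≤ ((h' - h : ℕ) : ℝ) ∧ h' - h < L := by
  have hL0 : 0 < L := by
    have : (0:ℝ) < L := by linarith
    exact_mod_cast this
  have hP0 : (0:ℝ) < P := by exact_mod_cast hL0.trans_le hLP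
  have hLr : (0:ℝ) < L := by exact_mod_cast hL0
  obtain ⟨y, hy, hcard⟩ : ∃ y ∈ range (P / L + 1),
      (L : ℝ) / (2 * B) ≤ #{h ∈ H | h / L = y} := by
    have hmaps : Set.MapsTo (fun h => h / L) (H : Set ℕ) (range (P / L + 1) : Finset ℕ) := by
      intro h hh
      have := (mem_Icc.1 (hH hh)).2
      simp only [coe_range, Set.mem_Iio]
      exact Nat.lt_succ_of_le (Nat.div_le_div_right this)
    by_contra! hcon
    have h1 := card_eq_sum_card_fiberwise hmaps
    have h2 : (#H : ℝ) = ∑ b ∈ range (P / L + 1), (#{h ∈ H | h / L = b} : ℝ) := by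
      exact_mod_cast h1
    have h3 : (#H : ℝ) < ∑ b ∈ range (P / L + 1), (L : ℝ) / (2 * B) := by
      rw [h2]
      exact sum_lt_sum_of_nonempty (by simp) hcon
    rw [sum_const, card_range, nsmul_eq_mul] at h3
    have h4 : ((P / L + 1 : ℕ) : ℝ) ≤ 2 * P / L := by
      push_cast
      have h5 : ((P / L : ℕ) : ℝ) ≤ (P : ℝ) / L := Nat.cast_div_le
      have h6 : (1 : ℝ) ≤ (P : ℝ) / L := by
        rw [le_div_iff₀ hLr]; exact_mod_cast (by omega)
      have : 2 * (P : ℝ) / L = P / L + P / L := by ring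
      linarith
    have h7 : (#H : ℝ) < P / B := by
      refine h3.trans_le ((mul_le_mul_of_nonneg_right h4 (by positivity)).trans_eq ?_)
      field_simp
    rw [lt_div_iff₀ (by positivity)] at h7
    linarith
  set T := {h ∈ H | h / L = y} with hT
  have hcard2 : (2 : ℝ) < #T := by
    refine lt_of_lt_of_le ?_ hcard
    rw [lt_div_iff₀ (by positivity)]
    linarith
  have hTn : T.Nonempty := by
    rw [← card_pos]
    have : (0 : ℝ) < #T := by linarith
    exact_mod_cast this
  have hmin := T.min'_mem hTn
  have hmax := T.max'_mem hTn
  set a := T.min' hTn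
  set b := T.max' hTn
  have hsub : T ⊆ Icc a b := fun x hx => mem_Icc.2 ⟨T.min'_le _ hx, T.le_max' _ hx⟩
  have hab : #T ≤ b + 1 - a := by
    have := card_le_card hsub
    rwa [Nat.card_Icc] at this
  have h2T : 2 < #T := by exact_mod_cast hcard2
  rw [hT, mem_filter] at hmin hmax
  refine ⟨a, hmin.1, b, hmax.1, by omega, ?_, ?_⟩
  · have h8 : (#T : ℝ) ≤ ((b - a : ℕ) : ℝ) + 1 := by exact_mod_cast (by omega)
    have h9 : (1 : ℝ) ≤ L / (4 * B) := by
      rw [le_div_iff₀ (by positivity)]; linarith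
    have h10 : (L : ℝ) / (2 * B) = L / (4 * B) + L / (4 * B) := by field_simp; ring
    linarith
  · have h1 := Nat.div_add_mod a L
    have h2 := Nat.div_add_mod b L
    rw [hmin.2] at h1
    rw [hmax.2] at h2
    have := Nat.mod_lt b hL0
    omega

/-- If many multiples of `γ` are close to integers, then `γ` has a good rational approximation. -/
theorem exists_approx_of_many_near_int {B : ℝ} (hB : 2 ≤ B) {P : ℕ} (hP : 64 * B ^ 2 ≤ P)
    {H : Finset ℕ} (hH : H ⊆ Icc 1 P) (hc : (P : ℝ) ≤ B * #H) {η γ : ℝ} (hη0 : 0 ≤ η)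
    (hη : η ≤ B / P) (hγ : ∀ h ∈ H, ∃ m : ℤ, |h * γ - m| ≤ η) :
    ∃ d : ℕ, 1 ≤ d ∧ (d : ℝ) ≤ 5 * B ∧ ∃ m : ℤ, |d * γ - m| ≤ B ^ 13 * η / P := by
  have hP0 : (0:ℝ) < P := by nlinarith
  have key : ∀ L : ℕ, 4 * B < L → L ≤ P → ∃ d : ℕ, 1 ≤ d ∧ (L : ℝ) / (4 * B) ≤ d ∧ d < L ∧
      ∃ m : ℤ, |d * γ - m| ≤ 2 * η := by
    intro L hL hLP
    obtain ⟨h, hh, h', hh', hlt, h1, h2⟩ := exists_gap hB hH hc hL hLP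
    obtain ⟨m, hm⟩ := hγ h hh
    obtain ⟨m', hm'⟩ := hγ h' hh'
    refine ⟨h' - h, by omega, h1, h2, m' - m, ?_⟩
    rw [Nat.cast_sub hlt.le]
    push_cast
    have : ((h' : ℝ) - h) * γ - (m' - m) = (h' * γ - m') - (h * γ - m) := by ring
    rw [this]
    exact (abs_sub _ _).trans (by linarith)
  have hPB : B * P ≤ P * P := by nlinarith
  obtain ⟨d₁, hd₁, -, hd₁u, m₁, hm₁⟩ := key (⌊4 * B⌋₊ + 1) (by exact_mod_cast Nat.lt_floor_add_one _)
    (by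
      have : (⌊4 * B⌋₊ : ℝ) + 1 ≤ P := by
        have := Nat.floor_le (show 0 ≤ 4 * B by linarith)
        nlinarith
      exact_mod_cast this)
  have hfl : (P : ℝ) / (8 * B) < ⌊(P : ℝ) / (8 * B)⌋₊ + 1 := Nat.lt_floor_add_one _
  have hfu : (⌊(P : ℝ) / (8 * B)⌋₊ : ℝ) ≤ P / (8 * B) := Nat.floor_le (by positivity)
  have h8B : 8 * B ≤ P / (8 * B) := by
    rw [le_div_iff₀ (by positivity)]; nlinarith
  obtain ⟨d₂, hd₂, hd₂l, hd₂u, m₂, hm₂⟩ := key ⌊(P : ℝ) / (8 * B)⌋₊ (by linarith)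
    (by
      have : (⌊(P : ℝ) / (8 * B)⌋₊ : ℝ) ≤ P := by
        refine hfu.trans (div_le_self hP0.le (by linarith))
      exact_mod_cast this)
  have hd₁r : (d₁ : ℝ) ≤ 5 * B := by
    have h1 : (d₁ : ℝ) ≤ ⌊4 * B⌋₊ := by exact_mod_cast Nat.lt_succ_iff.1 hd₁u
    have := Nat.floor_le (show 0 ≤ 4 * B by linarith)
    linarith
  have hd₂r : (d₂ : ℝ) ≤ P / (8 * B) := by
    have h1 : (d₂ : ℝ) ≤ ⌊(P : ℝ) / (8 * B)⌋₊ := by exact_mod_cast hd₂u.le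
    linarith
  have hd₂lr : (P : ℝ) / (64 * B ^ 2) ≤ d₂ := by
    refine le_trans ?_ hd₂l
    rw [div_le_div_iff₀ (by positivity) (by positivity)]
    have h1 : (P : ℝ) / (8 * B) ≤ 2 * ⌊(P : ℝ) / (8 * B)⌋₊ := by linarith
    rw [div_le_iff₀ (by positivity)] at h1
    nlinarith
  have hd₂p : (0:ℝ) < d₂ := by exact_mod_cast hd₂
  refine ⟨d₁, hd₁, hd₁r, m₁, ?_⟩
  set ρ₁ := d₁ * γ - m₁ with hρ₁
  set ρ₂ := d₂ * γ - m₂ with hρ₂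
  have hηP : η * P ≤ B := by rwa [le_div_iff₀ hP0] at hη
  have hzero : (d₁ : ℤ) * m₂ - d₂ * m₁ = 0 := by
    have e : (((d₁ : ℤ) * m₂ - d₂ * m₁ : ℤ) : ℝ) = d₂ * ρ₁ - d₁ * ρ₂ := by
      rw [hρ₁, hρ₂]; push_cast; ring
    have h1 : |(d₂ : ℝ) * ρ₁ - d₁ * ρ₂| < 1 := by
      have h2 : |(d₂ : ℝ) * ρ₁| ≤ 1 / 4 := by
        rw [abs_mul, Nat.abs_cast]
        calc (d₂ : ℝ) * |ρ₁| ≤ P / (8 * B) * (2 * (B / P)) := by gcongr; linarith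
          _ = 1 / 4 := by field_simp; norm_num
      have h3 : |(d₁ : ℝ) * ρ₂| ≤ 1 / 4 := by
        rw [abs_mul, Nat.abs_cast]
        calc (d₁ : ℝ) * |ρ₂| ≤ 5 * B * (2 * (B / P)) := by gcongr; linarith
          _ = 10 * B ^ 2 / P := by ring
          _ ≤ 1 / 4 := by rw [div_le_iff₀ hP0]; nlinarith
      exact (abs_sub _ _).trans_lt (by linarith)
    rw [← e, ← Int.cast_abs] at h1
    have h4 : |(d₁ : ℤ) * m₂ - d₂ * m₁| < 1 := by exact_mod_cast h1
    exact Int.abs_lt_one_iff.1 h4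
  have hρ : d₂ * ρ₁ = d₁ * ρ₂ := by
    have e : ((d₁ : ℝ) * m₂ - d₂ * m₁) = 0 := by exact_mod_cast hzero
    rw [hρ₁, hρ₂]; linear_combination e
  have h5 : (d₂ : ℝ) * |ρ₁| ≤ 5 * B * (2 * η) := by
    have : (d₂ : ℝ) * |ρ₁| = d₁ * |ρ₂| := by
      have := congrArg abs hρ
      rwa [abs_mul, abs_mul, Nat.abs_cast, Nat.abs_cast] at this
    rw [this]; gcongr
  have h6 : (P : ℝ) / (64 * B ^ 2) * |ρ₁| ≤ 5 * B * (2 * η) :=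
    (mul_le_mul_of_nonneg_right hd₂lr (abs_nonneg _)).trans h5
  rw [div_mul_eq_mul_div, div_le_iff₀ (by positivity)] at h6
  rw [le_div_iff₀ hP0]
  calc |ρ₁| * P = P * |ρ₁| := mul_comm _ _
    _ ≤ _ := h6
    _ = 640 * B ^ 3 * η := by ring
    _ ≤ 2 ^ 10 * B ^ 3 * η := by gcongr; norm_num
    _ ≤ B ^ 10 * B ^ 3 * η := by gcongr
    _ = _ := by ring

theorem exists_approx_of_large_linear_sum {B : ℝ} {P N : ℕ} (hB : 2 ≤ B) (hP : 1 ≤ P)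
    {p : Polynomial ℝ} (hp : p.natDegree ≤ 1)
    (h : P / B ≤ ‖∑ x ∈ range N, ec (p.eval (x : ℝ))‖) :
    |p.coeff 1 - round (p.coeff 1)| ≤ B / P := by
  have hP0 : (0:ℝ) < P := by exact_mod_cast hP
  set θ := p.coeff 1 - round (p.coeff 1) with hθ
  have hev : ∀ x : ℕ, ec (p.eval (x : ℝ)) = ec (p.coeff 0) * ec θ ^ x := by
    intro x
    rw [Polynomial.eval_eq_sum_range' (n := 2) (by omega), sum_range_succ, sum_range_one,
      ← ec_nat_mul, ← ec_add, pow_zero, mul_one, pow_one]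
    have : p.coeff 0 + p.coeff 1 * x = p.coeff 0 + x * θ + ((x * round (p.coeff 1) : ℤ) : ℝ) := by
      rw [hθ]; push_cast; ring
    rw [this, ec_add_intCast]
  have h1 : ‖∑ x ∈ range N, ec (p.eval (x : ℝ))‖ * ‖ec θ - 1‖ ≤ 2 := by
    simp_rw [hev]
    rw [← mul_sum, norm_mul, norm_ec, one_mul, ← norm_mul, geom_sum_mul, ← ec_nat_mul]
    refine (norm_sub_le _ _).trans ?_
    rw [norm_ec, norm_one]; norm_num
  have h2 := four_mul_abs_le_norm_ec_sub_one (abs_sub_round (p.coeff 1))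
  have h3 : (P : ℝ) / B * (4 * |θ|) ≤ 2 := le_trans (by gcongr) h1
  rw [div_mul_eq_mul_div, div_le_iff₀ (by positivity)] at h3
  rw [le_div_iff₀ hP0]
  nlinarith [abs_nonneg θ]

theorem natDegree_taylor_sub_le {p : Polynomial ℝ} {k : ℕ} (hp : p.natDegree ≤ k + 1) (h : ℝ) :
    (Polynomial.taylor h p - p).natDegree ≤ k := by
  rw [Polynomial.natDegree_le_iff_coeff_eq_zero]
  intro m hm
  rw [Polynomial.coeff_sub, Polynomial.taylor_coeff]
  rcases eq_or_lt_of_le (Nat.succ_le_of_lt hm) with h1 | h1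
  · subst h1
    have : (Polynomial.hasseDeriv (k + 1) p).natDegree < 1 :=
      (Polynomial.natDegree_hasseDeriv_le p (k + 1)).trans_lt (by omega)
    rw [Nat.succ_eq_add_one, Polynomial.eval_eq_sum_range' this]
    simp [Polynomial.hasseDeriv_coeff]
  · have h2 : p.natDegree < m := by omega
    rw [Polynomial.hasseDeriv_eq_zero_of_lt_natDegree p m h2,
      Polynomial.coeff_eq_zero_of_natDegree_lt h2]
    simp

theorem coeff_taylor_sub {p : Polynomial ℝ} {k : ℕ} (hp : p.natDegree ≤ k + 1) (h : ℝ) :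
    (Polynomial.taylor h p - p).coeff k = (k + 1) * h * p.coeff (k + 1) := by
  rw [Polynomial.coeff_sub, Polynomial.taylor_coeff]
  have : (Polynomial.hasseDeriv k p).natDegree < 2 :=
    (Polynomial.natDegree_hasseDeriv_le p k).trans_lt (by omega)
  rw [Polynomial.eval_eq_sum_range' this, sum_range_succ, sum_range_one]
  simp only [Polynomial.hasseDeriv_coeff]
  rw [zero_add, Nat.choose_self, add_comm 1 k, Nat.choose_succ_self_right]
  push_cast
  ring

/-- Weyl differencing: many of the differenced sums of a large exponential sum are large. -/
theorem card_large_differenced_sums {B : ℝ} (hB : 2 ≤ B) {P N : ℕ} (hN : N ≤ P)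
    (hP : 2 * B ^ 2 ≤ P) {F : ℕ → ℂ} (hF : ∀ x, ‖F x‖ = 1)
    (h : P / B ≤ ‖∑ x ∈ range N, F x‖) :
    (P : ℝ) ≤ (8 * B ^ 2) * #{h ∈ Ico 1 N |
      P / (8 * B ^ 2) ≤ ‖∑ x ∈ range (N - h), F (x + h) * starRingEnd ℂ (F x)‖} := by
  have hP0 : (0:ℝ) < P := by nlinarith
  have hNr : (N : ℝ) ≤ P := by exact_mod_cast hN
  set S : ℕ → ℝ := fun h => ‖∑ x ∈ range (N - h), F (x + h) * starRingEnd ℂ (F x)‖ with hS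
  have hSP : ∀ h, S h ≤ P := by
    intro h
    refine (norm_sum_le _ _).trans ?_
    simp only [norm_mul, RCLike.norm_conj, hF, mul_one, sum_const, card_range, nsmul_eq_mul]
    exact_mod_cast (by omega)
  have h1 := normSq_sum_range_le F hF N
  have h2 : (P / B) ^ 2 ≤ N + 2 * ∑ h ∈ Ico 1 N, S h := le_trans (by gcongr) h1
  have h3 : ∑ h ∈ Ico 1 N, S h ≤ #{h ∈ Ico 1 N | P / (8 * B ^ 2) ≤ S h} * (P : ℝ) +
      P * (P / (8 * B ^ 2)) := by
    rw [← sum_filter_add_sum_filter_not (Ico 1 N) (fun h => P / (8 * B ^ 2) ≤ S h)]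
    refine add_le_add ?_ ?_
    · refine (sum_le_card_nsmul _ _ (P : ℝ) fun h _ => hSP h).trans_eq (nsmul_eq_mul _ _)
    · refine (sum_le_card_nsmul _ _ ((P : ℝ) / (8 * B ^ 2)) fun h hh => ?_).trans ?_
      · exact (not_le.1 (mem_filter.1 hh).2).le
      · rw [nsmul_eq_mul]
        gcongr
        refine (card_filter_le _ _).trans ?_
        rw [Nat.card_Ico]; omega
  set c : ℝ := (#{h ∈ Ico 1 N | P / (8 * B ^ 2) ≤ S h} : ℝ)
  have h4 : (P / B) ^ 2 ≤ P + 2 * (c * P + P * (P / (8 * B ^ 2))) := by linarith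
  have e1 : ((P : ℝ) / B) ^ 2 = P * P / B ^ 2 := by ring
  have e2 : (P : ℝ) * (P / (8 * B ^ 2)) = P * P / B ^ 2 / 8 := by field_simp
  rw [e1, e2] at h4
  have h5 : (P : ℝ) ≤ P * P / B ^ 2 / 2 := by
    rw [le_div_iff₀ (by norm_num), le_div_iff₀ (by positivity)]; nlinarith
  have h6 : (P : ℝ) * P / B ^ 2 ≤ 8 * (c * P) := by linarith
  rw [div_le_iff₀ (by positivity)] at h6
  nlinarith

theorem exists_card_fiber_ge {H : Finset ℕ} {f : ℕ → ℕ} {M : ℝ} (hM : 1 ≤ M)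
    (hf : ∀ h ∈ H, 1 ≤ f h ∧ (f h : ℝ) ≤ M) (hne : H.Nonempty) :
    ∃ q : ℕ, 1 ≤ q ∧ (q : ℝ) ≤ M ∧ (#H : ℝ) ≤ M * #{h ∈ H | f h = q} := by
  have hmaps : Set.MapsTo f (H : Set ℕ) (Icc 1 ⌊M⌋₊ : Finset ℕ) := by
    intro h hh
    rw [coe_Icc, Set.mem_Icc]
    exact ⟨(hf h hh).1, Nat.le_floor (hf h hh).2⟩
  obtain ⟨h₀, hh₀⟩ := hne
  by_contra! hcon
  have h1 : (#H : ℝ) = ∑ q ∈ Icc 1 ⌊M⌋₊, (#{h ∈ H | f h = q} : ℝ) := by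
    exact_mod_cast card_eq_sum_card_fiberwise hmaps
  have h2 : (#H : ℝ) < ∑ q ∈ Icc 1 ⌊M⌋₊, (#H : ℝ) / M := by
    conv_lhs => rw [h1]
    refine sum_lt_sum_of_nonempty ⟨f h₀, by simpa using hmaps hh₀⟩ fun q hq => ?_
    rw [mem_Icc] at hq
    rw [lt_div_iff₀ (by positivity), mul_comm]
    exact hcon q hq.1 ((Nat.le_floor_iff (by positivity)).1 hq.2)
  rw [sum_const, Nat.card_Icc, nsmul_eq_mul, Nat.add_sub_cancel] at h2
  have h3 : (⌊M⌋₊ : ℝ) * (#H / M) ≤ M * (#H / M) := by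
    gcongr; exact Nat.floor_le (by positivity)
  rw [mul_div_cancel₀ _ (by positivity)] at h3
  linarith

/-- Weyl's inequality in inverse form: a large exponential sum forces the leading coefficient to
have a good rational approximation with small denominator. -/
theorem exists_approx_of_large_weyl_sum (k : ℕ) : ∃ C : ℕ, ∀ B : ℝ, 2 ≤ B → ∀ P : ℕ, 1 ≤ P →
    ∀ N ≤ P, ∀ p : Polynomial ℝ, p.natDegree ≤ k + 1 →
    P / B ≤ ‖∑ x ∈ range N, ec (p.eval (x : ℝ))‖ →
    ∃ q : ℕ, 1 ≤ q ∧ (q : ℝ) ≤ B ^ C ∧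
      ∃ m : ℤ, |q * p.coeff (k + 1) - m| ≤ B ^ C / (P : ℝ) ^ (k + 1) := by
  induction k with
  | zero =>
    refine ⟨1, fun B hB P hP N _ p hp h => ⟨1, le_rfl, by simp; linarith, round (p.coeff 1), ?_⟩⟩
    simpa using exists_approx_of_large_linear_sum hB hP hp h
  | succ k ih =>
    obtain ⟨C₀, hC₀⟩ := ih
    set E := 5 * (C₀ + 1) with hE
    refine ⟨(6 + 14 * E) * (k + 2), fun B hB P hP N hN p hp h => ?_⟩
    have hP0 : (0:ℝ) < P := by exact_mod_cast hP
    have hB1 : 1 ≤ B := by linarith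
    set β := p.coeff (k + 1 + 1) with hβ
    have hB2 : 2 ≤ B ^ E := by
      calc (2:ℝ) ≤ B ^ 1 := by simpa using hB
        _ ≤ B ^ E := pow_le_pow_right₀ hB1 (by omega)
    by_cases hsmall : (P : ℝ) < 64 * (B ^ E) ^ 2
    · refine ⟨1, le_rfl, by simpa using one_le_pow₀ hB1, round β, ?_⟩
      rw [Nat.cast_one, one_mul, le_div_iff₀ (by positivity)]
      have h1 := abs_sub_round β
      have h2 : (P : ℝ) ^ (k + 1 + 1) ≤ (B ^ (6 + 14 * E)) ^ (k + 2) := by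
        gcongr
        calc (P : ℝ) ≤ 2 ^ 6 * (B ^ E) ^ 2 := by linarith
          _ ≤ B ^ 6 * (B ^ E) ^ 2 := by gcongr
          _ = B ^ (6 + E * 2) := by rw [← pow_mul, ← pow_add]
          _ ≤ _ := pow_le_pow_right₀ hB1 (by omega)
      rw [pow_mul]
      have h3 : 0 < (P : ℝ) ^ (k + 1 + 1) := by positivity
      calc |β - round β| * (P : ℝ) ^ (k + 1 + 1) ≤ 1 * (P : ℝ) ^ (k + 1 + 1) := by
            gcongr; linarith
        _ ≤ _ := by rwa [one_mul]
    push Not at hsmall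
    set B₁ := 8 * B ^ 2 with hB₁
    have hB₁2 : 2 ≤ B₁ := by nlinarith
    have hB₁B : B₁ ≤ B ^ 5 := by
      calc B₁ = 2 ^ 3 * B ^ 2 := by rw [hB₁]; norm_num
        _ ≤ B ^ 3 * B ^ 2 := by gcongr
        _ = B ^ 5 := by ring
    have hB₁E : B₁ ^ (C₀ + 1) ≤ B ^ E := by
      rw [hE, pow_mul]; gcongr
    have hPB : 2 * B ^ 2 ≤ P := by
      refine le_trans ?_ hsmall
      have : B ^ 2 ≤ (B ^ E) ^ 2 := by
        gcongr; exact le_self_pow₀ hB1 (by omega)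
      nlinarith
    set F : ℕ → ℂ := fun x => ec (p.eval (x : ℝ)) with hF
    have hcard := card_large_differenced_sums hB hN hPB (F := F) (fun x => norm_ec _) h
    set H := {h ∈ Ico 1 N |
      P / (8 * B ^ 2) ≤ ‖∑ x ∈ range (N - h), F (x + h) * starRingEnd ℂ (F x)‖} with hH
    have hH' : ∀ h ∈ H, ∃ q : ℕ, (1 ≤ q ∧ (q : ℝ) ≤ B₁ ^ C₀) ∧
        ∃ m : ℤ, |h * (q * ((k + 2) * β)) - m| ≤ B₁ ^ C₀ / (P : ℝ) ^ (k + 1) := by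
      intro h hh
      rw [hH, mem_filter] at hh
      obtain ⟨q, hq1, hq2, m, hm⟩ := hC₀ B₁ hB₁2 P hP (N - h) (by omega)
        (Polynomial.taylor (h : ℝ) p - p) (natDegree_taylor_sub_le hp _) (by
          refine hh.2.trans_eq ?_
          congr 1
          refine sum_congr rfl fun x _ => ?_
          rw [hF, Polynomial.eval_sub, Polynomial.taylor_eval, ec_sub]
          push_cast
          rfl)
      refine ⟨q, ⟨hq1, hq2⟩, m, ?_⟩
      rw [coeff_taylor_sub hp] at hm
      convert hm using 3
      push_cast
      ring
    choose! f hf using hH'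
    have hM : 1 ≤ B₁ ^ C₀ := one_le_pow₀ (by linarith)
    have hHne : H.Nonempty := by
      rw [← card_pos]
      by_contra h0
      have : #H = 0 := by omega
      rw [this] at hcard
      simp at hcard
      omega
    obtain ⟨q, hq1, hq2, hq3⟩ := exists_card_fiber_ge hM (fun h hh => (hf h hh).1) hHne
    have hηp : 0 ≤ B₁ ^ C₀ / (P : ℝ) ^ (k + 1) := by positivity
    have hCE : B₁ ^ C₀ ≤ B ^ E :=
      (pow_le_pow_right₀ (by linarith) (Nat.le_succ C₀)).trans hB₁E
    obtain ⟨d, hd1, hd2, m, hm⟩ := exists_approx_of_many_near_int (B := B ^ E) hB2 hsmall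
      (H := {h ∈ H | f h = q}) (fun h hh => by
        have := mem_Ico.1 (mem_filter.1 (mem_filter.1 hh).1).1
        exact mem_Icc.2 ⟨this.1, by omega⟩)
      (by
        calc (P : ℝ) ≤ B₁ * #H := hcard
          _ ≤ B₁ * (B₁ ^ C₀ * #{h ∈ H | f h = q}) := by gcongr
          _ = B₁ ^ (C₀ + 1) * #{h ∈ H | f h = q} := by ring
          _ ≤ _ := by gcongr)
      (γ := q * ((k + 2) * β)) hηp
      (by
        gcongr
        exact le_self_pow₀ (by exact_mod_cast hP) (by omega))
      (fun h hh => by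
        rw [mem_filter] at hh
        have := (hf h hh.1).2
        rwa [hh.2] at this)
    refine ⟨d * (q * (k + 2)), ?_, ?_, m, ?_⟩
    · exact Nat.mul_pos hd1 (Nat.mul_pos hq1 (by omega))
    · push_cast
      have hk2 : ((k : ℝ) + 2) ≤ B ^ (k + 2) := by
        have h1 : k + 2 < 2 ^ (k + 2) := Nat.lt_two_pow_self
        calc ((k : ℝ) + 2) ≤ 2 ^ (k + 2) := by exact_mod_cast h1.le
          _ ≤ B ^ (k + 2) := by gcongr
      calc (d : ℝ) * (q * (k + 2)) ≤ (5 * B ^ E) * (B ^ E * B ^ (k + 2)) := by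
            gcongr; exact hq2.trans hCE
        _ ≤ (2 ^ 3 * B ^ E) * (B ^ E * B ^ (k + 2)) := by gcongr; norm_num
        _ ≤ (B ^ 3 * B ^ E) * (B ^ E * B ^ (k + 2)) := by gcongr
        _ = B ^ (3 + E + (E + (k + 2))) := by simp only [← pow_add]
        _ ≤ _ := pow_le_pow_right₀ hB1 (by nlinarith)
    · have e : ((d * (q * (k + 2)) : ℕ) : ℝ) * β = d * (q * ((k + 2) * β)) := by push_cast; ring
      rw [e]
      refine hm.trans ?_
      calc (B ^ E) ^ 13 * (B₁ ^ C₀ / (P : ℝ) ^ (k + 1)) / P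
          = (B ^ E) ^ 13 * B₁ ^ C₀ / (P : ℝ) ^ (k + 1 + 1) := by
            rw [pow_succ (P : ℝ) (k + 1)]; field_simp
        _ ≤ (B ^ E) ^ 13 * B ^ E / (P : ℝ) ^ (k + 1 + 1) := by gcongr
        _ = B ^ (E * 13 + E) / (P : ℝ) ^ (k + 1 + 1) := by rw [← pow_mul, ← pow_add]
        _ ≤ _ := by gcongr ?_ / _; exact pow_le_pow_right₀ hB1 (by nlinarith)

end Weyl

section Grid

theorem ec_eq_one_iff {x : ℝ} : ec x = 1 ↔ ∃ m : ℤ, x = m := by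
  constructor
  · intro h
    unfold ec at h
    rw [Complex.exp_eq_one_iff] at h
    obtain ⟨m, hm⟩ := h
    refine ⟨m, ?_⟩
    have h1 : (2 * Real.pi * Complex.I) * (x : ℂ) = (2 * Real.pi * Complex.I) * (m : ℂ) := by
      rw [hm]; ring
    have h2 := mul_left_cancel₀ Complex.two_pi_I_ne_zero h1
    exact_mod_cast h2
  · rintro ⟨m, rfl⟩
    exact ec_intCast m

theorem sum_ec_grid {L : ℕ} (hL : 0 < L) (m : ℤ) :
    ∑ j ∈ range L, ec (m * (j / L)) = if (L : ℤ) ∣ m then (L : ℂ) else 0 := by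
  have hL0 : (L : ℝ) ≠ 0 := by positivity
  have h1 : ∀ j : ℕ, ec (m * (j / L)) = ec (m / L) ^ j := by
    intro j
    rw [← ec_nat_mul]; congr 1; ring
  simp_rw [h1]
  split_ifs with h
  · obtain ⟨c, rfl⟩ := h
    have : (((L : ℤ) * c : ℤ) : ℝ) / L = (c : ℤ) := by push_cast; field_simp
    rw [this, ec_intCast]
    simp
  · have hz : ec (m / L) ≠ 1 := by
      rw [Ne, ec_eq_one_iff]
      rintro ⟨c, hc⟩
      rw [div_eq_iff hL0] at hc
      exact h ⟨c, by rw [mul_comm]; exact_mod_cast hc⟩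
    rw [geom_sum_eq hz, ← ec_nat_mul, mul_div_cancel₀ _ hL0, ec_intCast]
    simp

theorem sum_grid_eval_mul_ec {L n : ℕ} (hn : n < L) {W : Polynomial ℂ} (hW : W.natDegree < L) :
    ∑ j ∈ range L, W.eval (ec (j / L)) * ec (-(n : ℝ) * (j / L)) = L * W.coeff n := by
  have hL : 0 < L := by omega
  have h1 : ∀ j : ℕ, W.eval (ec (j / L)) * ec (-(n : ℝ) * (j / L)) =
      ∑ m ∈ range L, W.coeff m * ec (((m - n : ℤ) : ℝ) * (j / L)) := by
    intro j
    rw [Polynomial.eval_eq_sum_range' hW, sum_mul]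
    refine sum_congr rfl fun m _ => ?_
    rw [← ec_nat_mul, mul_assoc, ← ec_add]
    congr 2
    push_cast; ring
  simp_rw [h1]
  rw [sum_comm]
  simp_rw [← mul_sum, sum_ec_grid hL]
  rw [sum_eq_single n]
  · simp [mul_comm]
  · intro m hm hmn
    rw [mem_range] at hm
    rw [if_neg, mul_zero]
    intro hd
    have := Int.eq_zero_of_abs_lt_dvd hd (by rw [abs_lt]; omega)
    omega
  · intro h; exact absurd (mem_range.2 hn) h

theorem sum_grid_normSq_eval {L : ℕ} {W : Polynomial ℂ} (hW : W.natDegree < L) :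
    ∑ j ∈ range L, ‖W.eval (ec (j / L))‖ ^ 2 = L * ∑ m ∈ range L, ‖W.coeff m‖ ^ 2 := by
  have h : ((∑ j ∈ range L, ‖W.eval (ec (j / L))‖ ^ 2 : ℝ) : ℂ) =
      ((L * ∑ m ∈ range L, ‖W.coeff m‖ ^ 2 : ℝ) : ℂ) := by
    push_cast
    simp_rw [← Complex.mul_conj']
    have h1 : ∀ j : ℕ, W.eval (ec (j / L)) * starRingEnd ℂ (W.eval (ec (j / L))) =
        ∑ m ∈ range L, starRingEnd ℂ (W.coeff m) *
          (W.eval (ec (j / L)) * ec (-(m : ℝ) * (j / L))) := by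
      intro j
      conv_lhs => rw [Polynomial.eval_eq_sum_range' hW (ec (j / L))]
      rw [map_sum, ← Polynomial.eval_eq_sum_range' hW, mul_sum]
      refine sum_congr rfl fun m _ => ?_
      rw [map_mul, ← ec_nat_mul, ← ec_neg, neg_mul]
      ring
    simp_rw [h1]
    rw [sum_comm, mul_sum]
    refine sum_congr rfl fun m hm => ?_
    rw [← mul_sum, sum_grid_eval_mul_ec (mem_range.1 hm) hW]
    ring
  exact_mod_cast h

/-- The generating polynomial of the `k`-th powers of `1, …, P`. -/
noncomputable def powPoly (k P : ℕ) : Polynomial ℂ := ∑ x ∈ Icc 1 P, Polynomial.X ^ (x ^ k)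

theorem natDegree_powPoly_le (k P : ℕ) : (powPoly k P).natDegree ≤ P ^ k := by
  refine Polynomial.natDegree_sum_le_of_forall_le _ _ fun x hx => ?_
  rw [Polynomial.natDegree_X_pow]
  exact Nat.pow_le_pow_left (mem_Icc.1 hx).2 k

theorem eval_powPoly (k P : ℕ) (α : ℝ) :
    (powPoly k P).eval (ec α) = ∑ x ∈ Icc 1 P, ec (α * (x : ℝ) ^ k) := by
  rw [powPoly, Polynomial.eval_finsetSum]
  refine sum_congr rfl fun x _ => ?_
  rw [Polynomial.eval_pow, Polynomial.eval_X, ← ec_nat_mul]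
  push_cast; rw [mul_comm]

theorem norm_eval_powPoly_le (k P : ℕ) (α : ℝ) : ‖(powPoly k P).eval (ec α)‖ ≤ P := by
  rw [eval_powPoly]
  refine (norm_sum_le _ _).trans ?_
  simp [norm_ec]

theorem coeff_powPoly_pow (k P s m : ℕ) : (powPoly k P ^ s).coeff m =
    (#{x ∈ Fintype.piFinset fun _ : Fin s => Icc 1 P | ∑ i, x i ^ k = m} : ℂ) := by
  rw [powPoly, Finset.sum_pow', Polynomial.finsetSum_coeff]
  simp_rw [prod_pow_eq_pow_sum, Polynomial.coeff_X_pow]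
  rw [card_filter]
  push_cast
  exact sum_congr rfl fun x _ => by simp only [eq_comm]

theorem Rcount_eq_coeff {k P s n : ℕ} (hn : n < (P + 1) ^ k) :
    (Rcount s k n : ℂ) = (powPoly k P ^ s).coeff n := by
  rw [coeff_powPoly_pow, Rcount]
  congr 1
  rw [← Set.ncard_coe_finset]
  congr 1
  ext x
  simp only [Set.mem_ofPred_eq, coe_filter, Fintype.mem_piFinset, mem_Icc]
  constructor
  · rintro ⟨h1, h2⟩
    refine ⟨fun i => ⟨h1 i, ?_⟩, h2⟩
    have h3 : x i ^ k ≤ n := by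
      rw [← h2]; exact single_le_sum (f := fun i => x i ^ k) (fun _ _ => Nat.zero_le _) (mem_univ i)
    have h4 := lt_of_pow_lt_pow_left₀ k (Nat.zero_le _) (h3.trans_lt hn)
    omega
  · rintro ⟨h1, h2⟩
    exact ⟨fun i => (h1 i).1, h2⟩

theorem sum_normSq_coeff_powPoly_pow {k P t L : ℕ} (hL : t * P ^ k < L) :
    ∑ m ∈ range L, ‖(powPoly k P ^ t).coeff m‖ ^ 2 =
      (#{z ∈ (Fintype.piFinset fun _ : Fin t => Icc 1 P) ×ˢ
        (Fintype.piFinset fun _ : Fin t => Icc 1 P) |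
          ∑ i, z.1 i ^ k = ∑ i, z.2 i ^ k} : ℝ) := by
  simp_rw [coeff_powPoly_pow, Complex.norm_natCast]
  have hmaps : Set.MapsTo (fun z : (Fin t → ℕ) × (Fin t → ℕ) => ∑ i, z.1 i ^ k)
      ({z ∈ (Fintype.piFinset fun _ : Fin t => Icc 1 P) ×ˢ
        (Fintype.piFinset fun _ : Fin t => Icc 1 P) |
          ∑ i, z.1 i ^ k = ∑ i, z.2 i ^ k} : Finset _) (range L : Finset ℕ) := by
    intro z hz
    simp only [coe_filter, mem_product, Fintype.mem_piFinset, mem_Icc, Set.mem_ofPred_eq] at hz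
    rw [coe_range, Set.mem_Iio]
    refine lt_of_le_of_lt ?_ hL
    calc ∑ i, z.1 i ^ k ≤ ∑ _i : Fin t, P ^ k :=
          sum_le_sum fun i _ => Nat.pow_le_pow_left (hz.1.1 i).2 k
      _ = t * P ^ k := by simp
  rw [card_eq_sum_card_fiberwise hmaps]
  push_cast
  refine sum_congr rfl fun m _ => ?_
  rw [sq, ← Nat.cast_mul, ← card_product]
  congr 2
  ext z
  simp only [mem_product, mem_filter]
  constructor
  · rintro ⟨⟨h1, h2⟩, h3, h4⟩
    exact ⟨⟨⟨h1, h3⟩, h2.trans h4.symm⟩, h2⟩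
  · rintro ⟨⟨⟨h1, h3⟩, h2⟩, h4⟩
    exact ⟨⟨h1, h4⟩, h3, h2 ▸ h4⟩

/-- Grid form of the mean value estimate for sums of `k`-th powers. -/
theorem sum_grid_powPoly_le {k : ℕ} (hk : k ≠ 0) {ε : ℝ} (hε : 0 < ε) : ∃ C : ℝ, 0 < C ∧
    ∀ P : ℕ, 1 ≤ P → ∀ L : ℕ, tri k * P ^ k < L →
      ∑ j ∈ range L, ‖(powPoly k P).eval (ec (j / L))‖ ^ (2 * tri k) ≤
        L * (C * (P : ℝ) ^ ((k : ℝ) ^ 2 + ε)) := by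
  obtain ⟨C, hC, h⟩ := card_sum_pow_eq_le hk hε
  refine ⟨C, hC, fun P hP L hL => ?_⟩
  have hdeg : (powPoly k P ^ tri k).natDegree < L :=
    (Polynomial.natDegree_pow_le_of_le _ (natDegree_powPoly_le k P)).trans_lt hL
  have h1 := sum_grid_normSq_eval hdeg
  rw [sum_normSq_coeff_powPoly_pow hL] at h1
  calc ∑ j ∈ range L, ‖(powPoly k P).eval (ec (j / L))‖ ^ (2 * tri k)
      = ∑ j ∈ range L, ‖(powPoly k P ^ tri k).eval (ec (j / L))‖ ^ 2 := by
        refine sum_congr rfl fun j _ => ?_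
        rw [Polynomial.eval_pow, norm_pow, ← pow_mul, mul_comm]
    _ ≤ _ := by rw [h1]; gcongr; exact h P hP

end Grid

section Arcs

/-- The reduced fractions `a / q` in `(0, 1]` with denominator at most `Q`, as pairs `⟨q, a⟩`. -/
def fareyPairs (Q : ℕ) : Finset (Σ _ : ℕ, ℕ) :=
  (Icc 1 Q).sigma fun q => (Icc 1 q).filter fun a => Nat.Coprime a q

theorem mem_fareyPairs {Q : ℕ} {x : Σ _ : ℕ, ℕ} : x ∈ fareyPairs Q ↔
    (1 ≤ x.1 ∧ x.1 ≤ Q) ∧ (1 ≤ x.2 ∧ x.2 ≤ x.1) ∧ Nat.Coprime x.2 x.1 := by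
  simp [fareyPairs]

theorem card_fareyPairs_le (Q : ℕ) : #(fareyPairs Q) ≤ Q ^ 2 := by
  rw [fareyPairs, card_sigma, sq]
  calc ∑ q ∈ Icc 1 Q, #{a ∈ Icc 1 q | Nat.Coprime a q} ≤ ∑ _q ∈ Icc 1 Q, Q := by
        refine sum_le_sum fun q hq => (card_filter_le _ _).trans ?_
        rw [Nat.card_Icc]; simp only [mem_Icc] at hq; omega
    _ = Q * Q := by simp

/-- The grid point at distance `r` from the fraction `a / q`. -/
def arcPoint (L : ℕ) (z : (Σ _ : ℕ, ℕ) × ℤ) : ℕ :=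
  (((z.1.2 : ℤ) * (L / z.1.1 : ℕ) + z.2) % L).toNat

/-- The grid points `j / L` on the arcs of radius `R / L` about fractions of denominator at
most `Q`. -/
noncomputable def majorGrid (L Q R : ℕ) : Finset ℕ :=
  (fareyPairs Q ×ˢ Icc (-(R : ℤ)) R).image (arcPoint L)

theorem arcPoint_cast {L : ℕ} (hL : 0 < L) {z : (Σ _ : ℕ, ℕ) × ℤ} (hz : z.1.1 ∣ L)
    (hz0 : 0 < z.1.1) :
    ∃ m : ℤ, (z.1.2 : ℝ) / z.1.1 + z.2 / L = (arcPoint L z : ℝ) / L + m := by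
  have hL0 : (L : ℝ) ≠ 0 := by positivity
  have hq0 : (z.1.1 : ℝ) ≠ 0 := by positivity
  set w := (z.1.2 : ℤ) * (L / z.1.1 : ℕ) + z.2 with hw
  have h1 : (arcPoint L z : ℤ) = w % L := Int.toNat_of_nonneg (Int.emod_nonneg _ (by omega))
  have h2 := Int.emod_add_mul_ediv w L
  rw [← h1] at h2
  refine ⟨w / L, ?_⟩
  have h3 : (w : ℝ) = arcPoint L z + L * ((w / L : ℤ) : ℝ) := by exact_mod_cast h2.symm
  have h4 : (w : ℝ) = z.1.2 * (L / z.1.1) + z.2 := by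
    rw [hw, Int.cast_add, Int.cast_mul, Int.cast_natCast, Int.cast_natCast, Nat.cast_div hz hq0]
  rw [h4] at h3
  field_simp
  field_simp at h3
  linear_combination h3

theorem majorGrid_subset {L : ℕ} (hL : 0 < L) (Q R : ℕ) : majorGrid L Q R ⊆ range L := by
  intro j hj
  obtain ⟨z, -, rfl⟩ := mem_image.1 hj
  rw [mem_range, arcPoint, Int.toNat_lt (Int.emod_nonneg _ (by omega))]
  exact Int.emod_lt_of_pos _ (by omega)

theorem arcPoint_injOn {L Q R : ℕ} (hL : 0 < L) (hQL : ∀ q, 1 ≤ q → q ≤ Q → q ∣ L)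
    (hR : 2 * (R * Q ^ 2) < L) :
    Set.InjOn (arcPoint L) (fareyPairs Q ×ˢ Icc (-(R : ℤ)) R : Finset _) := by
  rintro ⟨⟨q, a⟩, r⟩ hz ⟨⟨q', a'⟩, r'⟩ hz' heq
  simp only [coe_product, Set.mem_prod, mem_coe, mem_fareyPairs, mem_Icc] at hz hz'
  obtain ⟨⟨⟨hq1, hqQ⟩, ⟨ha1, haq⟩, hco⟩, hr1, hr2⟩ := hz
  obtain ⟨⟨⟨hq1', hqQ'⟩, ⟨ha1', haq'⟩, hco'⟩, hr1', hr2'⟩ := hz'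
  obtain ⟨m, hm⟩ := arcPoint_cast hL (z := (⟨q, a⟩, r)) (hQL q hq1 hqQ) hq1
  obtain ⟨m', hm'⟩ := arcPoint_cast hL (z := (⟨q', a'⟩, r')) (hQL q' hq1' hqQ') hq1'
  rw [heq] at hm
  simp only at hm hm'
  have hL0 : (L : ℝ) ≠ 0 := by positivity
  have hq0 : (q : ℝ) ≠ 0 := by positivity
  have hq0' : (q' : ℝ) ≠ 0 := by positivity
  -- the difference of the two fractions, cleared of denominators
  have key : ((a : ℤ) * q' - a' * q - (m - m') * (q * q')) * L = (r' - r) * (q * q') := by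
    have h1 : (a : ℝ) / q - a' / q' - (m - m') = (r' - r) / L := by
      have : ((r' : ℝ) - r) / L = r' / L - r / L := by ring
      rw [this]; linarith
    field_simp at h1
    have h2 : ((((a : ℤ) * q' - a' * q - (m - m') * (q * q')) * L : ℤ) : ℝ) =
        (((r' - r) * (q * q') : ℤ) : ℝ) := by push_cast; linear_combination h1
    exact_mod_cast h2
  have hqq : (q : ℤ) * q' ≤ Q ^ 2 := by
    rw [sq]; exact_mod_cast Nat.mul_le_mul hqQ hqQ'
  have hqq0 : (0 : ℤ) < (q : ℤ) * q' := by positivity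
  have hzero : (a : ℤ) * q' - a' * q - (m - m') * (q * q') = 0 := by
    have h1 : |(r' - r) * ((q : ℤ) * q')| < L := by
      rw [abs_mul, abs_of_pos hqq0]
      have h2 : |r' - r| ≤ 2 * R := by rw [abs_le]; omega
      calc |r' - r| * ((q : ℤ) * q') ≤ 2 * R * Q ^ 2 := by gcongr
        _ < L := by zify at hR; linarith
    have h3 : (r' - r) * ((q : ℤ) * q') = 0 :=
      Int.eq_zero_of_abs_lt_dvd (Dvd.intro_left _ key) h1
    rw [h3] at key
    exact (mul_eq_zero.1 key).resolve_right (by positivity)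
  rw [hzero, zero_mul] at key
  have hrr : r' = r := by
    have := (mul_eq_zero.1 key.symm).resolve_right hqq0.ne'
    omega
  have hqdvd : q ∣ q' := by
    refine (Nat.Coprime.symm hco).dvd_of_dvd_mul_left ?_
    zify
    exact ⟨a' + (m - m') * q', by linear_combination hzero⟩
  have hqdvd' : q' ∣ q := by
    refine (Nat.Coprime.symm hco').dvd_of_dvd_mul_left ?_
    zify
    exact ⟨a - (m - m') * q, by linear_combination -hzero⟩
  obtain rfl := Nat.dvd_antisymm hqdvd hqdvd'
  have haa : a = a' := by
    have h1 : (a : ℤ) - a' = (m - m') * q := by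
      have h2 : (q : ℤ) * ((a : ℤ) - a' - (m - m') * q) = 0 := by linear_combination hzero
      have := (mul_eq_zero.1 h2).resolve_left (by positivity)
      linarith
    have h3 : (a : ℤ) - a' = 0 :=
      Int.eq_zero_of_abs_lt_dvd (Dvd.intro_left _ h1.symm) (by rw [abs_lt]; omega)
    omega
  rw [haa, hrr]

theorem sum_majorGrid {E : Type*} [AddCommMonoid E] {L Q R : ℕ} (hL : 0 < L)
    (hQL : ∀ q, 1 ≤ q → q ≤ Q → q ∣ L) (hR : 2 * (R * Q ^ 2) < L) {F : ℝ → E}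
    (hF : ∀ (x : ℝ) (m : ℤ), F (x + m) = F x) :
    ∑ j ∈ majorGrid L Q R, F (j / L) =
      ∑ x ∈ fareyPairs Q, ∑ r ∈ Icc (-(R : ℤ)) R, F ((x.2 : ℝ) / x.1 + r / L) := by
  rw [majorGrid, sum_image (arcPoint_injOn hL hQL hR), sum_product]
  refine sum_congr rfl fun x hx => sum_congr rfl fun r _ => ?_
  rw [mem_fareyPairs] at hx
  obtain ⟨m, hm⟩ := arcPoint_cast hL (z := (x, r)) (hQL _ hx.1.1 hx.1.2) hx.1.1
  rw [hm, hF]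

theorem mem_majorGrid {L Q R j q : ℕ} (hj : j < L) (hQL : ∀ q, 1 ≤ q → q ≤ Q → q ∣ L)
    (hq : 1 ≤ q) (hqQ : q ≤ Q) {m : ℤ} {Δ : ℝ} (hR : Δ * L < R + 1)
    (h : |(j : ℝ) / L - m / q| ≤ Δ) : j ∈ majorGrid L Q R := by
  have hL : 0 < L := by omega
  have hL0 : (0 : ℝ) < L := by positivity
  set x : ℚ := (m : ℚ) / q with hx
  have hdq : x.den ∣ q := by
    have h1 := Rat.den_dvd m q
    have h2 : Rat.divInt m q = x := by rw [Rat.divInt_eq_div, hx]; push_cast; rfl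
    rw [h2] at h1
    exact_mod_cast h1
  have hd0 : 0 < x.den := x.den_pos
  have hdQ : x.den ≤ Q := (Nat.le_of_dvd hq hdq).trans hqQ
  have hdL := hQL x.den hd0 hdQ
  have hxr : (m : ℝ) / q = (x.num : ℝ) / x.den := by
    have h1 : ((x : ℚ) : ℝ) = (m : ℝ) / q := by rw [hx]; push_cast; rfl
    rw [← h1]
    exact Rat.cast_def x
  set a : ℕ := ((x.num - 1) % x.den + 1).toNat with ha
  have hmod0 := Int.emod_nonneg (x.num - 1) (show (x.den : ℤ) ≠ 0 by omega)
  have hmod1 := Int.emod_lt_of_pos (x.num - 1) (show (0 : ℤ) < x.den by omega)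
  have haz : (a : ℤ) = (x.num - 1) % x.den + 1 := Int.toNat_of_nonneg (by omega)
  have hac : (a : ℤ) = x.num - x.den * ((x.num - 1) / x.den) := by
    have := Int.emod_add_mul_ediv (x.num - 1) x.den
    linarith
  set c := (x.num - 1) / (x.den : ℤ)
  have hcop : Nat.Coprime a x.den := by
    have h1 : IsCoprime x.num (x.den : ℤ) := Rat.isCoprime_num_den x
    have h2 : IsCoprime (a : ℤ) (x.den : ℤ) := by
      have h3 := IsCoprime.add_mul_left_left h1 (-c)
      rw [hac]
      rwa [mul_neg, ← sub_eq_add_neg] at h3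
    exact Nat.isCoprime_iff_coprime.1 h2
  set r : ℤ := j - x.num * (L / x.den : ℕ) with hr
  have hrR : |r| ≤ R := by
    have h1 : (|r| : ℝ) ≤ Δ * L := by
      rw [hxr] at h
      have h2 : (r : ℝ) = ((j : ℝ) / L - x.num / x.den) * L := by
        have hd : (x.den : ℝ) ≠ 0 := by positivity
        rw [hr, Int.cast_sub, Int.cast_mul, Int.cast_natCast, Int.cast_natCast,
          Nat.cast_div hdL hd]
        field_simp
      rw [h2, abs_mul, abs_of_pos hL0]
      gcongr
    have h3 : ((|r| : ℤ) : ℝ) < R + 1 := by push_cast; linarith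
    have h4 : |r| < R + 1 := by exact_mod_cast h3
    omega
  rw [abs_le] at hrR
  refine mem_image.2 ⟨(⟨x.den, a⟩, r), mem_product.2 ⟨mem_fareyPairs.2
    ⟨⟨hd0, hdQ⟩, ⟨by show 1 ≤ a; omega, by show a ≤ x.den; omega⟩, hcop⟩, mem_Icc.2 hrR⟩, ?_⟩
  rw [arcPoint]
  simp only
  have h5 : (a : ℤ) * (L / x.den : ℕ) + r = j + L * (-c) := by
    have h6 : (x.den : ℤ) * (L / x.den : ℕ) = L := by exact_mod_cast Nat.mul_div_cancel' hdL
    rw [hr, hac]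
    linear_combination (-c) * h6
  rw [h5, Int.add_mul_emod_self_left, Int.emod_eq_of_lt (by omega) (by omega)]
  simp

end Arcs

section RisingBinomial

/-- The coefficient of `X ^ m` in the binomial series of `(1 - X) ^ (-a)`. -/
noncomputable def risingCoeff (a : ℝ) (m : ℕ) : ℝ := ∏ i ∈ range m, (a + i) / (i + 1)

theorem risingCoeff_zero (a : ℝ) : risingCoeff a 0 = 1 := by simp [risingCoeff]

theorem risingCoeff_succ (a : ℝ) (m : ℕ) :
    risingCoeff a (m + 1) = risingCoeff a m * ((a + m) / (m + 1)) := by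
  rw [risingCoeff, prod_range_succ, risingCoeff]

theorem risingCoeff_one (m : ℕ) : risingCoeff 1 m = 1 := by
  rw [risingCoeff]
  refine prod_eq_one fun i _ => ?_
  rw [add_comm (1 : ℝ)]
  exact div_self (by positivity)

theorem risingCoeff_pos {a : ℝ} (ha : 0 < a) (m : ℕ) : 0 < risingCoeff a m :=
  prod_pos fun i _ => by positivity

theorem antitone_risingCoeff {a : ℝ} (ha : 0 < a) (ha1 : a ≤ 1) : Antitone (risingCoeff a) := by
  refine antitone_nat_of_succ_le fun m => ?_
  rw [risingCoeff_succ]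
  refine mul_le_of_le_one_right (risingCoeff_pos ha m).le ?_
  rw [div_le_one (by positivity)]
  linarith

theorem risingCoeff_add_one {a : ℝ} (m : ℕ) :
    a * risingCoeff (a + 1) m = (a + m) * risingCoeff a m := by
  induction m with
  | zero => simp [risingCoeff_zero]
  | succ m ih =>
    rw [risingCoeff_succ, risingCoeff_succ, ← mul_assoc, ih]
    push_cast
    have : (m : ℝ) + 1 ≠ 0 := by positivity
    field_simp
    ring

theorem sum_risingCoeff {a : ℝ} (ha : 0 < a) (M : ℕ) :
    ∑ m ∈ range (M + 1), risingCoeff a m = risingCoeff (a + 1) M := by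
  induction M with
  | zero => simp [risingCoeff_zero]
  | succ M ih =>
    rw [sum_range_succ, ih]
    have h1 := risingCoeff_add_one (a := a) M
    have h2 := risingCoeff_add_one (a := a) (M + 1)
    refine mul_left_cancel₀ ha.ne' ?_
    rw [mul_add, h1, h2, risingCoeff_succ]
    push_cast
    have : (M : ℝ) + 1 ≠ 0 := by positivity
    field_simp
    ring

theorem risingCoeff_eq_Gamma {a : ℝ} (ha : 0 < a) (m : ℕ) :
    Real.Gamma a * risingCoeff a m = Real.Gamma (m + a) / Real.Gamma (m + 1) := by
  induction m with
  | zero => simp [risingCoeff_zero]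
  | succ m ih =>
    have h1 : Real.Gamma (m + 1) ≠ 0 := (Real.Gamma_pos_of_pos (by positivity)).ne'
    rw [risingCoeff_succ, ← mul_assoc, ih]
    push_cast
    have h2 : (m : ℝ) + 1 + a = (m + a) + 1 := by ring
    rw [h2, Real.Gamma_add_one (s := m + a) (by positivity),
      Real.Gamma_add_one (s := (m : ℝ) + 1) (by positivity)]
    field_simp
    ring

theorem rpow_le_risingCoeff {a : ℝ} (ha : 0 < a) (ha1 : a < 1) (M : ℕ) :
    (M : ℝ) ^ a ≤ Real.Gamma (1 + a) * risingCoeff (a + 1) M := by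
  rw [add_comm 1 a, risingCoeff_eq_Gamma (by positivity)]
  have hG1 : 0 < Real.Gamma (M + 1) := Real.Gamma_pos_of_pos (by positivity)
  have hG2 : 0 < Real.Gamma (M + a) := Real.Gamma_pos_of_pos (by positivity)
  have hMa : 0 < (M : ℝ) + a := by positivity
  rw [le_div_iff₀ hG1]
  have h1 := Real.Gamma_mul_add_mul_le_rpow_Gamma_mul_rpow_Gamma (s := M + a) (t := M + (a + 1))
    (a := a) (b := 1 - a) (by positivity) (by positivity) ha (by linarith) (by ring)
  have e1 : a * (M + a) + (1 - a) * (M + (a + 1)) = (M : ℝ) + 1 := by ring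
  have e2 : (M : ℝ) + (a + 1) = (M + a) + 1 := by ring
  rw [e1, e2, Real.Gamma_add_one hMa.ne', Real.mul_rpow hMa.le hG2.le, mul_left_comm,
    ← Real.rpow_add hG2, add_sub_cancel, Real.rpow_one] at h1
  rw [e2, Real.Gamma_add_one hMa.ne']
  calc (M : ℝ) ^ a * Real.Gamma (M + 1)
      ≤ (M + a) ^ a * ((M + a) ^ (1 - a) * Real.Gamma (M + a)) := by
        gcongr; linarith
    _ = _ := by rw [← mul_assoc, ← Real.rpow_add hMa, add_sub_cancel, Real.rpow_one]

theorem risingCoeff_le_rpow {a : ℝ} (ha : 0 < a) (ha1 : a < 1) (M : ℕ) :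
    Real.Gamma (1 + a) * risingCoeff (a + 1) M ≤ ((M : ℝ) + 1) ^ a := by
  rw [add_comm 1 a, risingCoeff_eq_Gamma (by positivity)]
  have hG1 : 0 < Real.Gamma (M + 1) := Real.Gamma_pos_of_pos (by positivity)
  have hM1 : 0 < (M : ℝ) + 1 := by positivity
  rw [div_le_iff₀ hG1]
  have h1 := Real.Gamma_mul_add_mul_le_rpow_Gamma_mul_rpow_Gamma (s := M + 1) (t := M + 1 + 1)
    (a := 1 - a) (b := a) (by positivity) (by positivity) (by linarith) ha (by ring)
  have e1 : (1 - a) * (M + 1) + a * (M + 1 + 1) = (M : ℝ) + (a + 1) := by ring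
  rwa [e1, Real.Gamma_add_one hM1.ne', Real.mul_rpow hM1.le hG1.le, mul_left_comm,
    ← Real.rpow_add hG1, sub_add_cancel, Real.rpow_one] at h1

theorem tendsto_risingCoeff_mul_rpow {a : ℝ} (ha : 0 < a) :
    Filter.Tendsto (fun n : ℕ => risingCoeff a n * (n : ℝ) ^ (1 - a)) Filter.atTop
      (nhds (Real.Gamma a)⁻¹) := by
  have h1 := (Real.GammaSeq_tendsto_Gamma a).inv₀ (Real.Gamma_pos_of_pos ha).ne'
  have h2 : Filter.Tendsto (fun n : ℕ => (n : ℝ) / (n + a)) Filter.atTop (nhds 1) :=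
    tendsto_natCast_div_add_atTop a
  have h3 := h1.mul h2
  rw [mul_one] at h3
  refine h3.congr' ?_
  filter_upwards [Filter.eventually_gt_atTop 0] with n hn
  have hn0 : (0 : ℝ) < n := by exact_mod_cast hn
  have hr : risingCoeff a n = (∏ j ∈ range n, (a + j)) / n.factorial := by
    rw [risingCoeff, prod_div_distrib]
    congr 1
    rw [← prod_range_add_one_eq_factorial]
    push_cast
    rfl
  have hp : 0 < ∏ j ∈ range n, (a + j) := prod_pos fun i _ => by positivity
  have hf : (0 : ℝ) < n.factorial := by exact_mod_cast n.factorial_pos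
  have hna : 0 < (n : ℝ) ^ a := by positivity
  rw [Real.GammaSeq, prod_range_succ, hr, Real.rpow_sub hn0, Real.rpow_one]
  field_simp
  ring

open PowerSeries in
theorem mk_risingCoeff_mul (a b : ℝ) :
    PowerSeries.mk (risingCoeff a) * PowerSeries.mk (risingCoeff b) = PowerSeries.mk (risingCoeff (a + b)) := by
  have hd : ∀ c : ℝ, (1 - X) * derivative ℝ (PowerSeries.mk (risingCoeff c)) = C c * PowerSeries.mk (risingCoeff c) := by
    intro c
    ext m
    rw [sub_mul, one_mul, map_sub, coeff_derivative, coeff_C_mul, coeff_mk, coeff_mk]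
    cases m with
    | zero =>
      rw [coeff_zero_X_mul, risingCoeff_succ, risingCoeff_zero]; simp
    | succ m =>
      rw [coeff_succ_X_mul, coeff_derivative, coeff_mk, risingCoeff_succ c (m + 1)]
      push_cast
      have : (m : ℝ) + 1 + 1 ≠ 0 := by positivity
      field_simp
      ring
  set H := PowerSeries.mk (risingCoeff a) * PowerSeries.mk (risingCoeff b) with hH
  have hHd : (1 - X) * derivative ℝ H = C (a + b) * H := by
    rw [hH, Derivation.leibniz, smul_eq_mul, smul_eq_mul, map_add]
    linear_combination PowerSeries.mk (risingCoeff a) * hd b + PowerSeries.mk (risingCoeff b) * hd a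
  ext m
  rw [coeff_mk]
  induction m with
  | zero => simp [hH, risingCoeff_zero]
  | succ m ih =>
    have h1 := congrArg (coeff m) hHd
    rw [sub_mul, one_mul, map_sub, coeff_derivative, coeff_C_mul] at h1
    have h2 : coeff m (X * derivative ℝ H) = m * coeff m H := by
      cases m with
      | zero => rw [coeff_zero_X_mul]; simp
      | succ m => rw [coeff_succ_X_mul, coeff_derivative]; push_cast; ring
    rw [h2, ih] at h1
    rw [risingCoeff_succ]
    have : (m : ℝ) + 1 ≠ 0 := by positivity
    field_simp
    linear_combination h1

open PowerSeries in
theorem mk_risingCoeff_pow (a : ℝ) (s : ℕ) :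
    PowerSeries.mk (risingCoeff a) ^ s = PowerSeries.mk (risingCoeff (s * a)) := by
  induction s with
  | zero =>
    ext m
    rw [pow_zero, coeff_mk, coeff_one]
    cases m with
    | zero => simp [risingCoeff_zero]
    | succ m => simp [risingCoeff, prod_range_succ']
  | succ s ih =>
    rw [pow_succ, ih, mk_risingCoeff_mul]
    push_cast
    ring_nf

end RisingBinomial

section AbelSummation

theorem norm_sum_antitone_mul_pow_le {c : ℕ → ℝ} (hc : Antitone c) (hc0 : ∀ m, 0 ≤ c m) {z : ℂ}
    (hz : ‖z‖ = 1) (N : ℕ) : ‖∑ m ∈ range N, (c m : ℂ) * z ^ m‖ * ‖z - 1‖ ≤ 2 * c 0 := by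
  cases N with
  | zero => simpa using hc0 0
  | succ N =>
    have key : ‖(∑ m ∈ range (N + 1), (c m : ℂ) * z ^ m) * (z - 1) - c N * z ^ (N + 1)‖ ≤
        2 * c 0 - c N := by
      induction N with
      | zero =>
        have e : (∑ m ∈ range (0 + 1), (c m : ℂ) * z ^ m) * (z - 1) - c 0 * z ^ (0 + 1) = -c 0 := by
          simp; ring
        rw [e, norm_neg, Complex.norm_real, Real.norm_of_nonneg (hc0 0)]
        linarith
      | succ N ih =>
        have e : (∑ m ∈ range (N + 1 + 1), (c m : ℂ) * z ^ m) * (z - 1) -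
            c (N + 1) * z ^ (N + 1 + 1) =
            ((∑ m ∈ range (N + 1), (c m : ℂ) * z ^ m) * (z - 1) - c N * z ^ (N + 1)) +
              ((c N - c (N + 1) : ℝ) : ℂ) * z ^ (N + 1) := by
          rw [sum_range_succ _ (N + 1)]; push_cast; ring
        rw [e]
        refine (norm_add_le _ _).trans ?_
        rw [norm_mul, norm_pow, hz, one_pow, mul_one, Complex.norm_real,
          Real.norm_of_nonneg (sub_nonneg.2 (hc (Nat.le_succ N)))]
        linarith
    rw [← norm_mul]
    calc _ = ‖((∑ m ∈ range (N + 1), (c m : ℂ) * z ^ m) * (z - 1) - c N * z ^ (N + 1)) +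
            c N * z ^ (N + 1)‖ := by rw [sub_add_cancel]
      _ ≤ (2 * c 0 - c N) + c N := by
        refine (norm_add_le _ _).trans (add_le_add key ?_)
        rw [norm_mul, norm_pow, hz, one_pow, mul_one, Complex.norm_real,
          Real.norm_of_nonneg (hc0 N)]
      _ = _ := by ring

theorem norm_sum_mul_pow_le_of_partial_sums {D : ℕ → ℂ} {K : ℝ} {n : ℕ}
    (hD : ∀ M ≤ n, ‖∑ m ∈ range (M + 1), D m‖ ≤ K) {z : ℂ} (hz : ‖z‖ = 1) :
    ‖∑ m ∈ range (n + 1), D m * z ^ m‖ ≤ K * (1 + n * ‖z - 1‖) := by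
  have key : ∀ N ≤ n, ‖∑ m ∈ range (N + 1), D m * z ^ m - (∑ m ∈ range (N + 1), D m) * z ^ N‖ ≤
      K * (N * ‖z - 1‖) := by
    intro N hN
    induction N with
    | zero => simp
    | succ N ih =>
      have e : ∑ m ∈ range (N + 1 + 1), D m * z ^ m - (∑ m ∈ range (N + 1 + 1), D m) * z ^ (N + 1) =
          (∑ m ∈ range (N + 1), D m * z ^ m - (∑ m ∈ range (N + 1), D m) * z ^ N) -
            (∑ m ∈ range (N + 1), D m) * z ^ N * (z - 1) := by
        rw [sum_range_succ _ (N + 1), sum_range_succ _ (N + 1)]; ring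
      rw [e]
      refine (norm_sub_le _ _).trans ?_
      rw [norm_mul, norm_mul, norm_pow, hz, one_pow, mul_one]
      have h1 := ih (by omega)
      have h2 := mul_le_mul_of_nonneg_right (hD N (by omega)) (norm_nonneg (z - 1))
      push_cast
      linarith
  have h1 := key n le_rfl
  have h2 := hD n le_rfl
  calc _ = ‖(∑ m ∈ range (n + 1), D m * z ^ m - (∑ m ∈ range (n + 1), D m) * z ^ n) +
          (∑ m ∈ range (n + 1), D m) * z ^ n‖ := by rw [sub_add_cancel]
    _ ≤ K * (n * ‖z - 1‖) + K := by
      refine (norm_add_le _ _).trans (add_le_add h1 ?_)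
      rwa [norm_mul, norm_pow, hz, one_pow, mul_one]
    _ = _ := by ring

end AbelSummation

section ModelSum

/-- Coefficients modelling the density of `k`-th powers. -/
noncomputable def modelCoeff (k m : ℕ) : ℝ :=
  Real.Gamma (1 + 1 / (k : ℝ)) * risingCoeff (1 / (k : ℝ)) m

/-- The model for the generating polynomial of the `k`-th powers up to `n`. -/
noncomputable def modelPoly (k n : ℕ) : Polynomial ℂ :=
  (PowerSeries.trunc (n + 1) (PowerSeries.mk (modelCoeff k))).map Complex.ofRealHom

variable {k : ℕ}

theorem one_div_pos_lt_one (hk : 2 ≤ k) : 0 < 1 / (k : ℝ) ∧ 1 / (k : ℝ) < 1 := by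
  have : (2 : ℝ) ≤ k := by exact_mod_cast hk
  exact ⟨by positivity, by rw [div_lt_one (by positivity)]; linarith⟩

theorem Gamma_one_add_pos (k : ℕ) : 0 < Real.Gamma (1 + 1 / (k : ℝ)) :=
  Real.Gamma_pos_of_pos (by positivity)

theorem modelCoeff_pos (hk : 2 ≤ k) (m : ℕ) : 0 < modelCoeff k m :=
  mul_pos (Gamma_one_add_pos k) (risingCoeff_pos (one_div_pos_lt_one hk).1 m)

theorem antitone_modelCoeff (hk : 2 ≤ k) : Antitone (modelCoeff k) := fun _ _ h =>
  mul_le_mul_of_nonneg_left (antitone_risingCoeff (one_div_pos_lt_one hk).1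
    (one_div_pos_lt_one hk).2.le h) (Gamma_one_add_pos k).le

theorem rpow_le_sum_modelCoeff (hk : 2 ≤ k) (M : ℕ) :
    (M : ℝ) ^ (1 / (k : ℝ)) ≤ ∑ m ∈ range (M + 1), modelCoeff k m := by
  obtain ⟨h1, h2⟩ := one_div_pos_lt_one hk
  simp_rw [modelCoeff]
  rw [← mul_sum, sum_risingCoeff h1]
  exact rpow_le_risingCoeff h1 h2 M

theorem sum_modelCoeff_le_rpow (hk : 2 ≤ k) (M : ℕ) :
    ∑ m ∈ range (M + 1), modelCoeff k m ≤ ((M : ℝ) + 1) ^ (1 / (k : ℝ)) := by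
  obtain ⟨h1, h2⟩ := one_div_pos_lt_one hk
  simp_rw [modelCoeff]
  rw [← mul_sum, sum_risingCoeff h1]
  exact risingCoeff_le_rpow h1 h2 M

theorem modelCoeff_le (hk : 2 ≤ k) (M : ℕ) :
    ((M : ℝ) + 1) * modelCoeff k M ≤ ((M : ℝ) + 1) ^ (1 / (k : ℝ)) := by
  refine le_trans ?_ (sum_modelCoeff_le_rpow hk M)
  have := card_nsmul_le_sum (range (M + 1)) (modelCoeff k) (modelCoeff k M) fun m hm =>
    antitone_modelCoeff hk (Nat.lt_succ_iff.1 (mem_range.1 hm))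
  rw [card_range, nsmul_eq_mul] at this
  exact_mod_cast this

theorem eval_modelPoly (n : ℕ) (z : ℂ) :
    (modelPoly k n).eval z = ∑ m ∈ range (n + 1), (modelCoeff k m : ℂ) * z ^ m := by
  rw [modelPoly, Polynomial.eval_map, PowerSeries.eval₂_trunc_eq_sum_range]
  simp

theorem natDegree_modelPoly_le (n : ℕ) : (modelPoly k n).natDegree ≤ n :=
  Polynomial.natDegree_map_le.trans (Nat.lt_succ_iff.1 (PowerSeries.natDegree_trunc_lt _ _))

theorem mk_modelCoeff_pow (k s : ℕ) : PowerSeries.mk (modelCoeff k) ^ s =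
    PowerSeries.mk (fun m => Real.Gamma (1 + 1 / (k : ℝ)) ^ s *
      risingCoeff ((s : ℝ) / k) m) := by
  have h1 : PowerSeries.mk (modelCoeff k) = PowerSeries.C (Real.Gamma (1 + 1 / (k : ℝ))) *
      PowerSeries.mk (risingCoeff (1 / (k : ℝ))) := by
    ext m; simp [modelCoeff]
  rw [h1, mul_pow, mk_risingCoeff_pow, ← map_pow]
  ext m
  rw [PowerSeries.coeff_C_mul, PowerSeries.coeff_mk, PowerSeries.coeff_mk, mul_one_div]

theorem coeff_modelPoly_pow_self (s n : ℕ) : (modelPoly k n ^ s).coeff n =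
    ((Real.Gamma (1 + 1 / (k : ℝ)) ^ s * risingCoeff ((s : ℝ) / k) n : ℝ) : ℂ) := by
  rw [modelPoly, ← Polynomial.map_pow, Polynomial.coeff_map, Complex.ofRealHom_eq_coe]
  congr 1
  have h1 := congrArg (fun p => Polynomial.coeff p n)
    (PowerSeries.trunc_trunc_pow (PowerSeries.mk (modelCoeff k)) (n + 1) s)
  simp only [PowerSeries.coeff_trunc, if_pos (Nat.lt_succ_self n), mk_modelCoeff_pow,
    PowerSeries.coeff_mk] at h1
  rw [← h1, ← Polynomial.coe_pow, Polynomial.coeff_coe]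

theorem coeff_pow_le_of_coeff_le {A B : PowerSeries ℝ}
    (h : ∀ m, 0 ≤ PowerSeries.coeff m A ∧ PowerSeries.coeff m A ≤ PowerSeries.coeff m B) (t m : ℕ) :
    0 ≤ PowerSeries.coeff m (A ^ t) ∧
      PowerSeries.coeff m (A ^ t) ≤ PowerSeries.coeff m (B ^ t) := by
  induction t generalizing m with
  | zero => simp only [pow_zero, PowerSeries.coeff_one, le_refl, and_true]; split_ifs <;> norm_num
  | succ t ih =>
    rw [pow_succ, pow_succ, PowerSeries.coeff_mul, PowerSeries.coeff_mul]
    refine ⟨sum_nonneg fun p _ => mul_nonneg (ih _).1 (h _).1, sum_le_sum fun p _ => ?_⟩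
    exact mul_le_mul (ih _).2 (h _).2 (h _).1 ((ih _).1.trans (ih _).2)

theorem norm_coeff_modelPoly_pow_le (hk : 2 ≤ k) (n m : ℕ) :
    ‖(modelPoly k n ^ k).coeff m‖ ≤ Real.Gamma (1 + 1 / (k : ℝ)) ^ k := by
  rw [modelPoly, ← Polynomial.map_pow, Polynomial.coeff_map, Complex.ofRealHom_eq_coe,
    Complex.norm_real, ← Polynomial.coeff_coe, Polynomial.coe_pow]
  have h1 := coeff_pow_le_of_coeff_le (A := (PowerSeries.trunc (n + 1)
    (PowerSeries.mk (modelCoeff k)) : PowerSeries ℝ)) (B := PowerSeries.mk (modelCoeff k)) (by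
      intro m
      rw [Polynomial.coeff_coe, PowerSeries.coeff_trunc, PowerSeries.coeff_mk]
      have := (modelCoeff_pos hk m).le
      split_ifs
      · exact ⟨this, le_rfl⟩
      · exact ⟨le_rfl, this⟩) k m
  rw [Real.norm_of_nonneg h1.1]
  refine h1.2.trans_eq ?_
  rw [mk_modelCoeff_pow, PowerSeries.coeff_mk, div_self (by positivity), risingCoeff_one, mul_one]

theorem sum_grid_modelPoly_le (hk : 2 ≤ k) {n L : ℕ} (hL : k * n < L) :
    ∑ j ∈ range L, ‖(modelPoly k n).eval (ec (j / L))‖ ^ (2 * k) ≤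
      L * ((Real.Gamma (1 + 1 / (k : ℝ)) ^ k) ^ 2 * (k * n + 1)) := by
  have hdeg : (modelPoly k n ^ k).natDegree ≤ k * n :=
    Polynomial.natDegree_pow_le_of_le _ (natDegree_modelPoly_le n)
  have h1 := sum_grid_normSq_eval (hdeg.trans_lt hL)
  calc ∑ j ∈ range L, ‖(modelPoly k n).eval (ec (j / L))‖ ^ (2 * k)
      = ∑ j ∈ range L, ‖(modelPoly k n ^ k).eval (ec (j / L))‖ ^ 2 := by
        refine sum_congr rfl fun j _ => ?_
        rw [Polynomial.eval_pow, norm_pow, ← pow_mul, mul_comm]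
    _ = L * ∑ m ∈ range L, ‖(modelPoly k n ^ k).coeff m‖ ^ 2 := h1
    _ = L * ∑ m ∈ range (k * n + 1), ‖(modelPoly k n ^ k).coeff m‖ ^ 2 := by
        congr 1
        refine (sum_subset (range_mono (by omega)) fun m _ hm => ?_).symm
        rw [mem_range, not_lt] at hm
        rw [Polynomial.coeff_eq_zero_of_natDegree_lt (by omega)]
        simp
    _ ≤ L * ∑ _m ∈ range (k * n + 1), (Real.Gamma (1 + 1 / (k : ℝ)) ^ k) ^ 2 := by
        gcongr with m hm
        exact norm_coeff_modelPoly_pow_le hk n m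
    _ = _ := by
        rw [sum_const, card_range, nsmul_eq_mul]; push_cast; ring

theorem norm_sum_modelCoeff_le (hk : 2 ≤ k) (n : ℕ) {z : ℂ} (hz : ‖z‖ = 1) :
    ‖∑ m ∈ range (n + 1), (modelCoeff k m : ℂ) * z ^ m‖ ≤ ((n : ℝ) + 1) ^ (1 / (k : ℝ)) := by
  refine (norm_sum_le _ _).trans (le_trans (sum_le_sum fun m _ => ?_) (sum_modelCoeff_le_rpow hk n))
  rw [norm_mul, norm_pow, hz, one_pow, mul_one, Complex.norm_real,
    Real.norm_of_nonneg (modelCoeff_pos hk m).le]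

theorem norm_eval_modelPoly_le (hk : 2 ≤ k) (n : ℕ) (β : ℝ) :
    ‖(modelPoly k n).eval (ec β)‖ ≤ ((n : ℝ) + 1) ^ (1 / (k : ℝ)) := by
  rw [eval_modelPoly]
  exact norm_sum_modelCoeff_le hk n (norm_ec β)

/-- Decay of the model sum away from the integers. -/
theorem norm_eval_modelPoly_le_of_ne_zero (hk : 2 ≤ k) (n : ℕ) {β : ℝ} (hβ0 : β ≠ 0)
    (hβ : |β| ≤ 1 / 2) :
    ‖(modelPoly k n).eval (ec β)‖ ≤ 8 * (1 / |β|) ^ (1 / (k : ℝ)) := by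
  obtain ⟨ha0, ha1⟩ := one_div_pos_lt_one hk
  set a := 1 / (k : ℝ) with ha
  have hβp : 0 < |β| := abs_pos.2 hβ0
  have hinv : 2 ≤ 1 / |β| := by rw [le_div_iff₀ hβp]; linarith
  set M := ⌈1 / |β|⌉₊ with hM
  have hM1 : 1 / |β| ≤ M := Nat.le_ceil _
  have hM2 : (M : ℝ) < 1 / |β| + 1 := Nat.ceil_lt_add_one (by positivity)
  have hM0 : (0 : ℝ) < M := by linarith
  have htwo : (2 : ℝ) ^ a ≤ 2 := by
    calc (2 : ℝ) ^ a ≤ 2 ^ (1 : ℝ) := Real.rpow_le_rpow_of_exponent_le (by norm_num) ha1.le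
      _ = 2 := Real.rpow_one 2
  have hMa : (M : ℝ) ^ a ≤ 2 * (1 / |β|) ^ a := by
    calc (M : ℝ) ^ a ≤ (2 * (1 / |β|)) ^ a := by gcongr; linarith
      _ = 2 ^ a * (1 / |β|) ^ a := Real.mul_rpow (by norm_num) (by positivity)
      _ ≤ _ := by gcongr
  have hMa1 : ((M : ℝ) + 1) ^ a ≤ 2 * (M : ℝ) ^ a := by
    calc ((M : ℝ) + 1) ^ a ≤ (2 * (M : ℝ)) ^ a := by gcongr; linarith
      _ = 2 ^ a * (M : ℝ) ^ a := Real.mul_rpow (by norm_num) (by positivity)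
      _ ≤ _ := by gcongr
  have hMnat : 1 ≤ M := by
    have : (0 : ℝ) < M := hM0
    exact_mod_cast this
  rcases le_or_gt (n + 1) M with hn | hn
  · refine (norm_eval_modelPoly_le hk n β).trans ?_
    have h1 : ((n : ℝ) + 1) ^ a ≤ (M : ℝ) ^ a := by
      gcongr; exact_mod_cast hn
    have : 0 ≤ (1 / |β|) ^ a := by positivity
    linarith
  · rw [eval_modelPoly, ← sum_range_add_sum_Ico _ hn.le]
    refine (norm_add_le _ _).trans ?_
    have h1 : ‖∑ m ∈ range M, (modelCoeff k m : ℂ) * ec β ^ m‖ ≤ (M : ℝ) ^ a := by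
      have h2 := norm_sum_modelCoeff_le hk (M - 1) (norm_ec β)
      rw [Nat.sub_add_cancel hMnat, Nat.cast_sub hMnat, Nat.cast_one, sub_add_cancel] at h2
      exact h2
    have h3 : ‖∑ m ∈ Ico M (n + 1), (modelCoeff k m : ℂ) * ec β ^ m‖ ≤ ((M : ℝ) + 1) ^ a := by
      rw [sum_Ico_eq_sum_range]
      have h4 := norm_sum_antitone_mul_pow_le (c := fun m => modelCoeff k (M + m))
        (fun _ _ h => antitone_modelCoeff hk (by omega)) (fun m => (modelCoeff_pos hk _).le)
        (norm_ec β) (n + 1 - M)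
      have h5 : ∑ i ∈ range (n + 1 - M), (modelCoeff k (M + i) : ℂ) * ec β ^ (M + i) =
          ec β ^ M * ∑ i ∈ range (n + 1 - M), (modelCoeff k (M + i) : ℂ) * ec β ^ i := by
        rw [mul_sum]; exact sum_congr rfl fun i _ => by rw [pow_add]; ring
      rw [h5, norm_mul, norm_pow, norm_ec, one_pow, one_mul]
      set T := ‖∑ i ∈ range (n + 1 - M), (modelCoeff k (M + i) : ℂ) * ec β ^ i‖ with hT
      have h6 := four_mul_abs_le_norm_ec_sub_one hβ
      have h7 : T * (4 * |β|) ≤ 2 * modelCoeff k M :=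
        (mul_le_mul_of_nonneg_left h6 (norm_nonneg _)).trans h4
      have h8 := modelCoeff_le hk M
      have hc := modelCoeff_pos hk M
      have h9 : 1 ≤ |β| * (M + 1) := by
        rw [div_le_iff₀ hβp] at hM1; nlinarith
      have hT0 : 0 ≤ T := norm_nonneg _
      calc T ≤ T * (|β| * (M + 1)) := le_mul_of_one_le_right hT0 h9
        _ = T * (4 * |β|) * ((M + 1) / 4) := by ring
        _ ≤ 2 * modelCoeff k M * ((M + 1) / 4) := by gcongr
        _ ≤ ((M : ℝ) + 1) * modelCoeff k M := by nlinarith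
        _ ≤ _ := h8
    have : 0 ≤ (1 / |β|) ^ a := by positivity
    linarith

end ModelSum

section MajorArcApproximation

/-- The normalized Gauss sum `q⁻¹ S(q, a)` for `k`-th powers. -/
noncomputable def gaussMean (k q a : ℕ) : ℂ :=
  (q : ℂ)⁻¹ * ∑ x ∈ Icc 1 q, ec ((a : ℝ) * (x : ℝ) ^ k / (q : ℝ))

theorem norm_gaussMean_le_one (k q a : ℕ) : ‖gaussMean k q a‖ ≤ 1 := by
  rw [gaussMean, norm_mul, norm_inv, Complex.norm_natCast]
  refine inv_mul_le_one_of_le₀ ?_ (Nat.cast_nonneg q)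
  refine (norm_sum_le _ _).trans ?_
  simp [norm_ec]

theorem exists_pow_le_lt_succ_pow {k : ℕ} (hk : k ≠ 0) (n : ℕ) :
    ∃ X : ℕ, X ^ k ≤ n ∧ n < (X + 1) ^ k := by
  have h : ∃ Y : ℕ, n < Y ^ k := ⟨n + 1, (Nat.lt_succ_self n).trans_le (Nat.le_self_pow hk _)⟩
  classical
  have h0 : Nat.find h ≠ 0 := fun h0 => by
    have := Nat.find_spec h
    rw [h0, zero_pow hk] at this
    omega
  obtain ⟨X, hX⟩ := Nat.exists_eq_succ_of_ne_zero h0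
  refine ⟨X, not_lt.1 (Nat.find_min h (by omega)), ?_⟩
  have := Nat.find_spec h
  rwa [hX] at this

theorem norm_sum_sub_mul_mean_le {c : ℕ → ℂ} (hc : ∀ x, ‖c x‖ ≤ 1) {q : ℕ}
    (hper : ∀ x, c (q + x) = c x) (hq : 1 ≤ q) (X : ℕ) :
    ‖∑ x ∈ range X, c x - X * ((q : ℂ)⁻¹ * ∑ x ∈ range q, c x)‖ ≤ 2 * q := by
  have hq0 : (q : ℂ) ≠ 0 := by exact_mod_cast (by omega : q ≠ 0)
  have hsum : ∀ N, ‖∑ x ∈ range N, c x‖ ≤ N := fun N => by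
    refine (norm_sum_le _ _).trans ((sum_le_sum fun x _ => hc x).trans ?_)
    simp
  induction X using Nat.strong_induction_on with
  | _ X ih =>
    rcases lt_or_ge X q with h | h
    · refine (norm_sub_le _ _).trans ?_
      rw [norm_mul, norm_mul, norm_inv, Complex.norm_natCast, Complex.norm_natCast]
      have h1 := hsum X
      have h2 := hsum q
      have h3 : (X : ℝ) ≤ q := by exact_mod_cast h.le
      have hqp : (0 : ℝ) < q := by exact_mod_cast hq
      have h4 : (q : ℝ)⁻¹ * ‖∑ x ∈ range q, c x‖ ≤ 1 := by
        rw [inv_mul_le_iff₀ hqp]; simpa using h2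
      have : (X : ℝ) * ((q : ℝ)⁻¹ * ‖∑ x ∈ range q, c x‖) ≤ X * 1 := by gcongr
      linarith
    · obtain ⟨Y, rfl⟩ := Nat.exists_eq_add_of_le h
      rw [sum_range_add]
      simp only [hper]
      convert ih Y (by omega) using 2
      push_cast
      field_simp
      ring

theorem sum_indicator_pow (k P N : ℕ) (c w : ℕ → ℂ) :
    ∑ m ∈ range N, (∑ x ∈ Icc 1 P, if x ^ k = m then c x else 0) * w m =
      ∑ x ∈ (Icc 1 P).filter (fun x => x ^ k < N), c x * w (x ^ k) := by
  simp only [sum_mul, ite_mul, zero_mul]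
  rw [sum_comm, sum_filter]
  refine sum_congr rfl fun x _ => ?_
  rw [sum_ite_eq]
  simp

theorem norm_eval_powPoly_sub_le {k : ℕ} (hk : 2 ≤ k) {n P q : ℕ} (hP : P ^ k ≤ n)
    (hn : n < (P + 1) ^ k) (hq : 1 ≤ q) (a : ℕ) (β : ℝ) :
    ‖(powPoly k P).eval (ec ((a : ℝ) / q + β)) - gaussMean k q a * (modelPoly k n).eval (ec β)‖ ≤
      3 * q * (1 + n * (2 * Real.pi * |β|)) := by
  have hk0 : k ≠ 0 := by omega
  have hqr : (1 : ℝ) ≤ q := by exact_mod_cast hq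
  set c : ℕ → ℂ := fun x => ec ((a : ℝ) * (x : ℝ) ^ k / (q : ℝ)) with hc
  set D : ℕ → ℂ := fun m => (∑ x ∈ Icc 1 P, if x ^ k = m then c x else 0) -
    gaussMean k q a * modelCoeff k m with hD
  have hfilter : ∀ M ≤ n, ∀ X, X ^ k ≤ M → M < (X + 1) ^ k →
      (Icc 1 P).filter (fun x => x ^ k < M + 1) = Icc 1 X := by
    intro M hM X h1 h2
    ext x
    simp only [mem_filter, mem_Icc]
    constructor
    · rintro ⟨⟨h3, _⟩, h4⟩
      refine ⟨h3, ?_⟩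
      have := lt_of_pow_lt_pow_left₀ k (by omega) (lt_of_le_of_lt (Nat.lt_succ_iff.1 h4) h2)
      omega
    · rintro ⟨h3, h4⟩
      have h5 : x ^ k ≤ M := (Nat.pow_le_pow_left h4 k).trans h1
      refine ⟨⟨h3, ?_⟩, by omega⟩
      have := lt_of_pow_lt_pow_left₀ k (by omega) (lt_of_le_of_lt (h5.trans hM) hn)
      omega
  have hexpand : (powPoly k P).eval (ec ((a : ℝ) / q + β)) -
      gaussMean k q a * (modelPoly k n).eval (ec β) = ∑ m ∈ range (n + 1), D m * ec β ^ m := by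
    simp only [hD, sub_mul, sum_sub_distrib]
    rw [sum_indicator_pow, hfilter n le_rfl P hP hn, eval_powPoly, eval_modelPoly, mul_sum]
    congr 1
    · refine sum_congr rfl fun x _ => ?_
      rw [hc, ← ec_nat_mul, ← ec_add]
      congr 1
      push_cast
      field_simp
    · exact sum_congr rfl fun x _ => by ring
  have hpart : ∀ M ≤ n, ‖∑ m ∈ range (M + 1), D m‖ ≤ 3 * q := by
    intro M hM
    obtain ⟨X, h1, h2⟩ := exists_pow_le_lt_succ_pow hk0 M
    have e1 : ∑ m ∈ range (M + 1), D m = (∑ x ∈ Icc 1 X, c x - X * gaussMean k q a) +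
        gaussMean k q a * ((X - ∑ m ∈ range (M + 1), modelCoeff k m : ℝ) : ℂ) := by
      have := sum_indicator_pow k P (M + 1) c (fun _ => 1)
      simp only [mul_one] at this
      simp only [hD, sum_sub_distrib]
      rw [this, hfilter M hM X h1 h2, ← mul_sum]
      push_cast
      ring
    have e2 : ∀ N, ∑ x ∈ Icc 1 N, c x = ∑ x ∈ range N, c (x + 1) := fun N => by
      rw [range_eq_Ico, sum_Ico_add' c 0 N 1]
      rfl
    have h3 : ‖∑ x ∈ Icc 1 X, c x - X * gaussMean k q a‖ ≤ 2 * q := by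
      have := norm_sum_sub_mul_mean_le (c := fun x => c (x + 1)) (fun x => (norm_ec _).le) (q := q)
        ?_ hq X
      · rw [gaussMean, e2, e2]; exact this
      · intro x
        simp only [hc]
        have hdiv : (q : ℤ) ∣ ((q : ℤ) + x + 1) ^ k - ((x : ℤ) + 1) ^ k :=
          (by simp : (q : ℤ) ∣ ((q : ℤ) + x + 1) - ((x : ℤ) + 1)).trans (sub_dvd_pow_sub_pow _ _ _)
        obtain ⟨m, hm⟩ := hdiv
        have hm' : ((q : ℝ) + x + 1) ^ k = ((x : ℝ) + 1) ^ k + q * m := by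
          have : (((q : ℤ) + x + 1) ^ k : ℤ) = ((x : ℤ) + 1) ^ k + q * m := by linarith
          exact_mod_cast this
        rw [← ec_add_intCast ((a : ℝ) * ((x + 1 : ℕ) : ℝ) ^ k / q) (a * m)]
        congr 1
        push_cast
        rw [hm']
        field_simp
    have h4 : |(X : ℝ) - ∑ m ∈ range (M + 1), modelCoeff k m| ≤ 1 := by
      have hkr : (0 : ℝ) < k := by positivity
      have h5 := rpow_le_sum_modelCoeff hk M
      have h6 := sum_modelCoeff_le_rpow hk M
      have h7 : (X : ℝ) ≤ (M : ℝ) ^ (1 / (k : ℝ)) := by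
        rw [one_div, Real.le_rpow_inv_iff_of_pos (by positivity) (by positivity) hkr,
          Real.rpow_natCast]
        exact_mod_cast h1
      have h8 : ((M : ℝ) + 1) ^ (1 / (k : ℝ)) ≤ X + 1 := by
        rw [one_div, Real.rpow_inv_le_iff_of_pos (by positivity) (by positivity) hkr,
          Real.rpow_natCast]
        exact_mod_cast h2
      rw [abs_le]
      constructor <;> linarith
    rw [e1]
    refine (norm_add_le _ _).trans ?_
    rw [norm_mul, Complex.norm_real, Real.norm_eq_abs]
    have := mul_le_mul (norm_gaussMean_le_one k q a) h4 (abs_nonneg _) zero_le_one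
    linarith
  rw [hexpand]
  refine (norm_sum_mul_pow_le_of_partial_sums hpart (norm_ec β)).trans ?_
  gcongr
  exact norm_ec_sub_one_le β

end MajorArcApproximation

section SingularSeries

theorem sum_Icc_one_eq_sum_range {M : Type*} [AddCommMonoid M] (f : ℕ → M) (N : ℕ) :
    ∑ x ∈ Icc 1 N, f x = ∑ x ∈ range N, f (x + 1) := by
  rw [range_eq_Ico, sum_Ico_add' f 0 N 1]
  rfl

/-- Large values of `∑_{x ≤ P} e(α x^k)` only occur near rationals of small denominator. -/
theorem exists_approx_of_large_powPoly {k : ℕ} (hk : 2 ≤ k) : ∃ C : ℕ, ∀ B : ℝ, 2 ≤ B →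
    ∀ P : ℕ, 1 ≤ P → ∀ α : ℝ, (P : ℝ) / B ≤ ‖(powPoly k P).eval (ec α)‖ →
    ∃ q : ℕ, 1 ≤ q ∧ (q : ℝ) ≤ B ^ C ∧ ∃ m : ℤ, |q * α - m| ≤ B ^ C / (P : ℝ) ^ k := by
  obtain ⟨C, hC⟩ := exists_approx_of_large_weyl_sum (k - 1)
  rw [Nat.sub_add_cancel (by omega : 1 ≤ k)] at hC
  refine ⟨C, fun B hB P hP α h => ?_⟩
  set p : Polynomial ℝ := Polynomial.C α * (Polynomial.X + Polynomial.C 1) ^ k with hp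
  have hmonic : ((Polynomial.X + Polynomial.C 1 : Polynomial ℝ) ^ k).Monic :=
    (Polynomial.monic_X_add_C 1).pow k
  have hdeg : ((Polynomial.X + Polynomial.C 1 : Polynomial ℝ) ^ k).natDegree = k := by
    rw [Polynomial.natDegree_pow, Polynomial.natDegree_X_add_C, mul_one]
  have hcoeff : p.coeff k = α := by
    have := hmonic.coeff_natDegree
    rw [hdeg] at this
    rw [hp, Polynomial.coeff_C_mul, this, mul_one]
  have := hC B hB P hP P le_rfl p ((Polynomial.natDegree_C_mul_le _ _).trans hdeg.le) (by
    refine h.trans_eq ?_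
    rw [eval_powPoly, sum_Icc_one_eq_sum_range]
    congr 1
    refine sum_congr rfl fun x _ => ?_
    simp [hp])
  rwa [hcoeff] at this

theorem exists_norm_gaussMean_le {k : ℕ} (hk : 2 ≤ k) : ∃ σ : ℝ, 0 < σ ∧
    ∀ q : ℕ, 1 ≤ q → ∀ a : ℕ, a.Coprime q → ‖gaussMean k q a‖ ≤ 2 * (q : ℝ) ^ (-σ) := by
  obtain ⟨C, hC⟩ := exists_approx_of_large_powPoly hk
  refine ⟨1 / (C + 1), by positivity, fun q hq a ha => ?_⟩
  set σ : ℝ := 1 / (C + 1) with hσ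
  have hσ0 : 0 < σ := by positivity
  have hqr : (1 : ℝ) ≤ q := by exact_mod_cast hq
  have hq0 : (0 : ℝ) < q := by linarith
  by_contra! hcon
  have hB : 2 ≤ (q : ℝ) ^ σ := by
    have := hcon.trans_le (norm_gaussMean_le_one k q a)
    rw [Real.rpow_neg hq0.le, ← div_eq_mul_inv, div_lt_one (by positivity)] at this
    exact this.le
  have hq1 : (1 : ℝ) < q := by
    by_contra! h
    rw [le_antisymm h hqr, Real.one_rpow] at hB
    linarith
  obtain ⟨r, hr1, hr2, m, hm⟩ := hC _ hB q hq (a / q) (by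
    have h1 : (powPoly k q).eval (ec ((a : ℝ) / q)) = q * gaussMean k q a := by
      rw [eval_powPoly, gaussMean, mul_inv_cancel_left₀ (by exact_mod_cast hq0.ne')]
      exact sum_congr rfl fun x _ => by rw [div_mul_eq_mul_div]
    rw [h1, norm_mul, Complex.norm_natCast, div_eq_mul_inv, ← Real.rpow_neg hq0.le]
    have : 0 < (q : ℝ) ^ (-σ) := by positivity
    gcongr
    linarith)
  have hBC : ((q : ℝ) ^ σ) ^ C < q := by
    rw [← Real.rpow_mul_natCast hq0.le]
    conv_rhs => rw [← Real.rpow_one (q : ℝ)]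
    refine Real.rpow_lt_rpow_of_exponent_lt hq1 ?_
    rw [hσ, div_mul_eq_mul_div, one_mul, div_lt_one (by positivity)]
    linarith
  have hrq : r < q := by exact_mod_cast hr2.trans_lt hBC
  have h2 : |(r : ℝ) * a - m * q| < 1 := by
    have h3 : (r : ℝ) * a - m * q = q * (r * (a / q) - m) := by field_simp
    rw [h3, abs_mul, abs_of_pos hq0]
    calc _ ≤ (q : ℝ) * (((q : ℝ) ^ σ) ^ C / (q : ℝ) ^ k) := by gcongr
      _ < q * (q / (q : ℝ) ^ k) := by gcongr
      _ = (q : ℝ) ^ 2 / (q : ℝ) ^ k := by ring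
      _ ≤ 1 := div_le_one_of_le₀ (pow_le_pow_right₀ hqr hk) (by positivity)
  have h3 : (r : ℤ) * a - m * q = 0 := by
    rw [← Int.abs_lt_one_iff]
    exact_mod_cast h2
  have h4 : q ∣ r * a := by
    have : (q : ℤ) ∣ ((r * a : ℕ) : ℤ) := ⟨m, by push_cast; linarith⟩
    exact_mod_cast this
  have := Nat.le_of_dvd (by omega) (ha.symm.dvd_of_dvd_mul_right h4)
  omega

theorem le_norm_eval_modelPoly {k : ℕ} (hk : 2 ≤ k) {P : ℕ} (hP : 1 ≤ P) {β : ℝ}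
    (hβ : (P : ℝ) ^ k * |β| ≤ 1 / 32) :
    (P : ℝ) / 2 ≤ ‖(modelPoly k (P ^ k)).eval (ec β)‖ := by
  have hkr : (0 : ℝ) < k := by positivity
  have hPr : (1 : ℝ) ≤ P := by exact_mod_cast hP
  set W := ∑ m ∈ range (P ^ k + 1), modelCoeff k m with hW
  have hWlow : (P : ℝ) ≤ W := by
    have := rpow_le_sum_modelCoeff hk (P ^ k)
    rwa [one_div, Nat.cast_pow, Real.pow_rpow_inv_natCast (by positivity) (by omega)] at this
  have hdiff : ‖(modelPoly k (P ^ k)).eval (ec β) - (W : ℂ)‖ ≤ W * (1 / 5) := by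
    rw [eval_modelPoly, hW]
    push_cast
    rw [← sum_sub_distrib, sum_mul]
    refine (norm_sum_le _ _).trans (sum_le_sum fun m hm => ?_)
    have hmP : (m : ℝ) ≤ (P : ℝ) ^ k := by
      exact_mod_cast Nat.lt_succ_iff.1 (mem_range.1 hm)
    have e : (modelCoeff k m : ℂ) * ec β ^ m - modelCoeff k m =
        (modelCoeff k m : ℂ) * (ec (m * β) - 1) := by rw [ec_nat_mul]; ring
    rw [e, norm_mul, Complex.norm_real, Real.norm_of_nonneg (modelCoeff_pos hk m).le]
    refine mul_le_mul_of_nonneg_left ?_ (modelCoeff_pos hk m).le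
    refine (norm_ec_sub_one_le _).trans ?_
    rw [abs_mul, Nat.abs_cast]
    have h1 : (m : ℝ) * |β| ≤ 1 / 32 := (by gcongr : (m : ℝ) * |β| ≤ P ^ k * |β|).trans hβ
    have := Real.pi_lt_d2
    have hpi := Real.pi_pos
    nlinarith [mul_nonneg (Nat.cast_nonneg (α := ℝ) m) (abs_nonneg β)]
  have h2 : W ≤ ‖(modelPoly k (P ^ k)).eval (ec β)‖ + W * (1 / 5) := by
    have h3 := norm_sub_norm_le (W : ℂ) ((W : ℂ) - (modelPoly k (P ^ k)).eval (ec β))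
    rw [sub_sub_cancel, Complex.norm_real, Real.norm_of_nonneg (by linarith),
      norm_sub_rev (W : ℂ)] at h3
    linarith
  linarith

theorem sum_fareyPairs_norm_gaussMean_le {k : ℕ} (hk : 2 ≤ k) {ε : ℝ} (hε : 0 < ε) :
    ∃ C : ℝ, 0 < C ∧ ∀ Q : ℕ, 1 ≤ Q →
      ∑ x ∈ fareyPairs Q, ‖gaussMean k x.1 x.2‖ ^ (2 * tri k) ≤ C * (Q : ℝ) ^ ε := by
  obtain ⟨C, hC0, hC⟩ := sum_grid_powPoly_le (by omega : k ≠ 0) (half_pos hε)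
  refine ⟨4 ^ (2 * tri k) * (16 * C + 6 ^ (2 * tri k)), by positivity, fun Q hQ => ?_⟩
  have hQr : (1 : ℝ) ≤ Q := by exact_mod_cast hQ
  set P := Q ^ 2 with hP
  have hP1 : 1 ≤ P := Nat.one_le_pow _ _ hQ
  have hPr : (1 : ℝ) ≤ P := by exact_mod_cast hP1
  have hPQ : (P : ℝ) = (Q : ℝ) ^ 2 := by simp [hP]
  set R := Q.factorial * (tri k + 1) with hR
  have hR1 : 1 ≤ R := Nat.one_le_iff_ne_zero.2 (by positivity)
  set L := 32 * P ^ k * R with hLdef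
  have hL : 0 < L := by positivity
  have hQP : Q ^ 2 ≤ P ^ k := Nat.le_self_pow (by omega) _
  have hQL : ∀ q, 1 ≤ q → q ≤ Q → q ∣ L := fun q h1 h2 =>
    ((Nat.dvd_factorial h1 h2).trans (Dvd.intro _ rfl)).trans (Dvd.intro_left _ rfl)
  have hRL : 2 * (R * Q ^ 2) < L := by
    have h1 : R * Q ^ 2 ≤ R * P ^ k := Nat.mul_le_mul_left _ hQP
    have h2 : 0 < R * P ^ k := by positivity
    rw [hLdef]; linarith
  have htL : tri k * P ^ k < L := by
    have h1 : tri k + 1 ≤ R := Nat.le_mul_of_pos_left _ (Nat.factorial_pos _)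
    have h2 : (tri k + 1) * P ^ k ≤ R * P ^ k := Nat.mul_le_mul_right _ h1
    have h3 : 0 < P ^ k := by positivity
    rw [hLdef]; nlinarith
  set f : ℝ → ℂ := fun α => (powPoly k P).eval (ec α) with hf
  have hmean := hC P hP1 L htL
  have hsub : ∑ j ∈ majorGrid L Q R, ‖f (j / L)‖ ^ (2 * tri k) ≤
      L * (C * (P : ℝ) ^ ((k : ℝ) ^ 2 + ε / 2)) :=
    (sum_le_sum_of_subset_of_nonneg (majorGrid_subset hL Q R) fun _ _ _ => by positivity).trans hmean
  rw [sum_majorGrid (F := fun α => ‖f α‖ ^ (2 * tri k)) hL hQL hRL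
    (fun x m => by simp only [hf, ec_add_intCast])] at hsub
  have hpt : ∀ x ∈ fareyPairs Q, ∀ r ∈ Icc (-(R : ℤ)) R,
      (‖gaussMean k x.1 x.2‖ * (P / 2)) ^ (2 * tri k) ≤ 2 ^ (2 * tri k) *
        (‖f ((x.2 : ℝ) / x.1 + r / L)‖ ^ (2 * tri k) + (6 * Q) ^ (2 * tri k)) := by
    intro x hx r hr
    have hx' := mem_fareyPairs.1 hx
    have hxq : (x.1 : ℝ) ≤ Q := by exact_mod_cast hx'.1.2
    have hβ : (P : ℝ) ^ k * |(r : ℝ) / L| ≤ 1 / 32 := by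
      have hr' : |(r : ℝ)| ≤ R := by
        rw [mem_Icc, ← abs_le] at hr
        exact_mod_cast hr
      have hRp : (0 : ℝ) < R := by exact_mod_cast hR1
      rw [abs_div, Nat.abs_cast, hLdef]
      push_cast
      rw [← mul_div_assoc, div_le_iff₀ (by positivity)]
      have : (P : ℝ) ^ k * |(r : ℝ)| ≤ P ^ k * R := by gcongr
      linarith
    have h1 := norm_eval_powPoly_sub_le hk (n := P ^ k) (P := P) le_rfl
      (Nat.pow_lt_pow_left (Nat.lt_succ_self P) (by omega)) hx'.1.1 x.2 ((r : ℝ) / L)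
    have h2 := le_norm_eval_modelPoly hk hP1 hβ
    have h3 : 3 * (x.1 : ℝ) * (1 + ((P ^ k : ℕ) : ℝ) * (2 * Real.pi * |(r : ℝ) / L|)) ≤ 6 * Q := by
      have h4 : ((P ^ k : ℕ) : ℝ) * (2 * Real.pi * |(r : ℝ) / L|) ≤ 1 := by
        push_cast
        nlinarith [Real.pi_lt_d2, Real.pi_pos]
      have h5 : 0 ≤ ((P ^ k : ℕ) : ℝ) * (2 * Real.pi * |(r : ℝ) / L|) := by
        have := Real.pi_pos; positivity
      have h6 : (0 : ℝ) ≤ x.1 := by positivity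
      nlinarith
    have h4 : ‖gaussMean k x.1 x.2‖ * (P / 2) ≤ ‖f ((x.2 : ℝ) / x.1 + r / L)‖ + 6 * Q := by
      have h5 : ‖gaussMean k x.1 x.2‖ * (P / 2) ≤
          ‖gaussMean k x.1 x.2 * (modelPoly k (P ^ k)).eval (ec ((r : ℝ) / L))‖ := by
        rw [norm_mul]; gcongr
      have h6 := norm_sub_norm_le (gaussMean k x.1 x.2 * (modelPoly k (P ^ k)).eval (ec ((r : ℝ) / L)))
        (f ((x.2 : ℝ) / x.1 + r / L))
      rw [norm_sub_rev] at h6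
      linarith
    calc _ ≤ (‖f ((x.2 : ℝ) / x.1 + r / L)‖ + 6 * Q) ^ (2 * tri k) := by gcongr
      _ ≤ 2 ^ (2 * tri k - 1) * (‖f ((x.2 : ℝ) / x.1 + r / L)‖ ^ (2 * tri k) +
          (6 * Q) ^ (2 * tri k)) := add_pow_le (by positivity) (by positivity) _
      _ ≤ _ := by gcongr <;> simp
  set A := ∑ x ∈ fareyPairs Q, ‖gaussMean k x.1 x.2‖ ^ (2 * tri k) with hA
  set T : ℝ := 2 * R + 1 with hT
  have hcard : (#(Icc (-(R : ℤ)) R) : ℝ) = T := by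
    rw [Int.card_Icc, show (R : ℤ) + 1 - -(R : ℤ) = ((2 * R + 1 : ℕ) : ℤ) by push_cast; ring,
      Int.toNat_natCast]
    push_cast; rfl
  have htot : T * (A * (P / 2) ^ (2 * tri k)) ≤ 2 ^ (2 * tri k) *
      (L * (C * (P : ℝ) ^ ((k : ℝ) ^ 2 + ε / 2)) + T * ((Q : ℝ) ^ 2 * (6 * Q) ^ (2 * tri k))) := by
    have h1 := sum_le_sum fun x hx => sum_le_sum fun r hr => hpt x hx r hr
    simp only [mul_pow _ ((P : ℝ) / 2), sum_const, nsmul_eq_mul, hcard, ← mul_sum, sum_add_distrib,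
      ← sum_mul] at h1
    refine (h1.trans ?_)
    refine mul_le_mul_of_nonneg_left (add_le_add hsub ?_) (by positivity)
    have h2 : (#(fareyPairs Q) : ℝ) ≤ (Q : ℝ) ^ 2 := by exact_mod_cast card_fareyPairs_le Q
    have hT0 : 0 ≤ T := by positivity
    calc _ ≤ (Q : ℝ) ^ 2 * (T * (6 * Q) ^ (2 * tri k)) := by gcongr
      _ = _ := by ring
  have hLT : (L : ℝ) ≤ 16 * P ^ k * T := by
    have : (0 : ℝ) ≤ 16 * (P : ℝ) ^ k := by positivity
    rw [hLdef, hT]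
    push_cast
    nlinarith
  have hTp : 0 < T := by positivity
  have h5 : A * (P / 2) ^ (2 * tri k) ≤ 2 ^ (2 * tri k) *
      (16 * P ^ k * (C * (P : ℝ) ^ ((k : ℝ) ^ 2 + ε / 2)) + (Q : ℝ) ^ 2 * (6 * Q) ^ (2 * tri k)) := by
    refine le_of_mul_le_mul_left (htot.trans ?_) hTp
    have : 0 ≤ C * (P : ℝ) ^ ((k : ℝ) ^ 2 + ε / 2) := by positivity
    calc _ ≤ 2 ^ (2 * tri k) * ((16 * P ^ k * T) * (C * (P : ℝ) ^ ((k : ℝ) ^ 2 + ε / 2)) +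
          T * ((Q : ℝ) ^ 2 * (6 * Q) ^ (2 * tri k))) := by gcongr
      _ = _ := by ring
  have h6 : (P : ℝ) ^ k * (P : ℝ) ^ ((k : ℝ) ^ 2 + ε / 2) = P ^ (2 * tri k) * (Q : ℝ) ^ ε := by
    rw [← Real.rpow_natCast _ k, ← Real.rpow_natCast _ (2 * tri k), ← Real.rpow_add (by linarith),
      two_mul_tri]
    have : (Q : ℝ) ^ ε = (P : ℝ) ^ (ε / 2) := by
      rw [hPQ, ← Real.rpow_natCast_mul (by linarith)]
      congr 1; push_cast; ring
    rw [this, ← Real.rpow_add (by linarith)]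
    congr 1; push_cast; ring
  have h7 : (Q : ℝ) ^ 2 * (6 * Q) ^ (2 * tri k) ≤ 6 ^ (2 * tri k) * (P ^ (2 * tri k) * (Q : ℝ) ^ ε) := by
    have h8 : (Q : ℝ) ^ 2 ≤ Q ^ (2 * tri k) := by
      refine pow_le_pow_right₀ hQr ?_
      have := Nat.pos_of_ne_zero (tri_ne_zero (k := k) (by omega))
      omega
    have h9 : 1 ≤ (Q : ℝ) ^ ε := Real.one_le_rpow hQr hε.le
    calc (Q : ℝ) ^ 2 * (6 * Q) ^ (2 * tri k) ≤ Q ^ (2 * tri k) * (6 * Q) ^ (2 * tri k) := by gcongr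
      _ = 6 ^ (2 * tri k) * (P ^ (2 * tri k) * 1) := by
        rw [hPQ, mul_one, ← pow_mul, mul_pow, mul_comm 2 (2 * tri k), pow_mul]; ring
      _ ≤ _ := by gcongr
  have h8 : A * (P / 2) ^ (2 * tri k) ≤ 4 ^ (2 * tri k) * (16 * C + 6 ^ (2 * tri k)) *
      (Q : ℝ) ^ ε * (P / 2) ^ (2 * tri k) := by
    refine h5.trans ?_
    calc _ = 2 ^ (2 * tri k) * (16 * C * ((P : ℝ) ^ k * (P : ℝ) ^ ((k : ℝ) ^ 2 + ε / 2)) +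
          (Q : ℝ) ^ 2 * (6 * Q) ^ (2 * tri k)) := by ring
      _ ≤ 2 ^ (2 * tri k) * (16 * C * (P ^ (2 * tri k) * (Q : ℝ) ^ ε) +
          6 ^ (2 * tri k) * (P ^ (2 * tri k) * (Q : ℝ) ^ ε)) := by
        rw [h6]; gcongr
      _ = _ := by
        rw [show (4 : ℝ) = 2 * 2 by norm_num, mul_pow, div_pow]
        field_simp
  exact le_of_mul_le_mul_right h8 (by positivity)

theorem sum_fareyPairs {M : Type*} [AddCommMonoid M] (Q : ℕ) (F : ℕ → ℕ → M) :
    ∑ x ∈ fareyPairs Q, F x.1 x.2 =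
      ∑ q ∈ Icc 1 Q, ∑ a ∈ (Icc 1 q).filter (fun a => Nat.Coprime a q), F q a := by
  rw [fareyPairs, sum_sigma]

/-- The sum of the absolute values of the terms of the singular series of denominator `q`. -/
noncomputable def singBound (s k q : ℕ) : ℝ :=
  ∑ a ∈ (Icc 1 q).filter (fun a => Nat.Coprime a q), ‖gaussMean k q a‖ ^ s

theorem singBound_nonneg (s k q : ℕ) : 0 ≤ singBound s k q :=
  sum_nonneg fun _ _ => by positivity

theorem summable_singBound {k s : ℕ} (hk : 2 ≤ k) (hs : 2 * tri k + 1 ≤ s) :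
    Summable (singBound s k) := by
  obtain ⟨σ, hσ, hbd⟩ := exists_norm_gaussMean_le hk
  obtain ⟨C, hC0, hC⟩ := sum_fareyPairs_norm_gaussMean_le hk (half_pos hσ)
  set A : ℕ → ℝ := singBound (2 * tri k) k with hA
  have hA0 : ∀ q, 0 ≤ A q := singBound_nonneg _ _
  have h1 : LSeriesSummable (fun q => (A q : ℂ)) (σ : ℂ) := by
    refine LSeriesSummable_of_sum_norm_bigO (r := σ / 2) ?_ (by positivity) (by simpa using hσ)
    refine Asymptotics.IsBigO.of_bound C ?_
    filter_upwards [Filter.eventually_ge_atTop 1] with Q hQ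
    have h2 := hC Q hQ
    rw [sum_fareyPairs Q (fun q a => ‖gaussMean k q a‖ ^ (2 * tri k))] at h2
    rw [Real.norm_of_nonneg (sum_nonneg fun _ _ => norm_nonneg _),
      Real.norm_of_nonneg (by positivity)]
    refine le_trans (le_of_eq (sum_congr rfl fun q _ => ?_)) h2
    rw [Complex.norm_real, Real.norm_of_nonneg (hA0 q)]
    rfl
  refine Summable.of_nonneg_of_le (singBound_nonneg s k) (fun q => ?_) (h1.norm.mul_left 2)
  rcases Nat.eq_zero_or_pos q with rfl | hq
  · simp [singBound]
  have hqr : (0 : ℝ) < q := by exact_mod_cast hq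
  rw [LSeries.term_of_ne_zero hq.ne', norm_div, Complex.norm_real, Real.norm_of_nonneg (hA0 q),
    Complex.norm_natCast_cpow_of_pos hq, Complex.ofReal_re, hA, singBound, singBound, sum_div, mul_sum]
  refine sum_le_sum fun a ha => ?_
  have h2 := hbd q hq a (mem_filter.1 ha).2
  calc ‖gaussMean k q a‖ ^ s ≤ ‖gaussMean k q a‖ ^ (2 * tri k + 1) :=
        pow_le_pow_of_le_one (norm_nonneg _) (norm_gaussMean_le_one k q a) hs
    _ = ‖gaussMean k q a‖ ^ (2 * tri k) * ‖gaussMean k q a‖ := pow_succ _ _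
    _ ≤ ‖gaussMean k q a‖ ^ (2 * tri k) * (2 * (q : ℝ) ^ (-σ)) := by gcongr
    _ = _ := by rw [Real.rpow_neg hqr.le]; ring

/-- The part of the singular series with denominators up to `Q`. -/
noncomputable def singSum (s k Q n : ℕ) : ℂ :=
  ∑ x ∈ fareyPairs Q, gaussMean k x.1 x.2 ^ s * ec (-(n : ℝ) * ((x.2 : ℝ) / x.1))

theorem norm_singSum_le {k s : ℕ} (hk : 2 ≤ k) (hs : 2 * tri k + 1 ≤ s) (Q n : ℕ) :
    ‖singSum s k Q n‖ ≤ ∑' q, singBound s k q := by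
  refine le_trans ?_ ((summable_singBound hk hs).sum_le_tsum (Icc 1 Q)
    fun q _ => singBound_nonneg s k q)
  rw [singSum]
  refine (norm_sum_le _ _).trans ?_
  simp only [norm_mul, norm_ec, mul_one, norm_pow]
  rw [sum_fareyPairs Q (fun q a => ‖gaussMean k q a‖ ^ s)]
  rfl

theorem norm_singSeries_sub_singSum_le {k s : ℕ} (hk : 2 ≤ k) (hs : 2 * tri k + 1 ≤ s) (Q n : ℕ) :
    ‖singSeries s k n - singSum s k Q n‖ ≤ ∑' q, singBound s k (q + (Q + 1)) := by
  set T : ℕ → ℂ := fun q => ∑ a ∈ (Icc 1 q).filter (fun a => Nat.Coprime a q),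
    gaussMean k q a ^ s * ec (-(n : ℝ) * (a : ℝ) / q) with hT
  have hTb : ∀ q, ‖T q‖ ≤ singBound s k q := fun q => by
    refine (norm_sum_le _ _).trans (le_of_eq ?_)
    simp only [norm_mul, norm_ec, mul_one, norm_pow]
    rfl
  have hsum := summable_singBound hk hs
  have hTs : Summable T := Summable.of_norm_bounded hsum hTb
  have h1 : singSeries s k n = ∑' q, T q := rfl
  have h2 : singSum s k Q n = ∑ q ∈ range (Q + 1), T q := by
    rw [singSum, sum_fareyPairs Q (fun q a => gaussMean k q a ^ s * ec (-(n : ℝ) * ((a : ℝ) / q))),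
      sum_range_succ', ← sum_Icc_one_eq_sum_range]
    simp only [hT, mul_div_assoc]
    simp
  rw [h1, h2, ← hTs.sum_add_tsum_nat_add (Q + 1), add_sub_cancel_left]
  exact tsum_of_norm_bounded ((summable_nat_add_iff (Q + 1)).2 hsum).hasSum fun q => hTb _

theorem tendsto_tsum_singBound {k s : ℕ} :
    Filter.Tendsto (fun Q : ℕ => ∑' q, singBound s k (q + (Q + 1))) Filter.atTop (nhds 0) :=
  (tendsto_sum_nat_add (singBound s k)).comp (Filter.tendsto_add_atTop_nat 1)

end SingularSeries

section CircleMethod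

variable {k : ℕ}

theorem norm_pow_sub_pow_le_mul {a b : ℂ} {M : ℝ} (ha : ‖a‖ ≤ M) (hb : ‖b‖ ≤ M) (s : ℕ) :
    ‖a ^ s - b ^ s‖ ≤ s * M ^ (s - 1) * ‖a - b‖ := by
  have hM : 0 ≤ M := (norm_nonneg a).trans ha
  rw [← (Commute.all a b).geom_sum₂_mul, norm_mul]
  refine mul_le_mul_of_nonneg_right ?_ (norm_nonneg _)
  refine (norm_sum_le _ _).trans ?_
  rw [← nsmul_eq_mul, ← card_range s, ← sum_const, card_range]
  refine sum_le_sum fun i hi => ?_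
  have hi' := mem_range.1 hi
  calc ‖a ^ i * b ^ (s - 1 - i)‖ = ‖a‖ ^ i * ‖b‖ ^ (s - 1 - i) := by
        rw [norm_mul, norm_pow, norm_pow]
    _ ≤ M ^ i * M ^ (s - 1 - i) := by gcongr
    _ = M ^ (s - 1) := by rw [← pow_add]; congr 1; omega

theorem ec_neg_natCast_mul_add_intCast (n : ℕ) (x : ℝ) (m : ℤ) :
    ec (-(n : ℝ) * (x + m)) = ec (-(n : ℝ) * x) := by
  rw [← ec_add_intCast (-(n : ℝ) * x) (-(n : ℤ) * m)]
  congr 1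
  push_cast
  ring

/-- The contribution of the grid points outside the major arcs. -/
theorem sum_minor_norm_eval_powPoly_le (hk : 2 ≤ k) {s : ℕ} (hs : 2 * tri k + 1 ≤ s) {ε : ℝ}
    (hε : 0 < ε) : ∃ K : ℝ, 0 < K ∧ ∀ (P L : ℕ) (B D : ℝ), 1 ≤ P → tri k * P ^ k < L → 0 < B →
      (∀ α : ℝ, (P : ℝ) / B ≤ ‖(powPoly k P).eval (ec α)‖ → ∃ q : ℕ, 1 ≤ q ∧ (q : ℝ) ≤ D ∧
        ∃ m : ℤ, |q * α - m| ≤ D / (P : ℝ) ^ k) →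
      (∀ q, 1 ≤ q → q ≤ ⌊D⌋₊ → q ∣ L) →
      ∑ j ∈ range L \ majorGrid L ⌊D⌋₊ ⌊D / (P : ℝ) ^ k * L⌋₊,
        ‖(powPoly k P).eval (ec (j / L))‖ ^ s ≤ L * (K * ((P : ℝ) ^ (s - k) * ((P : ℝ) ^ ε / B))) := by
  obtain ⟨K, hK, hmean⟩ := sum_grid_powPoly_le (by omega : k ≠ 0) hε
  refine ⟨K, hK, fun P L B D hP hL hB hW hQL => ?_⟩
  have hPr : (1 : ℝ) ≤ P := by exact_mod_cast hP
  have hL0 : (0 : ℝ) < L := by exact_mod_cast (Nat.zero_le _).trans_lt hL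
  have hpt : ∀ j ∈ range L \ majorGrid L ⌊D⌋₊ ⌊D / (P : ℝ) ^ k * L⌋₊,
      ‖(powPoly k P).eval (ec (j / L))‖ ^ s ≤ (P : ℝ) ^ (s - (2 * tri k + 1)) * (P / B) *
        ‖(powPoly k P).eval (ec (j / L))‖ ^ (2 * tri k) := by
    intro j hj
    rw [mem_sdiff, mem_range] at hj
    have hsmall : ‖(powPoly k P).eval (ec (j / L))‖ ≤ P / B := by
      by_contra! hcon
      obtain ⟨q, hq1, hqD, m, hm⟩ := hW _ hcon.le
      refine hj.2 (mem_majorGrid hj.1 hQL hq1 (Nat.le_floor hqD) (m := m)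
        (Nat.lt_floor_add_one _) ?_)
      have hqr : (1 : ℝ) ≤ q := by exact_mod_cast hq1
      have h1 : (j : ℝ) / L - m / q = (q * (j / L) - m) / q := by field_simp
      rw [h1, abs_div, Nat.abs_cast]
      exact (div_le_self (abs_nonneg _) hqr).trans hm
    have e : s = (s - (2 * tri k + 1)) + 1 + 2 * tri k := by omega
    calc ‖(powPoly k P).eval (ec (j / L))‖ ^ s =
          ‖(powPoly k P).eval (ec (j / L))‖ ^ (s - (2 * tri k + 1)) *
            ‖(powPoly k P).eval (ec (j / L))‖ *
            ‖(powPoly k P).eval (ec (j / L))‖ ^ (2 * tri k) := by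
          rw [← pow_succ, ← pow_add, ← e]
      _ ≤ _ := by
        gcongr
        exact norm_eval_powPoly_le k P _
  refine (sum_le_sum hpt).trans ?_
  rw [← mul_sum]
  have h1 : ∑ j ∈ range L \ majorGrid L ⌊D⌋₊ ⌊D / (P : ℝ) ^ k * L⌋₊,
      ‖(powPoly k P).eval (ec (j / L))‖ ^ (2 * tri k) ≤ L * (K * (P : ℝ) ^ ((k : ℝ) ^ 2 + ε)) :=
    (sum_le_sum_of_subset_of_nonneg sdiff_subset fun _ _ _ => by positivity).trans (hmean P hP L hL)
  refine (mul_le_mul_of_nonneg_left h1 (by positivity)).trans (le_of_eq ?_)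
  have h2 : (P : ℝ) ^ ((k : ℝ) ^ 2 + ε) = (P : ℝ) ^ (k ^ 2) * (P : ℝ) ^ ε := by
    rw [Real.rpow_add (by linarith), ← Real.rpow_natCast _ (k ^ 2)]
    push_cast; rfl
  have h3 : (P : ℝ) ^ (s - k) = (P : ℝ) ^ (s - (2 * tri k + 1)) * P * (P : ℝ) ^ (k ^ 2) := by
    rw [← pow_succ, ← pow_add]
    congr 1
    have := two_mul_tri k
    have : k * (k + 1) = k ^ 2 + k := by ring
    omega
  rw [h2, h3]
  ring

/-- The truncated singular integral, as a grid sum near the origin, is close to the full one. -/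
theorem norm_sum_modelPoly_sub_le (hk : 2 ≤ k) {s n L R : ℕ} {Δ : ℝ} (hs : 2 * k ≤ s)
    (hL : s * n < L) (hΔ : 0 < Δ) (hR : Δ * L < R + 1) (hRL : 2 * R < L) :
    ‖∑ r ∈ Icc (-(R : ℤ)) R, (modelPoly k n).eval (ec (r / L)) ^ s * ec (-(n : ℝ) * (r / L)) -
      L * ((Real.Gamma (1 + 1 / (k : ℝ)) ^ s * risingCoeff ((s : ℝ) / k) n : ℝ) : ℂ)‖ ≤
      (8 * (1 / Δ) ^ (1 / (k : ℝ))) ^ (s - 2 * k) *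
        (L * ((Real.Gamma (1 + 1 / (k : ℝ)) ^ k) ^ 2 * (k * n + 1))) := by
  have hL0 : 0 < L := by omega
  have hnL : n < L := lt_of_le_of_lt (Nat.le_mul_of_pos_left n (by omega)) hL
  have hdvd : ∀ q, 1 ≤ q → q ≤ 1 → q ∣ L := fun q h1 h2 => by
    rw [le_antisymm h2 h1]; exact one_dvd L
  set F : ℝ → ℂ := fun β => (modelPoly k n).eval (ec β) ^ s * ec (-(n : ℝ) * β) with hF
  have hper : ∀ (x : ℝ) (m : ℤ), F (x + m) = F x := fun x m => by
    simp only [hF, ec_add_intCast, ec_neg_natCast_mul_add_intCast]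
  have hnear : ∑ r ∈ Icc (-(R : ℤ)) R, F (r / L) = ∑ j ∈ majorGrid L 1 R, F (j / L) := by
    rw [sum_majorGrid hL0 hdvd (by omega) hper]
    have h1 : fareyPairs 1 = {⟨1, 1⟩} := by decide
    rw [h1, sum_singleton]
    refine sum_congr rfl fun r _ => ?_
    have := hper (r / L) 1
    rw [← this]
    congr 1
    push_cast
    ring
  have hfull : ∑ j ∈ range L, F (j / L) =
      L * ((Real.Gamma (1 + 1 / (k : ℝ)) ^ s * risingCoeff ((s : ℝ) / k) n : ℝ) : ℂ) := by
    rw [← coeff_modelPoly_pow_self, ← sum_grid_eval_mul_ec hnL]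
    · simp only [hF, Polynomial.eval_pow]
    · exact (Polynomial.natDegree_pow_le.trans
        (Nat.mul_le_mul_left s (natDegree_modelPoly_le n))).trans_lt hL
  have hsplit := sum_sdiff (f := fun j : ℕ => F (j / L)) (majorGrid_subset hL0 1 R)
  change ‖∑ r ∈ Icc (-(R : ℤ)) R, F (r / L) - _‖ ≤ _
  rw [hnear, ← hfull, ← hsplit, norm_sub_rev, add_sub_cancel_right]
  refine (norm_sum_le _ _).trans ?_
  have hpt : ∀ j ∈ range L \ majorGrid L 1 R, ‖F (j / L)‖ ≤
      (8 * (1 / Δ) ^ (1 / (k : ℝ))) ^ (s - 2 * k) * ‖(modelPoly k n).eval (ec (j / L))‖ ^ (2 * k) := by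
    intro j hj
    rw [mem_sdiff, mem_range] at hj
    set β : ℝ := (j : ℝ) / L - round ((j : ℝ) / L) with hβ
    have hβ1 : |β| ≤ 1 / 2 := abs_sub_round _
    have hβΔ : Δ < |β| := by
      by_contra! hcon
      refine hj.2 (mem_majorGrid hj.1 hdvd le_rfl le_rfl (m := round ((j : ℝ) / L)) hR ?_)
      simpa using hcon
    have hβ0 : β ≠ 0 := fun h => by rw [h, abs_zero] at hβΔ; linarith
    have he : ec ((j : ℝ) / L) = ec β := by
      rw [← ec_add_intCast β (round ((j : ℝ) / L)), hβ, sub_add_cancel]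
    have hv : ‖(modelPoly k n).eval (ec β)‖ ≤ 8 * (1 / Δ) ^ (1 / (k : ℝ)) := by
      refine (norm_eval_modelPoly_le_of_ne_zero hk n hβ0 hβ1).trans ?_
      gcongr
    rw [hF]
    simp only
    rw [norm_mul, norm_ec, mul_one, norm_pow, he]
    conv_lhs => rw [← Nat.sub_add_cancel hs, pow_add]
    gcongr
  refine (sum_le_sum hpt).trans ?_
  rw [← mul_sum]
  have hkn : k * n < L := lt_of_le_of_lt (Nat.mul_le_mul_right n (by omega)) hL
  have h1 := sum_grid_modelPoly_le hk hkn
  refine mul_le_mul_of_nonneg_left (le_trans ?_ h1) (by positivity)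
  exact sum_le_sum_of_subset_of_nonneg sdiff_subset fun _ _ _ => by positivity

end CircleMethod

section Assembly

variable {k : ℕ}

/-- On the major arcs the generating function may be replaced by its local approximation. -/
theorem norm_sum_major_sub_le (hk : 2 ≤ k) {s : ℕ} (hs : k + 1 ≤ s) {n P L : ℕ} {D : ℝ}
    (hP : 1 ≤ P) (hPn : P ^ k ≤ n) (hnP : n < (P + 1) ^ k) (hD : 1 ≤ D) (hDP : 2 * D ^ 3 < (P : ℝ) ^ k)
    (hnL : n < L) (hQL : ∀ q, 1 ≤ q → q ≤ ⌊D⌋₊ → q ∣ L) :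
    ‖∑ j ∈ majorGrid L ⌊D⌋₊ ⌊D / (P : ℝ) ^ k * L⌋₊,
        (powPoly k P).eval (ec (j / L)) ^ s * ec (-(n : ℝ) * (j / L)) -
      singSum s k ⌊D⌋₊ n * ∑ r ∈ Icc (-(⌊D / (P : ℝ) ^ k * L⌋₊ : ℤ)) ⌊D / (P : ℝ) ^ k * L⌋₊,
        (modelPoly k n).eval (ec (r / L)) ^ s * ec (-(n : ℝ) * (r / L))‖ ≤
      L * (s * 2 ^ (s - 1) * (72 * 2 ^ k) * ((P : ℝ) ^ (s - k) * (D ^ 5 / P))) := by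
  have hPr : (1 : ℝ) ≤ P := by exact_mod_cast hP
  have hL0 : 0 < L := by omega
  have hLr : (0 : ℝ) < L := by exact_mod_cast hL0
  set Q := ⌊D⌋₊ with hQ
  have hQD : (Q : ℝ) ≤ D := Nat.floor_le (by linarith)
  set Δ : ℝ := D / (P : ℝ) ^ k with hΔ
  have hΔ0 : 0 < Δ := by positivity
  set R := ⌊Δ * L⌋₊ with hR
  have hRΔ : (R : ℝ) ≤ Δ * L := Nat.floor_le (by positivity)
  have hΔL : 1 ≤ Δ * L := by
    rw [hΔ, div_mul_eq_mul_div, one_le_div (by positivity)]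
    have : (P : ℝ) ^ k ≤ L := by exact_mod_cast hPn.trans hnL.le
    nlinarith
  have hRL : 2 * (R * Q ^ 2) < L := by
    have h1 : (2 : ℝ) * (R * Q ^ 2) < L := by
      calc (2 : ℝ) * (R * Q ^ 2) ≤ 2 * (Δ * L * D ^ 2) := by gcongr
        _ = (2 * D ^ 3) / (P : ℝ) ^ k * L := by rw [hΔ]; ring
        _ < 1 * L := by
          gcongr
          rwa [div_lt_one (by positivity)]
        _ = L := one_mul _
    exact_mod_cast h1
  have hnr : (n : ℝ) ≤ 2 ^ k * (P : ℝ) ^ k := by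
    rw [← mul_pow]
    calc (n : ℝ) ≤ ((P : ℝ) + 1) ^ k := by exact_mod_cast hnP.le
      _ ≤ _ := by gcongr; linarith
  have hv : ∀ β, ‖(modelPoly k n).eval (ec β)‖ ≤ 2 * P := fun β => by
    refine (norm_eval_modelPoly_le hk n β).trans ?_
    rw [one_div, Real.rpow_inv_le_iff_of_pos (by positivity) (by positivity) (by positivity),
      Real.rpow_natCast]
    calc (n : ℝ) + 1 ≤ ((P : ℝ) + 1) ^ k := by exact_mod_cast hnP
      _ ≤ _ := by gcongr; linarith
  rw [sum_majorGrid (F := fun α => (powPoly k P).eval (ec α) ^ s * ec (-(n : ℝ) * α)) hL0 hQL hRL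
    (fun x m => by simp only [ec_add_intCast, ec_neg_natCast_mul_add_intCast]), singSum, sum_mul,
    ← sum_sub_distrib]
  have hpt : ∀ x ∈ fareyPairs Q, ∀ r ∈ Icc (-(R : ℤ)) R,
      ‖(powPoly k P).eval (ec ((x.2 : ℝ) / x.1 + r / L)) ^ s *
          ec (-(n : ℝ) * ((x.2 : ℝ) / x.1 + r / L)) -
        gaussMean k x.1 x.2 ^ s * ec (-(n : ℝ) * ((x.2 : ℝ) / x.1)) *
          ((modelPoly k n).eval (ec (r / L)) ^ s * ec (-(n : ℝ) * (r / L)))‖ ≤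
      s * (2 * P) ^ (s - 1) * (24 * 2 ^ k * D ^ 2) := by
    intro x hx r hr
    have hx' := mem_fareyPairs.1 hx
    have hxD : (x.1 : ℝ) ≤ D := le_trans (by exact_mod_cast hx'.1.2) hQD
    have hβ : |(r : ℝ) / L| ≤ Δ := by
      have hr' : |(r : ℝ)| ≤ R := by
        rw [mem_Icc, ← abs_le] at hr
        exact_mod_cast hr
      rw [abs_div, Nat.abs_cast, div_le_iff₀ hLr]
      exact hr'.trans hRΔ
    have e : (powPoly k P).eval (ec ((x.2 : ℝ) / x.1 + r / L)) ^ s *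
          ec (-(n : ℝ) * ((x.2 : ℝ) / x.1 + r / L)) -
        gaussMean k x.1 x.2 ^ s * ec (-(n : ℝ) * ((x.2 : ℝ) / x.1)) *
          ((modelPoly k n).eval (ec (r / L)) ^ s * ec (-(n : ℝ) * (r / L))) =
        ((powPoly k P).eval (ec ((x.2 : ℝ) / x.1 + r / L)) ^ s -
          (gaussMean k x.1 x.2 * (modelPoly k n).eval (ec (r / L))) ^ s) *
          ec (-(n : ℝ) * ((x.2 : ℝ) / x.1 + r / L)) := by
      rw [mul_add, ec_add (-(n : ℝ) * ((x.2 : ℝ) / x.1)), mul_pow]; ring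
    rw [e, norm_mul, norm_ec, mul_one]
    have h1 : ‖(powPoly k P).eval (ec ((x.2 : ℝ) / x.1 + r / L))‖ ≤ 2 * P :=
      (norm_eval_powPoly_le k P _).trans (by linarith)
    have h2 : ‖gaussMean k x.1 x.2 * (modelPoly k n).eval (ec (r / L))‖ ≤ 2 * P := by
      rw [norm_mul]
      calc _ ≤ 1 * (2 * (P : ℝ)) := by
            gcongr
            · exact norm_gaussMean_le_one k x.1 x.2
            · exact hv _
        _ = _ := one_mul _
    refine (norm_pow_sub_pow_le_mul h1 h2 s).trans ?_
    gcongr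
    refine (norm_eval_powPoly_sub_le hk hPn hnP hx'.1.1 x.2 ((r : ℝ) / L)).trans ?_
    have hpi := Real.pi_lt_d2
    have hpi0 := Real.pi_pos
    have h3 : (n : ℝ) * (2 * Real.pi * |(r : ℝ) / L|) ≤ 7 * (2 ^ k * D) := by
      calc (n : ℝ) * (2 * Real.pi * |(r : ℝ) / L|) ≤ (2 ^ k * (P : ℝ) ^ k) * (7 * Δ) := by
            gcongr
            linarith
        _ = 7 * (2 ^ k * D) := by rw [hΔ]; field_simp
    have h4 : (1 : ℝ) ≤ 2 ^ k * D := by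
      have : (1 : ℝ) ≤ 2 ^ k := one_le_pow₀ (by norm_num)
      nlinarith
    calc 3 * (x.1 : ℝ) * (1 + n * (2 * Real.pi * |(r : ℝ) / L|)) ≤ 3 * D * (8 * (2 ^ k * D)) := by
          gcongr
          linarith
      _ = _ := by ring
  refine (norm_sum_le _ _).trans ?_
  have hcard : (#(Icc (-(R : ℤ)) R) : ℝ) ≤ 3 * (Δ * L) := by
    rw [Int.card_Icc, show (R : ℤ) + 1 - -(R : ℤ) = ((2 * R + 1 : ℕ) : ℤ) by push_cast; ring,
      Int.toNat_natCast]
    push_cast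
    linarith
  have hinner : ∀ x ∈ fareyPairs Q, ‖∑ r ∈ Icc (-(R : ℤ)) R,
      (powPoly k P).eval (ec ((x.2 : ℝ) / x.1 + r / L)) ^ s *
          ec (-(n : ℝ) * ((x.2 : ℝ) / x.1 + r / L)) -
        gaussMean k x.1 x.2 ^ s * ec (-(n : ℝ) * ((x.2 : ℝ) / x.1)) *
          ∑ r ∈ Icc (-(R : ℤ)) R, (modelPoly k n).eval (ec (r / L)) ^ s * ec (-(n : ℝ) * (r / L))‖ ≤
      3 * (Δ * L) * (s * (2 * P) ^ (s - 1) * (24 * 2 ^ k * D ^ 2)) := by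
    intro x hx
    rw [mul_sum, ← sum_sub_distrib]
    refine (norm_sum_le _ _).trans ((sum_le_sum (hpt x hx)).trans ?_)
    rw [sum_const, nsmul_eq_mul]
    gcongr
  refine (sum_le_sum hinner).trans ?_
  rw [sum_const, nsmul_eq_mul]
  have hfc : (#(fareyPairs Q) : ℝ) ≤ D ^ 2 := by
    calc (#(fareyPairs Q) : ℝ) ≤ (Q : ℝ) ^ 2 := by exact_mod_cast card_fareyPairs_le Q
      _ ≤ D ^ 2 := by gcongr
  calc _ ≤ D ^ 2 * (3 * (Δ * L) * (s * (2 * P) ^ (s - 1) * (24 * 2 ^ k * D ^ 2))) := by gcongr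
    _ = _ := by
      have h5 : (P : ℝ) ^ (s - 1) * P = (P : ℝ) ^ (s - k) * (P : ℝ) ^ k := by
        rw [← pow_succ, ← pow_add]; congr 1; omega
      have h6 : (P : ℝ) ^ (s - 1) = (P : ℝ) ^ (s - k) * (P : ℝ) ^ k / P := by
        rw [← h5]; field_simp
      rw [mul_pow, h6, hΔ]
      field_simp
      ring

/-- Quantitative asymptotic formula, given a Weyl-type inequality at the point `P`. -/
theorem norm_Rcount_sub_le (hk : 2 ≤ k) {s : ℕ} (hs : 2 * tri k + 1 ≤ s) {ε : ℝ} (hε : 0 < ε) :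
    ∃ K : ℝ, 0 < K ∧ ∀ (n P : ℕ) (B D : ℝ), 1 ≤ P → P ^ k ≤ n → n < (P + 1) ^ k → 0 < B → 1 ≤ D →
      2 * D ^ 3 < (P : ℝ) ^ k →
      (∀ α : ℝ, (P : ℝ) / B ≤ ‖(powPoly k P).eval (ec α)‖ → ∃ q : ℕ, 1 ≤ q ∧ (q : ℝ) ≤ D ∧
        ∃ m : ℤ, |q * α - m| ≤ D / (P : ℝ) ^ k) →
      ‖(Rcount s k n : ℂ) - singSum s k ⌊D⌋₊ n *
          ((Real.Gamma (1 + 1 / (k : ℝ)) ^ s * risingCoeff ((s : ℝ) / k) n : ℝ) : ℂ)‖ ≤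
        K * ((P : ℝ) ^ (s - k) * ((P : ℝ) ^ ε / B + D ^ 5 / P + 1 / D)) := by
  obtain ⟨K₁, hK₁, hminor⟩ := sum_minor_norm_eval_powPoly_le hk hs hε
  have htri : 2 * tri k = k * k + k := by rw [two_mul_tri]; ring
  have hkk : 2 * k ≤ k * k := Nat.mul_le_mul_right k hk
  set K₂ : ℝ := s * 2 ^ (s - 1) * (72 * 2 ^ k) with hK₂
  set S : ℝ := ∑' q, singBound s k q with hS
  have hS0 : 0 ≤ S := tsum_nonneg (singBound_nonneg s k)
  set G : ℝ := (Real.Gamma (1 + 1 / (k : ℝ)) ^ k) ^ 2 with hG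
  set K₃ : ℝ := S * (8 ^ (s - 2 * k) * (G * (k * 2 ^ k + 1))) with hK₃
  have hK₂0 : 0 ≤ K₂ := by positivity
  have hK₃0 : 0 ≤ K₃ := by positivity
  refine ⟨K₁ + K₂ + K₃, by positivity, fun n P B D hP hPn hnP hB hD hDP hW => ?_⟩
  have hPr : (1 : ℝ) ≤ P := by exact_mod_cast hP
  set L := (⌊D⌋₊).factorial * ((s + 1) * (n + 1)) with hLdef
  have hLs : (s + 1) * (n + 1) ≤ L := Nat.le_mul_of_pos_left _ (Nat.factorial_pos _)
  have hsnL : s * n < L := by nlinarith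
  have hnL : n < L := by nlinarith
  have hL0 : 0 < L := by omega
  have hLr : (0 : ℝ) < L := by exact_mod_cast hL0
  have hsPL : s * P ^ k < L := (Nat.mul_le_mul_left s hPn).trans_lt hsnL
  have htL : tri k * P ^ k < L := (Nat.mul_le_mul_right _ (by omega)).trans_lt hsPL
  have hQL : ∀ q, 1 ≤ q → q ≤ ⌊D⌋₊ → q ∣ L := fun q h1 h2 =>
    (Nat.dvd_factorial h1 h2).trans (Dvd.intro _ rfl)
  set Δ : ℝ := D / (P : ℝ) ^ k with hΔ
  have hΔ0 : 0 < Δ := by positivity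
  set R := ⌊Δ * L⌋₊ with hR
  set F : ℕ → ℂ := fun j => (powPoly k P).eval (ec (j / L)) ^ s * ec (-(n : ℝ) * (j / L)) with hF
  set J : ℂ := ∑ r ∈ Icc (-(R : ℤ)) R,
    (modelPoly k n).eval (ec (r / L)) ^ s * ec (-(n : ℝ) * (r / L)) with hJ
  set V : ℂ := ((Real.Gamma (1 + 1 / (k : ℝ)) ^ s * risingCoeff ((s : ℝ) / k) n : ℝ) : ℂ) with hV
  set M := majorGrid L ⌊D⌋₊ R with hM
  have hcount : (L : ℂ) * Rcount s k n = ∑ j ∈ range L \ M, F j + ∑ j ∈ M, F j := by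
    rw [sum_sdiff (majorGrid_subset hL0 _ _), Rcount_eq_coeff hnP, ← sum_grid_eval_mul_ec hnL]
    · simp only [hF, Polynomial.eval_pow]
    · exact (Polynomial.natDegree_pow_le.trans
        (Nat.mul_le_mul_left s (natDegree_powPoly_le k P))).trans_lt hsPL
  have h1 : ‖∑ j ∈ range L \ M, F j‖ ≤ L * (K₁ * ((P : ℝ) ^ (s - k) * ((P : ℝ) ^ ε / B))) := by
    refine (norm_sum_le _ _).trans ?_
    simp only [hF, norm_mul, norm_ec, mul_one, norm_pow]
    exact hminor P L B D hP htL hB hW hQL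
  have h2 : ‖∑ j ∈ M, F j - singSum s k ⌊D⌋₊ n * J‖ ≤
      L * (K₂ * ((P : ℝ) ^ (s - k) * (D ^ 5 / P))) :=
    norm_sum_major_sub_le hk (by omega) hP hPn hnP hD hDP hnL hQL
  have hRL : 2 * R < L := by
    have h3 : (R : ℝ) ≤ Δ * L := Nat.floor_le (by positivity)
    have h4 : 2 * Δ < 1 := by
      rw [hΔ, ← mul_div_assoc, div_lt_one (by positivity)]
      have : D ≤ D ^ 3 := le_self_pow₀ hD (by norm_num)
      linarith
    have : (2 : ℝ) * R < L := by nlinarith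
    exact_mod_cast this
  have h3 : ‖J - L * V‖ ≤ L * ((8 ^ (s - 2 * k) * (G * (k * 2 ^ k + 1))) *
      ((P : ℝ) ^ (s - k) * (1 / D))) := by
    refine (norm_sum_modelPoly_sub_le hk (by omega) hsnL hΔ0 (Nat.lt_floor_add_one _) hRL).trans ?_
    have hroot : (1 / Δ) ^ (1 / (k : ℝ)) = P * (1 / D) ^ (1 / (k : ℝ)) := by
      have : 1 / Δ = (P : ℝ) ^ k * (1 / D) := by rw [hΔ]; field_simp
      rw [this, Real.mul_rpow (by positivity) (by positivity), one_div (k : ℝ),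
        Real.pow_rpow_inv_natCast (by positivity) (by omega)]
    have hDpow : ((1 / D) ^ (1 / (k : ℝ))) ^ (s - 2 * k) ≤ 1 / D := by
      have hD1 : 1 / D ≤ 1 := by rw [div_le_one (by linarith)]; exact hD
      have h4 : ((1 / D) ^ (1 / (k : ℝ))) ^ k = 1 / D := by
        rw [one_div (k : ℝ), Real.rpow_inv_natCast_pow (by positivity) (by omega)]
      calc _ ≤ ((1 / D) ^ (1 / (k : ℝ))) ^ k :=
            pow_le_pow_of_le_one (by positivity) (Real.rpow_le_one (by positivity) hD1
              (by positivity)) (by omega)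
        _ = _ := h4
    have hnr : (k : ℝ) * n + 1 ≤ (k * 2 ^ k + 1) * (P : ℝ) ^ k := by
      have h5 : (n : ℝ) ≤ 2 ^ k * (P : ℝ) ^ k := by
        rw [← mul_pow]
        calc (n : ℝ) ≤ ((P : ℝ) + 1) ^ k := by exact_mod_cast hnP.le
          _ ≤ _ := by gcongr; linarith
      have h6 : (1 : ℝ) ≤ (P : ℝ) ^ k := one_le_pow₀ hPr
      have : (k : ℝ) * n ≤ k * (2 ^ k * (P : ℝ) ^ k) := by gcongr
      linarith
    rw [hroot, mul_pow, mul_pow]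
    calc _ ≤ 8 ^ (s - 2 * k) * ((P : ℝ) ^ (s - 2 * k) * (1 / D)) *
          (L * (G * ((k * 2 ^ k + 1) * (P : ℝ) ^ k))) := by
          gcongr
      _ = _ := by
        have : (P : ℝ) ^ (s - k) = (P : ℝ) ^ (s - 2 * k) * (P : ℝ) ^ k := by
          rw [← pow_add]; congr 1; omega
        rw [this]; ring
  have h4 : ‖singSum s k ⌊D⌋₊ n‖ ≤ S := norm_singSum_le hk hs _ n
  have e : (L : ℂ) * ((Rcount s k n : ℂ) - singSum s k ⌊D⌋₊ n * V) = ∑ j ∈ range L \ M, F j +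
      (∑ j ∈ M, F j - singSum s k ⌊D⌋₊ n * J) + singSum s k ⌊D⌋₊ n * (J - L * V) := by
    rw [mul_sub, hcount]; ring
  have h5 : L * ‖(Rcount s k n : ℂ) - singSum s k ⌊D⌋₊ n * V‖ ≤
      L * (K₁ * ((P : ℝ) ^ (s - k) * ((P : ℝ) ^ ε / B)) + K₂ * ((P : ℝ) ^ (s - k) * (D ^ 5 / P)) +
        K₃ * ((P : ℝ) ^ (s - k) * (1 / D))) := by
    have h6 : ‖singSum s k ⌊D⌋₊ n * (J - L * V)‖ ≤ L * (K₃ * ((P : ℝ) ^ (s - k) * (1 / D))) := by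
      rw [norm_mul]
      refine (mul_le_mul h4 h3 (norm_nonneg _) hS0).trans (le_of_eq ?_)
      rw [hK₃]; ring
    have h7 := congrArg norm e
    rw [norm_mul, Complex.norm_natCast] at h7
    rw [h7]
    refine (norm_add₃_le).trans ?_
    linarith
  refine (le_of_mul_le_mul_left h5 hLr).trans ?_
  have a1 : 0 ≤ (P : ℝ) ^ (s - k) * ((P : ℝ) ^ ε / B) := by positivity
  have a2 : 0 ≤ (P : ℝ) ^ (s - k) * (D ^ 5 / P) := by positivity
  have a3 : 0 ≤ (P : ℝ) ^ (s - k) * (1 / D) := by positivity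
  rw [mul_add ((P : ℝ) ^ (s - k)), mul_add ((P : ℝ) ^ (s - k))]
  have b1 := mul_le_mul_of_nonneg_right (by linarith : K₁ ≤ K₁ + K₂ + K₃) a1
  have b2 := mul_le_mul_of_nonneg_right (by linarith : K₂ ≤ K₁ + K₂ + K₃) a2
  have b3 := mul_le_mul_of_nonneg_right (by linarith : K₃ ≤ K₁ + K₂ + K₃) a3
  linarith

end Assembly

section AsymptoticFormula

open Filter Topology

/-- The asymptotic formula in Waring's problem holds for `k (k + 1) + 1` or more variables. -/
theorem asympFormula_of_le {k s : ℕ} (hk : 2 ≤ k) (hs : k * (k + 1) + 1 ≤ s) :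
    AsympFormula s k := by
  rw [← two_mul_tri] at hs
  have hks : k ≤ s := by
    have := two_mul_tri k
    have : k * 1 ≤ k * (k + 1) := Nat.mul_le_mul_left k (by omega)
    omega
  have hkr : (0 : ℝ) < k := by positivity
  obtain ⟨C, hC⟩ := exists_approx_of_large_powPoly hk
  set σ : ℝ := 1 / (6 * (C + 1)) with hσ
  have hσ0 : 0 < σ := by positivity
  obtain ⟨K, hK0, hK⟩ := norm_Rcount_sub_le hk hs (half_pos hσ0)
  choose P hPn hnP using exists_pow_le_lt_succ_pow (k := k) (by omega)
  have hPtend : Tendsto P atTop atTop := by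
    refine tendsto_atTop.2 fun b => ?_
    filter_upwards [eventually_ge_atTop (b ^ k)] with n hn
    have := lt_of_pow_lt_pow_left₀ k (by omega) (hn.trans_lt (hnP n))
    omega
  have hPreal : Tendsto (fun n => (P n : ℝ)) atTop atTop :=
    tendsto_natCast_atTop_atTop.comp hPtend
  set S : ℝ := ∑' q, singBound s k q with hS
  set G : ℝ := Real.Gamma (1 + 1 / (k : ℝ)) ^ s with hG
  have hG0 : 0 < G := pow_pos (Gamma_one_add_pos k) s
  have hsk : 0 < (s : ℝ) / k := by
    have : 0 < s := by omega
    positivity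
  set H : ℝ := (Real.Gamma ((s : ℝ) / k))⁻¹ with hH
  have hH0 : 0 < H := inv_pos.2 (Real.Gamma_pos_of_pos hsk)
  set c : ℕ → ℝ := fun n => risingCoeff ((s : ℝ) / k) n with hc
  set δ : ℕ → ℝ := fun n => K * ((P n : ℝ) ^ (-(σ / 2)) + (P n : ℝ) ^ (-(1 / 6 : ℝ)) +
      (P n : ℝ) ^ (-(1 / 6 : ℝ))) + S * (G * |c n * (n : ℝ) ^ (1 - (s : ℝ) / k) - H|) +
      G * H * ∑' q, singBound s k (q + (⌊(P n : ℝ) ^ (1 / 6 : ℝ)⌋₊ + 1)) with hδ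
  have hδ0 : Tendsto δ atTop (𝓝 0) := by
    have h1 := (tendsto_rpow_neg_atTop (half_pos hσ0)).comp hPreal
    have h2 := (tendsto_rpow_neg_atTop (by norm_num : (0 : ℝ) < 1 / 6)).comp hPreal
    have h3 : Tendsto (fun n => |c n * (n : ℝ) ^ (1 - (s : ℝ) / k) - H|) atTop (𝓝 0) := by
      have := ((tendsto_risingCoeff_mul_rpow hsk).sub_const H).abs
      rwa [← hH, sub_self, abs_zero] at this
    have h4 := (tendsto_tsum_singBound (k := k) (s := s)).comp
      (tendsto_nat_floor_atTop.comp
        ((tendsto_rpow_atTop (by norm_num : (0 : ℝ) < 1 / 6)).comp hPreal))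
    have := ((((h1.add h2).add h2).const_mul K).add ((h3.const_mul G).const_mul S)).add
      (h4.const_mul (G * H))
    simp only [add_zero, mul_zero] at this
    exact this
  have hbound : ∀ᶠ n : ℕ in atTop, ‖(Rcount s k n : ℂ) -
      (((Real.Gamma (1 + 1/(k:ℝ)))^s / Real.Gamma ((s:ℝ)/(k:ℝ)) : ℝ) : ℂ) *
        singSeries s k n * (((n:ℝ) ^ ((s:ℝ)/(k:ℝ) - 1) : ℝ) : ℂ)‖ ≤
      δ n * (n : ℝ) ^ ((s : ℝ) / k - 1) := by
    filter_upwards [eventually_ge_atTop 1, hPtend.eventually_ge_atTop 3,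
      ((tendsto_rpow_atTop hσ0).comp hPreal).eventually_ge_atTop 2] with n hn hP3 hB
    simp only [Function.comp_apply] at hB
    have hn0 : (0 : ℝ) < n := by exact_mod_cast hn
    have hP3r : (3 : ℝ) ≤ P n := by exact_mod_cast hP3
    have hP0 : (0 : ℝ) < P n := by linarith
    set D : ℝ := (P n : ℝ) ^ (1 / 6 : ℝ) with hD
    set N : ℝ := (n : ℝ) ^ ((s : ℝ) / k - 1) with hN
    have hN0 : 0 < N := by positivity
    have hBD : ((P n : ℝ) ^ σ) ^ (C + 1) = D := by
      rw [← Real.rpow_mul_natCast hP0.le, hD, hσ]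
      congr 1
      push_cast
      field_simp
    have hBC : ((P n : ℝ) ^ σ) ^ C ≤ D := by
      rw [← hBD]
      exact pow_le_pow_right₀ (by linarith) (Nat.le_succ C)
    have hD1 : 1 ≤ D := Real.one_le_rpow (by linarith) (by norm_num)
    have hD3 : 2 * D ^ 3 < (P n : ℝ) ^ k := by
      have h1 : D ^ 3 ≤ P n := by
        rw [hD, ← Real.rpow_mul_natCast hP0.le]
        conv_rhs => rw [← Real.rpow_one (P n : ℝ)]
        exact Real.rpow_le_rpow_of_exponent_le (by linarith) (by norm_num)
      have h2 : (P n : ℝ) ^ 2 ≤ (P n : ℝ) ^ k := pow_le_pow_right₀ (by linarith) hk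
      nlinarith
    have hmain := hK n (P n) ((P n : ℝ) ^ σ) D (by omega) (hPn n) (hnP n) (by positivity) hD1 hD3
      (fun α hα => by
        obtain ⟨q, hq1, hq2, m, hm⟩ := hC _ hB (P n) (by omega) α hα
        exact ⟨q, hq1, hq2.trans hBC, m, hm.trans (by gcongr)⟩)
    have hPN : (P n : ℝ) ^ (s - k) ≤ N := by
      have h1 : (P n : ℝ) ^ (s - k) = ((P n : ℝ) ^ k) ^ ((s : ℝ) / k - 1) := by
        rw [← Real.rpow_natCast_mul hP0.le, ← Real.rpow_natCast, Nat.cast_sub hks]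
        congr 1
        field_simp
      rw [h1, hN]
      refine Real.rpow_le_rpow (by positivity) (by exact_mod_cast hPn n) ?_
      rw [sub_nonneg, one_le_div hkr]
      exact_mod_cast hks
    have e1 : (P n : ℝ) ^ (σ / 2) / (P n : ℝ) ^ σ = (P n : ℝ) ^ (-(σ / 2)) := by
      rw [← Real.rpow_sub hP0]; congr 1; ring
    have e2 : D ^ 5 / P n = (P n : ℝ) ^ (-(1 / 6 : ℝ)) := by
      rw [hD, ← Real.rpow_mul_natCast hP0.le, ← Real.rpow_sub_one hP0.ne']
      norm_num
    have e3 : 1 / D = (P n : ℝ) ^ (-(1 / 6 : ℝ)) := by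
      rw [hD, Real.rpow_neg hP0.le, one_div]
    rw [e1, e2, e3] at hmain
    have herr : ‖(Rcount s k n : ℂ) - singSum s k ⌊D⌋₊ n * ((G * c n : ℝ) : ℂ)‖ ≤
        K * ((P n : ℝ) ^ (-(σ / 2)) + (P n : ℝ) ^ (-(1 / 6 : ℝ)) + (P n : ℝ) ^ (-(1 / 6 : ℝ))) * N := by
      refine hmain.trans ?_
      rw [mul_comm ((P n : ℝ) ^ (s - k)), ← mul_assoc]
      gcongr
    have hcn : c n - H * N = (c n * (n : ℝ) ^ (1 - (s : ℝ) / k) - H) * N := by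
      rw [sub_mul, mul_assoc, hN, ← Real.rpow_add hn0]
      simp
    have hmid : ‖singSum s k ⌊D⌋₊ n * ((G * (c n - H * N) : ℝ) : ℂ)‖ ≤
        S * (G * |c n * (n : ℝ) ^ (1 - (s : ℝ) / k) - H|) * N := by
      rw [norm_mul, Complex.norm_real, Real.norm_eq_abs, abs_mul, abs_of_pos hG0, hcn, abs_mul,
        abs_of_pos hN0, mul_assoc S, mul_assoc G]
      gcongr
      exact norm_singSum_le hk hs _ n
    have htail : ‖(singSeries s k n - singSum s k ⌊D⌋₊ n) * ((G * H * N : ℝ) : ℂ)‖ ≤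
        G * H * (∑' q, singBound s k (q + (⌊D⌋₊ + 1))) * N := by
      rw [norm_mul, Complex.norm_real, Real.norm_of_nonneg (by positivity)]
      have := norm_singSeries_sub_singSum_le hk hs ⌊D⌋₊ n
      calc _ ≤ (∑' q, singBound s k (q + (⌊D⌋₊ + 1))) * (G * H * N) := by gcongr
        _ = _ := by ring
    have e : (Rcount s k n : ℂ) - ((G / Real.Gamma ((s:ℝ)/(k:ℝ)) : ℝ) : ℂ) *
        singSeries s k n * (N : ℂ) =
        ((Rcount s k n : ℂ) - singSum s k ⌊D⌋₊ n * ((G * c n : ℝ) : ℂ)) +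
          singSum s k ⌊D⌋₊ n * ((G * (c n - H * N) : ℝ) : ℂ) -
          (singSeries s k n - singSum s k ⌊D⌋₊ n) * ((G * H * N : ℝ) : ℂ) := by
      rw [div_eq_mul_inv, ← hH]
      push_cast
      ring
    rw [e]
    refine (norm_sub_le _ _).trans ?_
    have := norm_add_le ((Rcount s k n : ℂ) - singSum s k ⌊D⌋₊ n * ((G * c n : ℝ) : ℂ))
      (singSum s k ⌊D⌋₊ n * ((G * (c n - H * N) : ℝ) : ℂ))
    simp only [hδ]
    rw [add_mul, add_mul]
    linarith
  refine Asymptotics.isLittleO_iff.2 fun η hη => ?_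
  filter_upwards [hbound, hδ0.eventually_le_const hη] with n h1 h2
  refine h1.trans ?_
  have h3 : (0 : ℝ) ≤ (n : ℝ) ^ ((s : ℝ) / k - 1) := by positivity
  rw [Real.norm_of_nonneg h3]
  gcongr

end AsymptoticFormula

end WaringAsymptotics

/-- Corollary 9.3: the stated bounds for G̃(k), 12 ≤ k ≤ 20; that is, for each pair
(k, B) listed, the asymptotic formula holds for every s ≥ B. -/
theorem corollary9_3 :
    (∀ s : ℕ, 253 ≤ s → AsympFormula s 12) ∧
    (∀ s : ℕ, 299 ≤ s → AsympFormula s 13) ∧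
    (∀ s : ℕ, 349 ≤ s → AsympFormula s 14) ∧
    (∀ s : ℕ, 403 ≤ s → AsympFormula s 15) ∧
    (∀ s : ℕ, 460 ≤ s → AsympFormula s 16) ∧
    (∀ s : ℕ, 521 ≤ s → AsympFormula s 17) ∧
    (∀ s : ℕ, 587 ≤ s → AsympFormula s 18) ∧
    (∀ s : ℕ, 656 ≤ s → AsympFormula s 19) ∧
    (∀ s : ℕ, 729 ≤ s → AsympFormula s 20) := by
  refine ⟨?_, ?_, ?_, ?_, ?_, ?_, ?_, ?_, ?_⟩ <;>
    exact fun s hs => asympFormula_of_le (by norm_num) (by omega)
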